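/- arXiv:math/9902077 — 4 statements merged into one kernel-verified Lean document; each statement's English description precedes it below -/
import Mathlib

section
/- For every natural number m with 0 ≤ m ≤ 4, there exists an irreducible homogeneous polynomial f ∈ ℂ[x₀,x₁,x₂,x₃] of degree 3 such that the set of points of ℙ³(ℂ) at which all four partial derivatives of f vanish is finite of cardinality exactly m, and at every such point the 4×4 Hessian matrix of second partial derivatives of f has rank 3. -/
open MvPolynomial

/-- The singular locus in `ℙ³(ℂ)` of the surface `f = 0` has the cardinality of any set `A` of
nonzero vectors containing exactly one representative of each singular point. -/
theorem finite_and_card_singularLocus (f : MvPolynomial (Fin 4) ℂ) (A : Set (Fin 4 → ℂ))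
    (hA : A.Finite) (h0 : ∀ a ∈ A, a ≠ 0)
    (hinj : ∀ a ∈ A, ∀ b ∈ A, ∀ c : ℂ, c • a = b → b = a)
    (hsing : ∀ v : Fin 4 → ℂ, v ≠ 0 →
      ((∀ i, eval v (pderiv i f) = 0) ↔ ∃ c : ℂ, ∃ a ∈ A, c • a = v)) :
    {x : Projectivization ℂ (Fin 4 → ℂ) | ∀ i : Fin 4, eval x.rep (pderiv i f) = 0}.Finite ∧
      Nat.card {x : Projectivization ℂ (Fin 4 → ℂ) |
        ∀ i : Fin 4, eval x.rep (pderiv i f) = 0} = A.ncard := by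
  let g : A → Projectivization ℂ (Fin 4 → ℂ) := fun a => .mk ℂ a.1 (h0 a.1 a.2)
  have hg : Function.Injective g := by
    rintro ⟨a, ha⟩ ⟨b, hb⟩ h
    obtain ⟨c, hc⟩ := (Projectivization.mk_eq_mk_iff' ℂ _ _ _ _).1 h
    exact Subtype.ext (hinj b hb a ha c hc)
  have hrange : {x : Projectivization ℂ (Fin 4 → ℂ) |
      ∀ i : Fin 4, eval x.rep (pderiv i f) = 0} = Set.range g := by
    ext x
    rw [Set.mem_ofPred_eq, hsing x.rep x.rep_nonzero, Set.mem_range]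
    constructor
    · rintro ⟨c, a, ha, hc⟩
      refine ⟨⟨a, ha⟩, ?_⟩
      conv_rhs => rw [← x.mk_rep]
      exact ((Projectivization.mk_eq_mk_iff' ℂ _ _ _ _).2 ⟨c, hc⟩).symm
    · rintro ⟨⟨a, ha⟩, hx⟩
      rw [← x.mk_rep] at hx
      obtain ⟨c, hc⟩ := (Projectivization.mk_eq_mk_iff' ℂ _ _ _ _).1 hx.symm
      exact ⟨c, a, ha, hc⟩
  have := hA.to_subtype
  rw [hrange]
  exact ⟨Set.finite_range g, Nat.card_range_of_injective hg⟩

/-- A singular `4 × 4` matrix with a nonvanishing `3 × 3` minor has rank `3`. -/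
theorem Matrix.rank_eq_three_of_minor {K : Type*} [Field K] (M : Matrix (Fin 4) (Fin 4) K)
    {v : Fin 4 → K} (hv : v ≠ 0) (hMv : M.mulVec v = 0) (r : Fin 3 → Fin 4)
    (hdet : (M.submatrix r r).det ≠ 0) : M.rank = 3 := by
  apply le_antisymm
  · have hker : 0 < Module.finrank K (LinearMap.ker M.mulVecLin) := by
      refine Module.finrank_pos_iff_exists_ne_zero.2 ⟨⟨v, by simpa using hMv⟩, ?_⟩
      simpa [Subtype.ext_iff] using hv
    have := LinearMap.finrank_range_add_finrank_ker M.mulVecLin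
    rw [Module.finrank_fin_fun] at this
    rw [Matrix.rank]
    omega
  · have h := Matrix.rank_of_det_ne_zero hdet
    rw [Fintype.card_fin] at h
    exact h ▸ Matrix.rank_submatrix_le M r r

/-- Eisenstein's criterion for a depressed cubic at the maximal ideal of a point: the constant
coefficient vanishes to order exactly one there. -/
theorem irreducible_cubic_of_pderiv_ne_zero {n : ℕ} {K : Type*} [Field K]
    (p q : MvPolynomial (Fin n) K) (x : Fin n → K) (hp : eval x p = 0) (hq : eval x q = 0)
    (i : Fin n) (hd : eval x (pderiv i q) ≠ 0) :
    Irreducible (Polynomial.X ^ 3 + (Polynomial.C p * Polynomial.X + Polynomial.C q)) := by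
  have hlt : (Polynomial.C p * Polynomial.X + Polynomial.C q).degree < ((3 : ℕ) : WithBot ℕ) :=
    Polynomial.degree_linear_le.trans_lt (Nat.cast_lt.2 (by norm_num : 1 < 3))
  have hdeg := Polynomial.degree_add_eq_left_of_degree_lt
    (hlt.trans_eq (Polynomial.degree_X_pow 3).symm)
  rw [Polynomial.degree_X_pow] at hdeg
  have hmonic := Polynomial.monic_X_pow_add hlt
  refine Polynomial.irreducible_of_eisenstein_criterion
    (P := RingHom.ker (eval x)) (RingHom.ker_isPrime _) ?_ ?_ ?_ ?_ hmonic.isPrimitive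
  · simp [hmonic.leadingCoeff]
  · intro k hk
    rw [hdeg, Nat.cast_lt] at hk
    interval_cases k <;>
      simp [RingHom.mem_ker, hp, hq, Polynomial.coeff_X, Polynomial.coeff_X_pow,
        Polynomial.coeff_C]
  · rw [hdeg]; norm_num
  · intro h
    have key : ∀ s ∈ RingHom.ker (eval x) ^ 2, eval x (pderiv i s) = 0 := by
      intro s hs
      rw [pow_two] at hs
      induction hs using Submodule.mul_induction_on' with
      | mem_mul_mem a ha b hb =>
        rw [RingHom.mem_ker] at ha hb
        simp [Derivation.leibniz, ha, hb]
      | add a _ b _ ha hb => simp [ha, hb]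
    exact hd (by simpa [Polynomial.coeff_X_pow] using key _ h)

theorem last_ne_zero_of_sq_eq {v : Fin 4 → ℂ} (hv : v ≠ 0) (h0 : v 0 ^ 2 = v 3 ^ 2)
    (h1 : v 1 ^ 2 = v 3 ^ 2) (h2 : v 2 ^ 2 = v 3 ^ 2) : v 3 ≠ 0 := by
  intro hz
  simp only [hz, ne_eq, OfNat.ofNat_ne_zero, not_false_eq_true, zero_pow,
    pow_eq_zero_iff] at h0 h1 h2
  exact hv (funext fun i => by fin_cases i <;> assumption)

/-- The sum of the cubics `x³ - 3x`, `y³ - 3y` and `b³(z³ - 3z)`, translated by `2k` and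
homogenized. -/
noncomputable def critCubic (b k : ℂ) : MvPolynomial (Fin 4) ℂ :=
  X 0 ^ 3 - C 3 * X 0 * X 3 ^ 2 + (X 1 ^ 3 - C 3 * X 1 * X 3 ^ 2)
    + C (b ^ 3) * (X 2 ^ 3 - C 3 * X 2 * X 3 ^ 2) + C (2 * k) * X 3 ^ 3

theorem critCubic_irreducible (b k : ℂ) (hb : b ≠ 0) : Irreducible (critCubic b k) := by
  rw [← MulEquiv.irreducible_iff (finSuccEquiv ℂ 3)]
  have h1 : finSuccEquiv ℂ 3 (X 1) = Polynomial.C (X 0) := finSuccEquiv_X_succ (j := 0)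
  have h2 : finSuccEquiv ℂ 3 (X 2) = Polynomial.C (X 1) := finSuccEquiv_X_succ (j := 1)
  have h3 : finSuccEquiv ℂ 3 (X 3) = Polynomial.C (X 2) := finSuccEquiv_X_succ (j := 2)
  have hC (c : ℂ) : finSuccEquiv ℂ 3 (C c) = Polynomial.C (C c) := by simp [finSuccEquiv_apply]
  convert irreducible_cubic_of_pderiv_ne_zero (K := ℂ) (n := 3) (- (C 3 * X 2 ^ 2))
    (X 0 ^ 3 - C 3 * X 0 * X 2 ^ 2 + C (b ^ 3) * (X 1 ^ 3 - C 3 * X 1 * X 2 ^ 2)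
      + C (2 * k) * X 2 ^ 3) ![-b, 1, 0] ?_ ?_ 0 ?_ using 1
  · simp only [critCubic, map_add, map_sub, map_mul, map_pow, map_neg, finSuccEquiv_X_zero, h1, h2,
      h3, hC]
    ring
  · simp
  · simp; ring
  · simp [Derivation.leibniz, Derivation.leibniz_pow, pderiv_X, hb]

theorem critCubic_isHomogeneous (b k : ℂ) : (critCubic b k).IsHomogeneous 3 := by
  have hX (i : Fin 4) : (X i ^ 3 : MvPolynomial (Fin 4) ℂ).IsHomogeneous 3 :=
    isHomogeneous_X_pow i 3
  have hXX (i : Fin 4) : (C 3 * X i * X 3 ^ 2 : MvPolynomial (Fin 4) ℂ).IsHomogeneous 3 :=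
    (isHomogeneous_C_mul_X 3 i).mul (isHomogeneous_X_pow 3 2)
  exact ((((hX 0).sub (hXX 0)).add ((hX 1).sub (hXX 1))).add
    (((hX 2).sub (hXX 2)).C_mul _)).add ((hX 3).C_mul _)

theorem critCubic_gradient (b k : ℂ) (hb : b ≠ 0) (v : Fin 4 → ℂ) :
    (∀ i, eval v (pderiv i (critCubic b k)) = 0) ↔
      v 0 ^ 2 = v 3 ^ 2 ∧ v 1 ^ 2 = v 3 ^ 2 ∧ v 2 ^ 2 = v 3 ^ 2 ∧
        (v 0 + v 1 + b ^ 3 * v 2 - k * v 3) * v 3 = 0 := by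
  have h0 : eval v (pderiv 0 (critCubic b k)) = 3 * (v 0 ^ 2 - v 3 ^ 2) := by
    simp [critCubic, Derivation.leibniz, Derivation.leibniz_pow, pderiv_X]
    ring
  have h1 : eval v (pderiv 1 (critCubic b k)) = 3 * (v 1 ^ 2 - v 3 ^ 2) := by
    simp [critCubic, Derivation.leibniz, Derivation.leibniz_pow, pderiv_X]
    ring
  have h2 : eval v (pderiv 2 (critCubic b k)) = 3 * b ^ 3 * (v 2 ^ 2 - v 3 ^ 2) := by
    simp [critCubic, Derivation.leibniz, Derivation.leibniz_pow, pderiv_X]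
    ring
  have h3 : eval v (pderiv 3 (critCubic b k)) =
      -6 * ((v 0 + v 1 + b ^ 3 * v 2 - k * v 3) * v 3) := by
    simp [critCubic, Derivation.leibniz, Derivation.leibniz_pow, pderiv_X]
    ring
  rw [Fin.forall_fin_succ, Fin.forall_fin_succ, Fin.forall_fin_succ, Fin.forall_fin_one]
  change _ ∧ eval v (pderiv 1 _) = 0 ∧ eval v (pderiv 2 _) = 0 ∧ eval v (pderiv 3 _) = 0 ↔ _
  rw [h0, h1, h2, h3]
  simp [hb, sub_eq_zero]

theorem critCubic_hessian (b k : ℂ) (v : Fin 4 → ℂ) :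
    (Matrix.of fun i j : Fin 4 => eval v (pderiv i (pderiv j (critCubic b k)))) =
      !![6 * v 0, 0, 0, -6 * v 3;
         0, 6 * v 1, 0, -6 * v 3;
         0, 0, 6 * b ^ 3 * v 2, -6 * b ^ 3 * v 3;
         -6 * v 3, -6 * v 3, -6 * b ^ 3 * v 3,
          -6 * (v 0 + v 1 + b ^ 3 * v 2 - 2 * k * v 3)] := by
  have hnat (i : Fin 4) (n : ℕ) [n.AtLeastTwo] :
      pderiv i (OfNat.ofNat n : MvPolynomial (Fin 4) ℂ) = 0 := Derivation.map_natCast _ n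
  ext i j
  fin_cases i <;> fin_cases j <;>
    simp [critCubic, Derivation.leibniz, Derivation.leibniz_pow, pderiv_X, Pi.single_apply,
      hnat] <;>
    ring

theorem critCubic_hessian_rank (b k : ℂ) (hb : b ≠ 0) (v : Fin 4 → ℂ) (hv : v ≠ 0)
    (h : ∀ i, eval v (pderiv i (critCubic b k)) = 0) :
    (Matrix.of fun i j : Fin 4 =>
      eval v (pderiv i (pderiv j (critCubic b k)))).rank = 3 := by
  rw [critCubic_gradient b k hb] at h
  obtain ⟨h0, h1, h2, h3⟩ := h
  have hv3 := last_ne_zero_of_sq_eq hv h0 h1 h2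
  have hne {z : ℂ} (hz : z ^ 2 = v 3 ^ 2) : z ≠ 0 := by
    rintro rfl
    exact hv3 (by simpa using hz.symm)
  rw [critCubic_hessian]
  refine Matrix.rank_eq_three_of_minor _ hv ?_ ![0, 1, 2] ?_
  · ext i
    fin_cases i <;> simp [Matrix.mulVec, dotProduct, Fin.sum_univ_four]
    · linear_combination 6 * h0
    · linear_combination 6 * h1
    · linear_combination 6 * b ^ 3 * h2
    · linear_combination -12 * h3
  · convert_to (Matrix.diagonal ![6 * v 0, 6 * v 1, 6 * b ^ 3 * v 2]).det ≠ 0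
    · congr 1
      ext i j
      fin_cases i <;> fin_cases j <;> simp
    rw [Matrix.det_diagonal]
    simp [Fin.prod_univ_three, hb, hne h0, hne h1, hne h2]

/-- The singular points of `critCubic b k` in the chart where the last coordinate is `1`. -/
theorem critCubic_singularLocus (b k : ℂ) (hb : b ≠ 0) (A : Set (Fin 4 → ℂ)) (hA : A.Finite)
    (hmem : ∀ s t u : ℂ, s ^ 2 = 1 → t ^ 2 = 1 → u ^ 2 = 1 →
      (s + t + b ^ 3 * u = k ↔ ![s, t, u, 1] ∈ A))
    (hsq : ∀ a ∈ A, a 0 ^ 2 = 1 ∧ a 1 ^ 2 = 1 ∧ a 2 ^ 2 = 1 ∧ a 3 = 1) :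
    {x : Projectivization ℂ (Fin 4 → ℂ) |
        ∀ i : Fin 4, eval x.rep (pderiv i (critCubic b k)) = 0}.Finite ∧
      Nat.card {x : Projectivization ℂ (Fin 4 → ℂ) |
        ∀ i : Fin 4, eval x.rep (pderiv i (critCubic b k)) = 0} = A.ncard := by
  have hvec (a : Fin 4 → ℂ) (ha : a 3 = 1) : ![a 0, a 1, a 2, 1] = a := by
    ext i; fin_cases i <;> simp [ha]
  apply finite_and_card_singularLocus _ A hA
  · rintro a ha rfl
    simpa using (hsq 0 ha).2.2.2
  · rintro a ha c hc z rfl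
    have hz := (hsq _ hc).2.2.2
    rw [Pi.smul_apply, (hsq a ha).2.2.2, smul_eq_mul, mul_one] at hz
    rw [hz, one_smul]
  · intro v hv
    rw [critCubic_gradient b k hb]
    constructor
    · rintro ⟨h0, h1, h2, h3⟩
      have hv3 := last_ne_zero_of_sq_eq hv h0 h1 h2
      refine ⟨v 3, ![v 0 / v 3, v 1 / v 3, v 2 / v 3, 1], ?_, ?_⟩
      · have hdiv {z : ℂ} (hz : z ^ 2 = v 3 ^ 2) : (z / v 3) ^ 2 = 1 := by
          rw [div_pow, hz, div_self (pow_ne_zero 2 hv3)]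
        refine (hmem _ _ _ (hdiv h0) (hdiv h1) (hdiv h2)).1 ?_
        have := (mul_eq_zero.1 h3).resolve_right hv3
        field_simp
        linear_combination this
      · ext i
        fin_cases i <;> simp [mul_div_cancel₀, hv3]
    · rintro ⟨c, a, ha, rfl⟩
      obtain ⟨h0, h1, h2, h3⟩ := hsq a ha
      have hk := (hmem _ _ _ h0 h1 h2).2 (by rwa [hvec a h3])
      simp only [Pi.smul_apply, smul_eq_mul, mul_pow, h0, h1, h2, h3, mul_one, true_and]
      linear_combination c ^ 2 * hk

theorem exists_nodal_cubic_of_critCubic (b k : ℂ) (hb : b ≠ 0) (A : Set (Fin 4 → ℂ))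
    (hA : A.Finite)
    (hmem : ∀ s t u : ℂ, s ^ 2 = 1 → t ^ 2 = 1 → u ^ 2 = 1 →
      (s + t + b ^ 3 * u = k ↔ ![s, t, u, 1] ∈ A))
    (hsq : ∀ a ∈ A, a 0 ^ 2 = 1 ∧ a 1 ^ 2 = 1 ∧ a 2 ^ 2 = 1 ∧ a 3 = 1) :
    ∃ f : MvPolynomial (Fin 4) ℂ,
      Irreducible f ∧ f.IsHomogeneous 3 ∧
      {x : Projectivization ℂ (Fin 4 → ℂ) |
          ∀ i : Fin 4, eval x.rep (pderiv i f) = 0}.Finite ∧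
      Nat.card {x : Projectivization ℂ (Fin 4 → ℂ) |
          ∀ i : Fin 4, eval x.rep (pderiv i f) = 0} = A.ncard ∧
      ∀ x : Projectivization ℂ (Fin 4 → ℂ),
        (∀ i : Fin 4, eval x.rep (pderiv i f) = 0) →
        (Matrix.of fun i j : Fin 4 =>
          eval x.rep (pderiv i (pderiv j f))).rank = 3 :=
  have h := critCubic_singularLocus b k hb A hA hmem hsq
  ⟨critCubic b k, critCubic_irreducible b k hb, critCubic_isHomogeneous b k, h.1, h.2,
    fun x hx => critCubic_hessian_rank b k hb x.rep x.rep_nonzero hx⟩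

/-- The Cayley cubic. -/
noncomputable def cayleyCubic : MvPolynomial (Fin 4) ℂ :=
  (X 1 * X 2 + X 1 * X 3 + X 2 * X 3) * X 0 + X 1 * X 2 * X 3

theorem cayleyCubic_irreducible : Irreducible cayleyCubic := by
  have hX (i : Fin 4) (x : Fin 4 → ℂ) (hx : x i = 0)
      (hQ : x 1 * x 2 + x 1 * x 3 + x 2 * x 3 ≠ 0) :
      IsRelPrime (X 1 * X 2 + X 1 * X 3 + X 2 * X 3 : MvPolynomial (Fin 4) ℂ) (X i) := by
    refine IsRelPrime.symm (((X_prime (i := i)).irreducible.isRelPrime_iff_not_dvd).2 ?_)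
    rintro ⟨q, hq⟩
    apply hQ
    simpa [hx] using congrArg (eval x) hq
  have hvar (i : Fin 4) (hi : 0 ≠ i) : (0 : Fin 4) ∉ (X i : MvPolynomial (Fin 4) ℂ).vars := by
    simpa using hi
  have hadd {p q : MvPolynomial (Fin 4) ℂ} (hp : 0 ∉ p.vars) (hq : 0 ∉ q.vars) :
      0 ∉ (p + q).vars := fun h => by simpa [hp, hq] using vars_add_subset p q h
  have hmul {p q : MvPolynomial (Fin 4) ℂ} (hp : 0 ∉ p.vars) (hq : 0 ∉ q.vars) :
      0 ∉ (p * q).vars := fun h => by simpa [hp, hq] using vars_mul p q h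
  have h1 := hvar 1 (by decide)
  have h2 := hvar 2 (by decide)
  have h3 := hvar 3 (by decide)
  refine irreducible_mul_X_add _ _ 0 ?_ ?_ ?_ ?_
  · intro h
    simpa using congrArg (eval ![0, 1, 1, 0]) h
  · exact hadd (hadd (hmul h1 h2) (hmul h1 h3)) (hmul h2 h3)
  · exact hmul (hmul h1 h2) h3
  · exact ((hX 1 ![0, 0, 1, 1] rfl (by simp)).mul_right
      (hX 2 ![0, 1, 0, 1] rfl (by simp))).mul_right (hX 3 ![0, 1, 1, 0] rfl (by simp))

theorem cayleyCubic_isHomogeneous : cayleyCubic.IsHomogeneous 3 := by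
  have hX (i : Fin 4) := isHomogeneous_X ℂ i
  exact (((((hX 1).mul (hX 2)).add ((hX 1).mul (hX 3))).add ((hX 2).mul (hX 3))).mul (hX 0)).add
    (((hX 1).mul (hX 2)).mul (hX 3))

theorem cayleyCubic_gradient (v : Fin 4 → ℂ) :
    (∀ i, eval v (pderiv i cayleyCubic) = 0) ↔ ∃ i : Fin 4, ∃ c : ℂ, c • Pi.single i 1 = v := by
  have h0 : eval v (pderiv 0 cayleyCubic) = v 1 * v 2 + v 1 * v 3 + v 2 * v 3 := by
    simp [cayleyCubic, Derivation.leibniz, pderiv_X]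
  have h1 : eval v (pderiv 1 cayleyCubic) = v 0 * v 2 + v 0 * v 3 + v 2 * v 3 := by
    simp [cayleyCubic, Derivation.leibniz, pderiv_X]
    ring
  have h2 : eval v (pderiv 2 cayleyCubic) = v 0 * v 1 + v 0 * v 3 + v 1 * v 3 := by
    simp [cayleyCubic, Derivation.leibniz, pderiv_X]
    ring
  have h3 : eval v (pderiv 3 cayleyCubic) = v 0 * v 1 + v 0 * v 2 + v 1 * v 2 := by
    simp [cayleyCubic, Derivation.leibniz, pderiv_X]
    ring
  rw [Fin.forall_fin_succ, Fin.forall_fin_succ, Fin.forall_fin_succ, Fin.forall_fin_one]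
  change _ ∧ eval v (pderiv 1 _) = 0 ∧ eval v (pderiv 2 _) = 0 ∧ eval v (pderiv 3 _) = 0 ↔ _
  rw [h0, h1, h2, h3]
  constructor
  · rintro ⟨h0, h1, h2, h3⟩
    have e0 : v 0 * (v 1 + v 2 + v 3) = 0 := by linear_combination (h1 + h2 + h3 - h0) / 2
    have e1 : v 1 * (v 0 + v 2 + v 3) = 0 := by linear_combination (h0 + h2 + h3 - h1) / 2
    have e2 : v 2 * (v 0 + v 1 + v 3) = 0 := by linear_combination (h0 + h1 + h3 - h2) / 2
    have e3 : v 3 * (v 0 + v 1 + v 2) = 0 := by linear_combination (h0 + h1 + h2 - h3) / 2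
    have key : (v 1 = 0 ∧ v 2 = 0 ∧ v 3 = 0) ∨ (v 0 = 0 ∧ v 2 = 0 ∧ v 3 = 0) ∨
        (v 0 = 0 ∧ v 1 = 0 ∧ v 3 = 0) ∨ (v 0 = 0 ∧ v 1 = 0 ∧ v 2 = 0) := by
      rw [mul_eq_zero] at e0 e1 e2 e3
      grind
    rcases key with ⟨ha, hb, hc⟩ | ⟨ha, hb, hc⟩ | ⟨ha, hb, hc⟩ | ⟨ha, hb, hc⟩
    · exact ⟨0, v 0, by ext i; fin_cases i <;> simp [ha, hb, hc]⟩
    · exact ⟨1, v 1, by ext i; fin_cases i <;> simp [ha, hb, hc]⟩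
    · exact ⟨2, v 2, by ext i; fin_cases i <;> simp [ha, hb, hc]⟩
    · exact ⟨3, v 3, by ext i; fin_cases i <;> simp [ha, hb, hc]⟩
  · rintro ⟨i, c, rfl⟩
    fin_cases i <;> simp

theorem cayleyCubic_hessian (v : Fin 4 → ℂ) :
    (Matrix.of fun i j : Fin 4 => eval v (pderiv i (pderiv j cayleyCubic))) =
      !![0, v 2 + v 3, v 1 + v 3, v 1 + v 2;
         v 2 + v 3, 0, v 0 + v 3, v 0 + v 2;
         v 1 + v 3, v 0 + v 3, 0, v 0 + v 1;
         v 1 + v 2, v 0 + v 2, v 0 + v 1, 0] := by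
  ext i j
  fin_cases i <;> fin_cases j <;>
    simp [cayleyCubic, Derivation.leibniz, pderiv_X, Pi.single_apply]

theorem cayleyCubic_hessian_rank (v : Fin 4 → ℂ) (hv : v ≠ 0)
    (h : ∀ i, eval v (pderiv i cayleyCubic) = 0) :
    (Matrix.of fun i j : Fin 4 => eval v (pderiv i (pderiv j cayleyCubic))).rank = 3 := by
  obtain ⟨i, c, rfl⟩ := (cayleyCubic_gradient v).1 h
  have hc : c ≠ 0 := by
    rintro rfl
    simp at hv
  rw [cayleyCubic_hessian]
  refine Matrix.rank_eq_three_of_minor _ hv ?_ i.succAbove ?_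
  · ext j
    fin_cases i <;> fin_cases j <;> simp [Matrix.mulVec, dotProduct, Fin.sum_univ_four]
  · fin_cases i <;> simp [Matrix.det_fin_three, hc, Fin.succAbove]

theorem cayleyCubic_singularLocus :
    {x : Projectivization ℂ (Fin 4 → ℂ) |
        ∀ i : Fin 4, eval x.rep (pderiv i cayleyCubic) = 0}.Finite ∧
      Nat.card {x : Projectivization ℂ (Fin 4 → ℂ) |
        ∀ i : Fin 4, eval x.rep (pderiv i cayleyCubic) = 0} = 4 := by
  have hinj : Function.Injective fun i : Fin 4 => (Pi.single i 1 : Fin 4 → ℂ) := fun i j h => by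
    simpa [Pi.single_apply] using congrFun h i
  have hcard : (Set.range fun i : Fin 4 => (Pi.single i 1 : Fin 4 → ℂ)).ncard = 4 := by
    rw [← Set.image_univ, Set.ncard_image_of_injective _ hinj]
    simp
  refine (?_ : _ ∧ _ = _) |>.imp_right (·.trans hcard)
  apply finite_and_card_singularLocus _ _ (Set.finite_range _)
  · rintro _ ⟨i, rfl⟩
    simp
  · rintro _ ⟨i, rfl⟩ _ ⟨j, rfl⟩ c hc
    have := congrFun hc j
    by_cases hij : i = j
    · rw [hij]
    · simp [Ne.symm hij] at this
  · intro v _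
    rw [cayleyCubic_gradient]
    simp only [Set.exists_range_iff]
    exact exists_comm

theorem exists_nodal_cubic (m : ℕ) (hm : m ≤ 4) :
    ∃ f : MvPolynomial (Fin 4) ℂ,
      Irreducible f ∧ f.IsHomogeneous 3 ∧
      {x : Projectivization ℂ (Fin 4 → ℂ) |
          ∀ i : Fin 4, eval x.rep (pderiv i f) = 0}.Finite ∧
      Nat.card {x : Projectivization ℂ (Fin 4 → ℂ) |
          ∀ i : Fin 4, eval x.rep (pderiv i f) = 0} = m ∧
      ∀ x : Projectivization ℂ (Fin 4 → ℂ),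
        (∀ i : Fin 4, eval x.rep (pderiv i f) = 0) →
        (Matrix.of fun i j : Fin 4 =>
          eval x.rep (pderiv i (pderiv j f))).rank = 3 := by
  have hsign {z : ℂ} (hz : z ^ 2 = 1) : z = 1 ∨ z = -1 := by
    simpa using hz
  interval_cases m
  · simpa using exists_nodal_cubic_of_critCubic 1 0 one_ne_zero ∅ Set.finite_empty
      (by
        intro s t u hs ht hu
        rcases hsign hs with rfl | rfl <;> rcases hsign ht with rfl | rfl <;>
          rcases hsign hu with rfl | rfl <;> norm_num)
      (by simp)
  · simpa using exists_nodal_cubic_of_critCubic 1 3 one_ne_zero {![1, 1, 1, 1]}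
      (Set.toFinite _)
      (by
        intro s t u hs ht hu
        rcases hsign hs with rfl | rfl <;> rcases hsign ht with rfl | rfl <;>
          rcases hsign hu with rfl | rfl <;> norm_num)
      (by simp)
  · have h := exists_nodal_cubic_of_critCubic 2 8 (by norm_num)
      {![1, -1, 1, 1], ![-1, 1, 1, 1]} (Set.toFinite _)
      (by
        intro s t u hs ht hu
        rcases hsign hs with rfl | rfl <;> rcases hsign ht with rfl | rfl <;>
          rcases hsign hu with rfl | rfl <;> norm_num)
      (by simp)
    rwa [Set.ncard_pair (fun h => by have := congrFun h 0; norm_num at this)] at h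
  · have h := exists_nodal_cubic_of_critCubic 1 1 (by norm_num)
      {![1, 1, -1, 1], ![1, -1, 1, 1], ![-1, 1, 1, 1]} (Set.toFinite _)
      (by
        intro s t u hs ht hu
        rcases hsign hs with rfl | rfl <;> rcases hsign ht with rfl | rfl <;>
          rcases hsign hu with rfl | rfl <;> norm_num)
      (by simp)
    rwa [Set.ncard_insert_of_notMem, Set.ncard_pair] at h
    · exact fun h => by have := congrFun h 0; norm_num at this
    · norm_num
  · exact ⟨cayleyCubic, cayleyCubic_irreducible, cayleyCubic_isHomogeneous,
      cayleyCubic_singularLocus.1, cayleyCubic_singularLocus.2,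
      fun x hx => cayleyCubic_hessian_rank x.rep x.rep_nonzero hx⟩
end

section
/- For every natural number m with 0 ≤ m ≤ 16, there exists an irreducible homogeneous polynomial f ∈ ℂ[x₀,x₁,x₂,x₃] of degree 4 such that the set of points of ℙ³(ℂ) at which all four partial derivatives of f vanish is finite of cardinality exactly m, and at every such point the 4×4 Hessian matrix of second partial derivatives of f has rank 3. -/
open MvPolynomial

section CommonZeros

variable {σ K : Type*} [Finite σ] [Field K]

/-- Translation by `a`, as an automorphism of the polynomial ring. -/
noncomputable def MvPolynomial.translate {σ K : Type*} [CommRing K] (a : σ → K) :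
    MvPolynomial σ K ≃ₐ[K] MvPolynomial σ K :=
  AlgEquiv.ofAlgHom (aeval fun i => X i + C (a i)) (aeval fun i => X i - C (a i))
    (by ext; simp) (by ext; simp)

theorem MvPolynomial.eval_translate {σ K : Type*} [CommRing K] (a x : σ → K)
    (p : MvPolynomial σ K) : eval x (translate a p) = eval (x + a) p := by
  have : (aeval x).comp (translate a).toAlgHom = aeval (R := K) (x + a) := by
    ext i; simp [translate]
  simpa [coe_aeval_eq_eval] using congrArg (fun φ => φ p) this

theorem MvPolynomial.height_vanishingIdeal_singleton [IsAlgClosed K] (x : σ → K) :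
    (vanishingIdeal K {x} : Ideal (MvPolynomial σ K)).height = Nat.card σ := by
  have hdim : ringKrullDim (MvPolynomial σ K) = Nat.card σ := by
    rw [ringKrullDim_of_isNoetherianRing, ringKrullDim_eq_zero_of_field, zero_add]
  have : FiniteRingKrullDim (MvPolynomial σ K) := by
    rw [finiteRingKrullDim_iff_ne_bot_and_top, hdim]
    exact ⟨by simp, WithBot.coe_injective.ne (ENat.natCast_ne_top (Nat.card σ))⟩
  obtain ⟨M, hM, hheight⟩ := Ideal.exists_isMaximal_height (R := MvPolynomial σ K)
  obtain ⟨a, rfl⟩ := eq_vanishingIdeal_singleton_of_isMaximal K hM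
  have hcomap : (vanishingIdeal K {a} : Ideal (MvPolynomial σ K)) =
      (vanishingIdeal K {x}).comap (translate (a - x)).toRingEquiv := by
    ext p
    simp [eval_translate]
  rw [hcomap, RingEquiv.height_comap, hdim] at hheight
  exact_mod_cast hheight

/-- Two hypersurfaces in affine space of dimension at least three that meet in a point
meet in another point. -/
theorem MvPolynomial.exists_ne_common_zero [IsAlgClosed K] (hσ : 2 < Nat.card σ)
    {g h : MvPolynomial σ K} {x : σ → K} (hg : eval x g = 0) (hh : eval x h = 0) :
    ∃ y, y ≠ x ∧ eval y g = 0 ∧ eval y h = 0 := by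
  by_contra! hne
  set I : Ideal (MvPolynomial σ K) := Ideal.span {g, h}
  have hle : I ≤ vanishingIdeal K {x} := by
    rw [Ideal.span_le]
    rintro p (rfl | rfl) <;> simpa [coe_aeval_eq_eval]
  obtain ⟨P, hP, hPx⟩ := Ideal.exists_minimalPrimes_le hle
  have := hP.1.1
  have hxP : vanishingIdeal K {x} ≤ P := by
    rw [← IsPrime.vanishingIdeal_zeroLocus (K := K) P]
    refine vanishingIdeal_anti_mono fun y hy => ?_
    have hgy : eval y g = 0 := hy g (hP.1.2 (Ideal.subset_span (by simp)))
    have hhy : eval y h = 0 := hy h (hP.1.2 (Ideal.subset_span (by simp)))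
    by_contra hyx
    exact hne y hyx hgy hhy
  have h1 : P.height ≤ ({g, h} : Set (MvPolynomial σ K)).ncard :=
    Ideal.height_le_card_of_mem_minimalPrimes_span (Set.toFinite _) hP
  have h2 := (Ideal.height_mono hxP).trans h1
  rw [height_vanishingIdeal_singleton] at h2
  have h3 := Set.ncard_insert_le g {h}
  rw [Set.ncard_singleton] at h3
  have h4 : Nat.card σ ≤ ({g, h} : Set (MvPolynomial σ K)).ncard := by exact_mod_cast h2
  omega

end CommonZeros

section Irreducibility

variable {σ K : Type*} [Field K]

theorem MvPolynomial.IsHomogeneous.eval_smul {f : MvPolynomial σ K} {d : ℕ}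
    (hf : f.IsHomogeneous d) (t : K) (x : σ → K) : eval (t • x) f = t ^ d * eval x f := by
  rw [eval_eq, eval_eq, Finset.mul_sum]
  refine Finset.sum_congr rfl fun e he => ?_
  have hdeg : ∑ i ∈ e.support, e i = d := by
    rw [← hf (mem_support_iff.1 he), Pi.one_def, ← Finsupp.degree_eq_weight_one, Finsupp.degree_apply]
  simp only [Pi.smul_apply, smul_eq_mul, mul_pow, Finset.prod_mul_distrib,
    Finset.prod_pow_eq_pow_sum, hdeg]
  ring

/-- A factor of a nonzero homogeneous polynomial that does not vanish at the origin is constant. -/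
theorem MvPolynomial.IsHomogeneous.isUnit_of_mul_eq [Infinite K] {f g h : MvPolynomial σ K} {d : ℕ}
    (hf : f.IsHomogeneous d) (hf0 : f ≠ 0) (hgh : f = g * h) (h0 : eval 0 h ≠ 0) : IsUnit h := by
  have hconst : ∀ x, eval x f ≠ 0 → eval x h = eval 0 h := by
    intro x hx
    let φ : MvPolynomial σ K →ₐ[K] Polynomial K :=
      MvPolynomial.aeval fun i => Polynomial.C (x i) * Polynomial.X
    have hφ : ∀ (p : MvPolynomial σ K) (t : K), (φ p).eval t = eval (t • x) p := by
      intro p t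
      have : (Polynomial.aeval t).comp φ = MvPolynomial.aeval (t • x) := by
        ext i; simp [φ, mul_comm t]
      simpa [coe_aeval_eq_eval, Polynomial.coe_aeval_eq_eval] using congrArg (fun ψ => ψ p) this
    have hfx : φ f = Polynomial.C (eval x f) * Polynomial.X ^ d := by
      refine Polynomial.funext fun t => ?_
      rw [hφ, hf.eval_smul, Polynomial.eval_mul, Polynomial.eval_C, Polynomial.eval_pow,
        Polynomial.eval_X, mul_comm]
    have hdvd : φ h ∣ Polynomial.X ^ d := by
      rw [← (Polynomial.isUnit_C.2 (isUnit_iff_ne_zero.2 hx)).dvd_mul_left (a := φ h), ← hfx, hgh,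
        map_mul]
      exact dvd_mul_left _ _
    obtain ⟨k, -, hk⟩ := (dvd_prime_pow Polynomial.prime_X d).1 hdvd
    obtain ⟨u, hu⟩ := hk.symm
    obtain ⟨c, hc, hcu⟩ := Polynomial.isUnit_iff.1 u.isUnit
    rw [← hcu] at hu
    have e0 := hφ h 0
    have e1 := hφ h 1
    rw [← hu, zero_smul] at e0
    rw [← hu, one_smul] at e1
    rcases Nat.eq_zero_or_pos k with rfl | hkpos
    · rw [← e0, ← e1]
      simp
    · refine absurd e0.symm ?_
      simpa [hkpos.ne'] using h0
  have hmul : f * (h - C (eval 0 h)) = 0 := by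
    refine MvPolynomial.funext fun x => ?_
    by_cases hx : eval x f = 0
    · simp [hx]
    · simp [hconst x hx]
  have := (mul_eq_zero.1 hmul).resolve_left hf0
  rw [sub_eq_zero.1 this]
  exact (isUnit_iff_ne_zero.2 h0).map C

/-- The Hessian of a product has rank at most two at a common zero of the factors. -/
theorem MvPolynomial.rank_hessian_mul_le [Fintype σ] {g h : MvPolynomial σ K} {x : σ → K}
    (hg : eval x g = 0) (hh : eval x h = 0) :
    (Matrix.of fun i j => eval x (pderiv i (pderiv j (g * h)))).rank ≤ 2 := by
  have : (Matrix.of fun i j => eval x (pderiv i (pderiv j (g * h)))) =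
      (Matrix.of fun i => ![eval x (pderiv i g), eval x (pderiv i h)]) *
        Matrix.of ![fun j => eval x (pderiv j h), fun j => eval x (pderiv j g)] := by
    ext i j
    simp [Derivation.leibniz, Matrix.mul_apply, hg, hh]
    ring
  rw [this]
  exact (Matrix.rank_mul_le_left _ _).trans 
    ((Matrix.rank_le_card_width _).trans_eq (Fintype.card_fin 2))

theorem MvPolynomial.IsHomogeneous.irreducible_of_hessian_rank [Fintype σ] [IsAlgClosed K]
    (hσ : 2 < Nat.card σ) {f : MvPolynomial σ K} {d : ℕ} (hf : f.IsHomogeneous d) (hd : d ≠ 0)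
    (hrank : ∀ x ≠ 0, (∀ i, eval x (pderiv i f) = 0) →
      2 < (Matrix.of fun i j => eval x (pderiv i (pderiv j f))).rank) :
    Irreducible f := by
  have hf0 : f ≠ 0 := by
    rintro rfl
    have : Nonempty σ := (Nat.card_pos_iff.1 (by omega)).1
    have h := hrank 1 one_ne_zero (by simp)
    have hz : (Matrix.of fun i j => eval (1 : σ → K) (pderiv i (pderiv j 0))) =
      (0 : Matrix σ σ K) := by ext; simp
    rw [hz, Matrix.rank_zero] at h
    omega
  have hinf : Infinite K := IsAlgClosed.instInfinite
  refine ⟨fun hu => ?_, fun {g h} hgh => ?_⟩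
  · obtain ⟨c, hc, rfl⟩ := isUnit_iff_eq_C_of_isReduced.1 hu
    exact hd (hf.inj_right (isHomogeneous_C σ c) hf0)
  · by_contra! hnu
    have hh : eval 0 h = 0 := by
      by_contra h0
      exact hnu.2 (hf.isUnit_of_mul_eq hf0 hgh h0)
    have hg : eval 0 g = 0 := by
      by_contra h0
      exact hnu.1 (hf.isUnit_of_mul_eq hf0 (hgh.trans (mul_comm g h)) h0)
    obtain ⟨y, hy, hgy, hhy⟩ := exists_ne_common_zero hσ hg hh
    refine (hrank y hy fun i => ?_).not_ge ?_
    · simp [hgh, Derivation.leibniz, hgy, hhy]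
    · rw [hgh]
      exact rank_hessian_mul_le hgy hhy

end Irreducibility

section SquareQuartic

variable {ι : Type*} [Fintype ι] [DecidableEq ι]

/-- The quartic form obtained from the quadratic form of `A` by squaring the variables. -/
noncomputable def squareQuartic (A : Matrix ι ι ℤ) : MvPolynomial ι ℂ :=
  ∑ i, ∑ j, C (A i j : ℂ) * (X i ^ 2 * X j ^ 2)

omit [DecidableEq ι] in
theorem isHomogeneous_squareQuartic (A : Matrix ι ι ℤ) : (squareQuartic A).IsHomogeneous 4 := by
  refine .sum _ _ _ fun i _ => .sum _ _ _ fun j _ => ?_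
  simpa using (isHomogeneous_C ι (A i j : ℂ)).mul
    (((isHomogeneous_X ℂ i).pow 2).mul ((isHomogeneous_X ℂ j).pow 2))

theorem pderiv_squareQuartic {A : Matrix ι ι ℤ} (hA : A.IsSymm) (k : ι) :
    pderiv k (squareQuartic A) = C 4 * (X k * ∑ j, C (A k j : ℂ) * X j ^ 2) := by
  have h : ∀ i j : ι, pderiv k (C (A i j : ℂ) * (X i ^ 2 * X j ^ 2) : MvPolynomial ι ℂ) =
      (if i = k then C (A i j : ℂ) * (C 2 * X i * X j ^ 2) else 0) +
      (if j = k then C (A i j : ℂ) * (C 2 * X j * X i ^ 2) else 0) := by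
    intro i j
    rw [pderiv_C_mul, pderiv_mul, pderiv_pow, pderiv_pow, pderiv_X, pderiv_X, map_ofNat C 2]
    simp only [Pi.single_apply]
    by_cases hi : i = k <;> by_cases hj : j = k <;> simp only [hi, hj, if_true, if_false] <;>
      push_cast <;> ring
  simp only [squareQuartic, map_sum, h, Finset.sum_add_distrib]
  rw [Finset.sum_comm]
  simp only [Finset.sum_ite_eq', Finset.mem_univ, if_true]
  simp only [fun i => hA.apply k i, Finset.mul_sum, ← Finset.sum_add_distrib]
  refine Finset.sum_congr rfl fun j _ => ?_
  have h2 : (C 2 : MvPolynomial ι ℂ) = 2 := map_ofNat C 2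
  have h4 : (C 4 : MvPolynomial ι ℂ) = 4 := map_ofNat C 4
  rw [h2, h4]
  ring

theorem eval_pderiv_squareQuartic {A : Matrix ι ι ℤ} (hA : A.IsSymm) (x : ι → ℂ) (k : ι) :
    eval x (pderiv k (squareQuartic A)) =
      4 * (x k * (A.map (Int.cast : ℤ → ℂ)).mulVec (x ^ 2) k) := by
  simp [pderiv_squareQuartic hA, Matrix.mulVec, dotProduct]

theorem eval_pderiv_squareQuartic_eq_zero_iff {A : Matrix ι ι ℤ} (hA : A.IsSymm) (x : ι → ℂ)
    (k : ι) : eval x (pderiv k (squareQuartic A)) = 0 ↔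
      x k = 0 ∨ (A.map (Int.cast : ℤ → ℂ)).mulVec (x ^ 2) k = 0 := by
  simp [eval_pderiv_squareQuartic hA]

theorem eval_pderiv_pderiv_squareQuartic {A : Matrix ι ι ℤ} (hA : A.IsSymm) (x : ι → ℂ)
    (i j : ι) : eval x (pderiv i (pderiv j (squareQuartic A))) =
      (if i = j then 4 * (A.map (Int.cast : ℤ → ℂ)).mulVec (x ^ 2) i else 0) +
        8 * (x i * A i j * x j) := by
  rw [pderiv_squareQuartic hA, pderiv_C_mul, pderiv_mul, pderiv_X]
  simp only [map_sum, pderiv_C_mul, pderiv_pow, pderiv_X, Pi.single_apply]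
  rw [← hA.apply i j]
  by_cases h : i = j
  · subst h
    simp [Matrix.mulVec, dotProduct]
    ring
  · simp [h, Ne.symm h]
    ring

/-- The matrix with the rows of `A` indexed by `I` and the rows of the identity matrix
elsewhere; its determinant is the principal minor of `A` on `I`. -/
def principalBlock (A : Matrix ι ι ℤ) (I : Finset ι) : Matrix ι ι ℤ :=
  Matrix.of fun i j => if i ∈ I then A i j else if i = j then 1 else 0

theorem eq_zero_of_det_principalBlock_ne_zero {A : Matrix ι ι ℤ} {I : Finset ι}
    (hdet : (principalBlock A I).det ≠ 0) {y : ι → ℂ}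
    (hAy : ∀ i ∈ I, (A.map (Int.cast : ℤ → ℂ)).mulVec y i = 0) (hy : ∀ i ∉ I, y i = 0) :
    y = 0 := by
  have hdet' : ((principalBlock A I).map (Int.cast : ℤ → ℂ)).det ≠ 0 := by
    have := Int.cast_det (R := ℂ) (principalBlock A I)
    rw [← this]
    exact_mod_cast hdet
  refine Matrix.eq_zero_of_mulVec_eq_zero hdet' (funext fun i => ?_)
  by_cases hi : i ∈ I
  · simpa [principalBlock, Matrix.mulVec, dotProduct, hi] using hAy i hi
  · simpa [principalBlock, Matrix.mulVec, dotProduct, hi] using hy i hi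

theorem eq_smul_of_det_principalBlock_erase_ne_zero {A : Matrix ι ι ℤ} {I : Finset ι} {k : ι}
    (hdet : (principalBlock A (I.erase k)).det ≠ 0) {w y : ι → ℂ} (hwk : w k ≠ 0)
    (hAw : ∀ i ∈ I, (A.map (Int.cast : ℤ → ℂ)).mulVec w i = 0) (hw : ∀ i ∉ I, w i = 0)
    (hAy : ∀ i ∈ I, (A.map (Int.cast : ℤ → ℂ)).mulVec y i = 0) (hy : ∀ i ∉ I, y i = 0) :
    y = (y k / w k) • w := by
  rw [← sub_eq_zero]
  refine eq_zero_of_det_principalBlock_ne_zero hdet (fun i hi => ?_) fun i hi => ?_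
  · have hi' := Finset.mem_of_mem_erase hi
    simp [Matrix.mulVec_sub, Matrix.mulVec_smul, hAw i hi', hAy i hi']
  · by_cases hik : i = k
    · subst hik; simp [hwk]
    · have hi' : i ∉ I := fun h => hi (Finset.mem_erase.2 ⟨hik, h⟩)
      simp [hw i hi', hy i hi']

end SquareQuartic

section Nodes

/-- The vectors `v` with entries at most two in absolute value and first nonzero entry `1`
that are singular points of `squareQuartic A`. -/
def nodeRepresentatives (A : Matrix (Fin 4) (Fin 4) ℤ) : Finset (Fin 4 → ℤ) :=
  (Fintype.piFinset fun _ => {-2, -1, 0, 1, 2}).filter fun v =>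
    (∃ k, v k = 1 ∧ ∀ j < k, v j = 0) ∧ ∀ i, v i = 0 ∨ A.mulVec (v ^ 2) i = 0

/-- A criterion, checkable by computation, for the singular points of `squareQuartic A` to be
nodes represented by `nodeRepresentatives A`. -/
def HasIntegralNodes (A : Matrix (Fin 4) (Fin 4) ℤ) : Prop :=
  ∀ I : Finset (Fin 4), (principalBlock A I).det ≠ 0 ∨
    (∃ k ∈ I, (principalBlock A (I.erase k)).det ≠ 0) ∧
    ∃ v ∈ nodeRepresentatives A, ∀ i, (v i ≠ 0 ↔ i ∈ I) ∧ (A.mulVec (v ^ 2) i = 0 ↔ i ∈ I)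

instance (A : Matrix (Fin 4) (Fin 4) ℤ) : Decidable (HasIntegralNodes A) := by
  unfold HasIntegralNodes; infer_instance

/-- Symmetric matrices whose `squareQuartic` has `m` nodes, for `m ≤ 16`. -/
def nodalMatrix : Fin 17 → Matrix (Fin 4) (Fin 4) ℤ := ![
  !![1, 0, 0, 0; 0, 1, 0, 0; 0, 0, 1, 0; 0, 0, 0, 1],
  !![-1, 0, 0, 1; 0, -1, 0, -1; 0, 0, -1, 1; 1, -1, 1, 0],
  !![-1, 0, 1, 0; 0, -1, 0, 1; 1, 0, 1, -1; 0, 1, -1, 1],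
  !![0, 1, -1, 1; 1, 0, 1, -1; -1, 1, -1, 1; 1, -1, 1, 0],
  !![1, -1, 0, -1; -1, 1, -1, 0; 0, -1, 1, -1; -1, 0, -1, -1],
  !![-1, 1, 1, 0; 1, 0, 1, -1; 1, 1, 1, 0; 0, -1, 0, 1],
  !![-1, 1, 1, 1; 1, -1, 0, 0; 1, 0, -1, 0; 1, 0, 0, -1],
  !![-1, 1, 1, -1; 1, -1, 1, 0; 1, 1, 0, -1; -1, 0, -1, 1],
  !![-1, 1, 0, 1; 1, -1, 1, 0; 0, 1, -1, 1; 1, 0, 1, -1],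
  !![0, -1, 1, 1; -1, 1, 0, 0; 1, 0, -1, 0; 1, 0, 0, -1],
  !![1, 0, -1, -1; 0, -1, 1, 1; -1, 1, 0, -1; -1, 1, -1, 0],
  !![0, -1, 1, -1; -1, 0, 1, 1; 1, 1, -2, 1; -1, 1, 1, 0],
  !![-1, -1, 1, 1; -1, 1, 0, 0; 1, 0, -1, 0; 1, 0, 0, -1],
  !![-24, 25, 28, -1; 25, -24, 28, -1; 28, 28, 0, -7; -1, -1, -7, 2],
  !![0, 1, 4, -1; 1, 0, 4, -1; 4, 4, 24, -7; -1, -1, -7, 2],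
  !![2, -1, -1, -1; -1, 0, 1, 1; -1, 1, 0, 1; -1, 1, 1, 0],
  !![2, -1, -1, -1; -1, 2, -1, -1; -1, -1, 2, -1; -1, -1, -1, 2]]

theorem isSymm_nodalMatrix : ∀ m, (nodalMatrix m).IsSymm := by
  unfold Matrix.IsSymm; decide +kernel

theorem card_nodeRepresentatives_nodalMatrix :
    ∀ m : Fin 17, (nodeRepresentatives (nodalMatrix m)).card = m := by
  decide +kernel

theorem hasIntegralNodes_nodalMatrix : ∀ m, HasIntegralNodes (nodalMatrix m) := by
  decide +kernel

theorem mem_nodeRepresentatives {A : Matrix (Fin 4) (Fin 4) ℤ} {v : Fin 4 → ℤ} :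
    v ∈ nodeRepresentatives A ↔ (∀ i, -2 ≤ v i ∧ v i ≤ 2) ∧
      (∃ k, v k = 1 ∧ ∀ j < k, v j = 0) ∧ ∀ i, v i = 0 ∨ A.mulVec (v ^ 2) i = 0 := by
  have h : ∀ a : ℤ, a = -2 ∨ a = -1 ∨ a = 0 ∨ a = 1 ∨ a = 2 ↔ -2 ≤ a ∧ a ≤ 2 := by omega
  simp only [nodeRepresentatives, Finset.mem_filter, Fintype.mem_piFinset, Finset.mem_insert,
    Finset.mem_singleton, h]

theorem mulVec_intCast_sq (A : Matrix (Fin 4) (Fin 4) ℤ) (v : Fin 4 → ℤ) (i : Fin 4) :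
    (A.map (Int.cast : ℤ → ℂ)).mulVec ((fun j => (v j : ℂ)) ^ 2) i =
      (A.mulVec (v ^ 2) i : ℤ) := by
  simp [Matrix.mulVec, dotProduct]

variable {A : Matrix (Fin 4) (Fin 4) ℤ} (hA : HasIntegralNodes A) {x : Fin 4 → ℂ} (hx : x ≠ 0)
  (hsing : ∀ i, x i = 0 ∨ (A.map (Int.cast : ℤ → ℂ)).mulVec (x ^ 2) i = 0)
include hA hx hsing

/-- Up to scaling, the squares of the coordinates of a singular point agree with those of
one of the representatives, and the kernel on the support is one-dimensional. -/
theorem HasIntegralNodes.exists_sq_eq_smul :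
    ∃ v ∈ nodeRepresentatives A, ∃ c : ℂ, c ≠ 0 ∧ (∀ i, x i ^ 2 = c * (v i : ℂ) ^ 2) ∧
      (∀ i, x i = 0 → (A.map (Int.cast : ℤ → ℂ)).mulVec (x ^ 2) i ≠ 0) ∧
      ∀ y : Fin 4 → ℂ, (∀ i, x i = 0 → y i = 0) →
        (∀ i, x i ≠ 0 → (A.map (Int.cast : ℤ → ℂ)).mulVec y i = 0) →
        ∃ t : ℂ, y = t • x ^ 2 := by
  classical
  let I : Finset (Fin 4) := Finset.univ.filter fun i => x i ≠ 0
  have hI : ∀ i, i ∈ I ↔ x i ≠ 0 := by simp [I]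
  have hAx : ∀ i ∈ I, (A.map (Int.cast : ℤ → ℂ)).mulVec (x ^ 2) i = 0 :=
    fun i hi => (hsing i).resolve_left ((hI i).1 hi)
  have hxI : ∀ i ∉ I, (x ^ 2) i = 0 := fun i hi => by
    have : x i = 0 := by simpa [hI] using hi
    simp [this]
  rcases hA I with hdet | ⟨⟨k, hk, hdet⟩, v, hv, hvI⟩
  · have := eq_zero_of_det_principalBlock_ne_zero hdet hAx hxI
    exact absurd (pow_eq_zero_iff two_ne_zero |>.1 this) hx
  have hxk : x k ≠ 0 := (hI k).1 hk
  have hvk : (v k : ℂ) ≠ 0 := Int.cast_ne_zero.2 ((hvI k).1.2 hk)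
  have hxk2 : (x ^ 2) k ≠ 0 := pow_ne_zero 2 hxk
  obtain ⟨d, hd⟩ : ∃ d : ℂ, (fun j => (v j : ℂ)) ^ 2 = d • x ^ 2 := by
    refine ⟨_, eq_smul_of_det_principalBlock_erase_ne_zero hdet hxk2 hAx hxI
      (fun i hi => ?_) fun i hi => ?_⟩
    · rw [mulVec_intCast_sq, (hvI i).2.2 hi, Int.cast_zero]
    · have : v i = 0 := by simpa [hi] using (hvI i).1
      simp [this]
  have hvx : ∀ i, (v i : ℂ) ^ 2 = d * x i ^ 2 := fun i => by simpa using congrFun hd i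
  have hd0 : d ≠ 0 := by
    rintro rfl
    exact hvk (by simpa using hvx k)
  refine ⟨v, hv, d⁻¹, inv_ne_zero hd0, fun i => ?_, fun i hi => ?_, fun y hy hAy => ?_⟩
  · rw [hvx, inv_mul_cancel_left₀ hd0]
  · have hiI : i ∉ I := by simpa [hI] using hi
    have h1 : A.mulVec (v ^ 2) i ≠ 0 := fun h => hiI ((hvI i).2.1 h)
    have h2 := mulVec_intCast_sq A v i
    rw [hd, Matrix.mulVec_smul] at h2
    intro h3
    rw [Pi.smul_apply, h3, smul_zero] at h2
    exact h1 (by exact_mod_cast h2.symm)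
  · exact ⟨_, eq_smul_of_det_principalBlock_erase_ne_zero hdet hxk2 hAx hxI
      (fun i hi => hAy i ((hI i).1 hi)) fun i hi => hy i (by simpa [hI] using hi)⟩

theorem HasIntegralNodes.exists_eq_smul :
    ∃ v ∈ nodeRepresentatives A, ∃ c : ℂ, c ≠ 0 ∧ x = c • fun i => (v i : ℂ) := by
  obtain ⟨v, hv, c, hc, hxv, -, -⟩ := hA.exists_sq_eq_smul hx hsing
  obtain ⟨hbox, ⟨k, hk, hlt⟩, hvsing⟩ := mem_nodeRepresentatives.1 hv
  have hxk : x k ^ 2 = c := by simpa [hk] using hxv k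
  have hxk0 : x k ≠ 0 := by
    intro h
    exact hc (by simpa [h] using hxk.symm)
  let w : Fin 4 → ℤ := fun i => if x i = x k * v i then v i else - v i
  have hw : ∀ i, w i = v i ∨ w i = - v i := fun i => by
    by_cases h : x i = x k * v i <;> simp [w, h]
  have hwv : w ^ 2 = v ^ 2 := funext fun i => by
    rcases hw i with h | h <;> simp [h]
  refine ⟨w, mem_nodeRepresentatives.2 ⟨fun i => ?_, ⟨k, by simp [w, hk], fun j hj => ?_⟩,
    fun i => ?_⟩, x k, hxk0, funext fun i => ?_⟩
  · have := hbox i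
    rcases hw i with h | h <;> omega
  · have := hlt j hj
    rcases hw j with h | h <;> omega
  · rw [hwv]
    refine (hvsing i).imp_left fun h0 => ?_
    rcases hw i with h | h <;> omega
  · by_cases h : x i = x k * v i
    · simp [w, h]
    · have hsq : x i ^ 2 = (x k * v i) ^ 2 := by rw [hxv, mul_pow, hxk]
      simpa [w, h] using (sq_eq_sq_iff_eq_or_eq_neg.1 hsq).resolve_left h

theorem HasIntegralNodes.rank_hessian (hsymm : A.IsSymm) :
    (Matrix.of fun i j => eval x (pderiv i (pderiv j (squareQuartic A)))).rank = 3 := by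
  obtain ⟨v, hv, c, hc, hxv, hoff, hker⟩ := hA.exists_sq_eq_smul hx hsing
  set B := A.map (Int.cast : ℤ → ℂ)
  set H := Matrix.of fun i j => eval x (pderiv i (pderiv j (squareQuartic A)))
  have hH : ∀ z i, H.mulVec z i = 4 * B.mulVec (x ^ 2) i * z i + 8 * x i * B.mulVec (x * z) i := by
    intro z i
    simp only [H, Matrix.mulVec, dotProduct, Matrix.of_apply,
      eval_pderiv_pderiv_squareQuartic hsymm, add_mul, ite_mul, zero_mul, Finset.sum_add_distrib,
      Finset.sum_ite_eq, Finset.mem_univ, if_true, Finset.mul_sum]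
    congr 1
    refine Finset.sum_congr rfl fun j _ => ?_
    simp [B]
    ring
  have hker_eq : LinearMap.ker H.mulVecLin = ℂ ∙ x := by
    ext z
    rw [LinearMap.mem_ker, Matrix.mulVecLin_apply, Submodule.mem_span_singleton]
    constructor
    · intro hz
      have hz0 : ∀ i, x i = 0 → z i = 0 := by
        intro i hi
        have := hH z i
        rw [hz] at this
        simpa [hi, hoff i hi] using this
      obtain ⟨t, ht⟩ := hker (x * z) (fun i hi => by simp [hi]) (fun i hi => by
        have := hH z i
        rw [hz, (hsing i).resolve_left hi] at this
        simpa [hi] using this)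
      refine ⟨t, funext fun i => ?_⟩
      by_cases hi : x i = 0
      · simp [hi, hz0 i hi]
      · have := congrFun ht i
        simp only [Pi.mul_apply, Pi.smul_apply, Pi.pow_apply, smul_eq_mul] at this ⊢
        refine mul_left_cancel₀ hi ?_
        rw [this]
        ring
    · rintro ⟨t, rfl⟩
      rw [Matrix.mulVec_smul]
      have : H.mulVec x = 0 := funext fun i => by
        rw [hH, ← sq]
        rcases hsing i with h | h <;> simp [h]
      rw [this, smul_zero]
  have hrn := H.mulVecLin.finrank_range_add_finrank_ker
  rw [hker_eq, finrank_span_singleton hx, Module.finrank_fin_fun] at hrn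
  rw [Matrix.rank]
  omega

end Nodes

theorem eq_of_mem_nodeRepresentatives_of_smul_eq {A : Matrix (Fin 4) (Fin 4) ℤ} {v w : Fin 4 → ℤ}
    (hv : v ∈ nodeRepresentatives A) (hw : w ∈ nodeRepresentatives A) {t : ℂ}
    (h : ∀ i, t * (w i : ℂ) = v i) : v = w := by
  obtain ⟨-, ⟨k, hk, hlt⟩, -⟩ := mem_nodeRepresentatives.1 hv
  obtain ⟨-, ⟨l, hl, hlt'⟩, -⟩ := mem_nodeRepresentatives.1 hw
  have ht : t = v l := by simpa [hl] using h l
  have hkl : k = l := by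
    rcases lt_trichotomy k l with hkl | hkl | hkl
    · have := h k
      simp [hlt' k hkl, hk] at this
    · exact hkl
    · have := h k
      simp [ht, hlt l hkl, hk] at this
  subst hkl
  funext i
  have := h i
  rw [ht, hk, Int.cast_one, one_mul] at this
  exact_mod_cast this.symm

theorem exists_nodal_quartic (m : ℕ) (hm : m ≤ 16) :
    ∃ f : MvPolynomial (Fin 4) ℂ,
      Irreducible f ∧ f.IsHomogeneous 4 ∧
      {x : Projectivization ℂ (Fin 4 → ℂ) |
          ∀ i : Fin 4, eval x.rep (pderiv i f) = 0}.Finite ∧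
      Nat.card {x : Projectivization ℂ (Fin 4 → ℂ) |
          ∀ i : Fin 4, eval x.rep (pderiv i f) = 0} = m ∧
      ∀ x : Projectivization ℂ (Fin 4 → ℂ),
        (∀ i : Fin 4, eval x.rep (pderiv i f) = 0) →
        (Matrix.of fun i j : Fin 4 =>
          eval x.rep (pderiv i (pderiv j f))).rank = 3 := by
  obtain ⟨A, hsymm, hA, hcard⟩ : ∃ A : Matrix (Fin 4) (Fin 4) ℤ, A.IsSymm ∧ HasIntegralNodes A ∧
      (nodeRepresentatives A).card = m :=
    ⟨_, isSymm_nodalMatrix _, hasIntegralNodes_nodalMatrix _,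
      card_nodeRepresentatives_nodalMatrix ⟨m, by omega⟩⟩
  have hne : ∀ v : nodeRepresentatives A, (fun i => (v.1 i : ℂ)) ≠ 0 := by
    rintro ⟨v, hv⟩ h0
    obtain ⟨-, ⟨k, hk, -⟩, -⟩ := mem_nodeRepresentatives.1 hv
    simpa [hk] using congrFun h0 k
  have hsing : ∀ x, (∀ i, eval x (pderiv i (squareQuartic A)) = 0) ↔
      ∀ i, x i = 0 ∨ (A.map (Int.cast : ℤ → ℂ)).mulVec (x ^ 2) i = 0 := fun x =>
    forall_congr' (eval_pderiv_squareQuartic_eq_zero_iff hsymm x)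
  have hrank : ∀ x ≠ 0, (∀ i, eval x (pderiv i (squareQuartic A)) = 0) →
      (Matrix.of fun i j => eval x (pderiv i (pderiv j (squareQuartic A)))).rank = 3 :=
    fun x hx h => hA.rank_hessian hx ((hsing x).1 h) hsymm
  let node : nodeRepresentatives A → Projectivization ℂ (Fin 4 → ℂ) := fun v => .mk ℂ _ (hne v)
  have hinj : Function.Injective node := by
    intro v w hvw
    obtain ⟨t, ht⟩ := (Projectivization.mk_eq_mk_iff' ℂ _ _ _ _).1 hvw
    exact Subtype.ext (eq_of_mem_nodeRepresentatives_of_smul_eq v.2 w.2 (congrFun ht))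
  have hrange : {x : Projectivization ℂ (Fin 4 → ℂ) |
      ∀ i : Fin 4, eval x.rep (pderiv i (squareQuartic A)) = 0} = Set.range node := by
    ext x
    constructor
    · intro h
      obtain ⟨v, hv, c, hc, hxv⟩ := hA.exists_eq_smul x.rep_nonzero ((hsing _).1 h)
      refine ⟨⟨v, hv⟩, ?_⟩
      rw [← x.mk_rep]
      exact ((Projectivization.mk_eq_mk_iff' ℂ _ _ _ _).2 ⟨c, hxv.symm⟩).symm
    · rintro ⟨v, rfl⟩
      obtain ⟨a, ha⟩ := Projectivization.exists_smul_eq_mk_rep ℂ _ (hne v)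
      change ∀ i, eval (Projectivization.mk ℂ _ (hne v)).rep _ = 0
      rw [← ha, hsing]
      intro i
      refine ((mem_nodeRepresentatives.1 v.2).2.2 i).imp (fun h => by simp [h]) fun h => ?_
      rw [smul_pow, Units.smul_def, Matrix.mulVec_smul, Pi.smul_apply, mulVec_intCast_sq, h]
      simp
  refine ⟨squareQuartic A, ?_, isHomogeneous_squareQuartic A, ?_, ?_,
    fun x hx => hrank _ x.rep_nonzero hx⟩
  · refine (isHomogeneous_squareQuartic A).irreducible_of_hessian_rank (by simp) (by norm_num)
      fun x hx h => ?_
    rw [hrank x hx h]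
    norm_num
  · rw [hrange]
    exact Set.finite_range node
  · rw [hrange, Nat.card_range_of_injective hinj, Nat.card_eq_fintype_card, Fintype.card_coe,
      hcard]
end

section
/- For every natural number m with 0 ≤ m ≤ 65, there exists an irreducible homogeneous polynomial f ∈ ℂ[x₀,x₁,x₂,x₃] of degree 6 such that the set of points of ℙ³(ℂ) at which all four partial derivatives of f vanish is finite of cardinality exactly m, and at every such point the 4×4 Hessian matrix of second partial derivatives of f has rank 3. -/
open MvPolynomial

section Gradient

variable {σ : Type*} [Fintype σ]

/-- The vector of first partial derivatives of `f` at `x`. -/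
noncomputable def gradientAt (f : MvPolynomial σ ℂ) (x : σ → ℂ) : σ → ℂ :=
  fun i => eval x (pderiv i f)

/-- The matrix of second partial derivatives of `f` at `x`. -/
noncomputable def hessianAt (f : MvPolynomial σ ℂ) (x : σ → ℂ) : Matrix σ σ ℂ :=
  Matrix.of fun i j => eval x (pderiv i (pderiv j f))

omit [Fintype σ] in
theorem pderiv_pderiv_comm (i j : σ) (f : MvPolynomial σ ℂ) :
    pderiv i (pderiv j f) = pderiv j (pderiv i f) := by
  classical
  have h : ⁅pderiv (R := ℂ) i, pderiv (R := ℂ) j⁆ = 0 := by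
    apply MvPolynomial.derivation_ext
    intro k
    simp [Derivation.commutator_apply, pderiv_X, Pi.single_apply, apply_ite]
  have := congrArg (fun D => D f) h
  simpa [Derivation.commutator_apply, sub_eq_zero] using this

omit [Fintype σ] in
theorem hessianAt_transpose (f : MvPolynomial σ ℂ) (x : σ → ℂ) :
    (hessianAt f x).transpose = hessianAt f x := by
  ext i j
  simp [hessianAt, pderiv_pderiv_comm i j]

theorem dotProduct_gradientAt {f : MvPolynomial σ ℂ} {n : ℕ} (hf : f.IsHomogeneous n)
    (x : σ → ℂ) : x ⬝ᵥ gradientAt f x = n * eval x f := by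
  have := congrArg (eval x) hf.sum_X_mul_pderiv
  simpa [dotProduct, gradientAt] using this

theorem hessianAt_mulVec_self {f : MvPolynomial σ ℂ} {n : ℕ} (hf : f.IsHomogeneous n)
    (x : σ → ℂ) : (hessianAt f x).mulVec x = ((n - 1 : ℕ) : ℂ) • gradientAt f x := by
  ext i
  have := dotProduct_gradientAt (hf.pderiv (i := i)) x
  rw [Pi.smul_apply, smul_eq_mul, gradientAt, ← this]
  simp [Matrix.mulVec, dotProduct, hessianAt, gradientAt, pderiv_pderiv_comm i, mul_comm]

theorem eval_smul_of_isHomogeneous {f : MvPolynomial σ ℂ} {n : ℕ} (hf : f.IsHomogeneous n)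
    (c : ℂ) (x : σ → ℂ) : eval (c • x) f = c ^ n * eval x f := by
  simp only [eval_eq', Finset.mul_sum]
  refine Finset.sum_congr rfl fun d hd => ?_
  have : ∑ i, d i = n := by
    rw [← Finsupp.degree_eq_sum]
    exact (hf.degree_eq_sum_deg_support hd).symm
  simp only [Pi.smul_apply, smul_eq_mul, mul_pow, Finset.prod_mul_distrib,
    Finset.prod_pow_eq_pow_sum,
    this]
  ring

theorem gradientAt_smul {f : MvPolynomial σ ℂ} {n : ℕ} (hf : f.IsHomogeneous n)
    (c : ℂ) (x : σ → ℂ) : gradientAt f (c • x) = c ^ (n - 1) • gradientAt f x := by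
  ext i
  simp [gradientAt, eval_smul_of_isHomogeneous hf.pderiv]

theorem hasStrictFDerivAt_eval (f : MvPolynomial σ ℂ) (x : σ → ℂ) :
    HasStrictFDerivAt (fun y => eval y f)
      (∑ i, gradientAt f x i • (ContinuousLinearMap.proj i : (σ → ℂ) →L[ℂ] ℂ)) x := by
  classical
  induction f using MvPolynomial.induction_on with
  | C a =>
    simp only [eval_C]
    refine (hasStrictFDerivAt_const (𝕜 := ℂ) a x).congr_fderiv ?_
    ext w
    simp [gradientAt]
  | add p q hp hq =>
    simp only [map_add]
    refine (hp.fun_add hq).congr_fderiv ?_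
    ext w
    simp [gradientAt, add_mul, Finset.sum_add_distrib]
  | mul_X p i hp =>
    have := hp.mul
      ((ContinuousLinearMap.proj (R := ℂ) (φ := fun _ : σ => ℂ) i).hasStrictFDerivAt (x := x))
    simp only [map_mul, eval_X]
    refine this.congr_fderiv ?_
    ext w
    simp [gradientAt, pderiv_X, Pi.single_apply, mul_add, Finset.sum_add_distrib, apply_ite,
      Finset.mul_sum, mul_comm, mul_left_comm]

end Gradient

section Deformation

open Filter Topology

variable {σ ι : Type*} [Fintype σ] [Fintype ι]

/-- A partial derivative-wise strict derivative of the gradient. -/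
theorem hasStrictFDerivAt_gradientAt (f : MvPolynomial σ ℂ) (x : σ → ℂ) :
    HasStrictFDerivAt (gradientAt f)
      (LinearMap.toContinuousLinearMap (hessianAt f x).mulVecLin) x := by
  refine hasStrictFDerivAt_pi'' fun i => (hasStrictFDerivAt_eval (pderiv i f) x).congr_fderiv ?_
  ext w
  simp [gradientAt, hessianAt, Matrix.mulVec, dotProduct, pderiv_pderiv_comm i]

/-- The linear deformation of `F` in the directions `G j`. -/
noncomputable def deformation (F : MvPolynomial σ ℂ) (G : ι → MvPolynomial σ ℂ) (t : ι → ℂ) :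
    MvPolynomial σ ℂ :=
  F + ∑ j, C (t j) * G j

omit [Fintype σ] in
theorem isHomogeneous_deformation {F : MvPolynomial σ ℂ} {G : ι → MvPolynomial σ ℂ} {n : ℕ}
    (hF : F.IsHomogeneous n) (hG : ∀ j, (G j).IsHomogeneous n) (t : ι → ℂ) :
    (deformation F G t).IsHomogeneous n :=
  hF.add (IsHomogeneous.sum _ _ _ fun j _ => (hG j).C_mul (t j))

omit [Fintype σ] in
theorem gradientAt_deformation (F : MvPolynomial σ ℂ) (G : ι → MvPolynomial σ ℂ) (t : ι → ℂ)
    (x : σ → ℂ) :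
    gradientAt (deformation F G t) x = gradientAt F x + ∑ j, t j • gradientAt (G j) x := by
  ext i
  simp [gradientAt, deformation]

omit [Fintype σ] in
theorem hessianAt_deformation (F : MvPolynomial σ ℂ) (G : ι → MvPolynomial σ ℂ) (t : ι → ℂ)
    (x : σ → ℂ) :
    hessianAt (deformation F G t) x = hessianAt F x + ∑ j, t j • hessianAt (G j) x := by
  ext i k
  simp [hessianAt, deformation, Matrix.sum_apply]

omit [Fintype σ] in
theorem continuous_gradientAt (f : MvPolynomial σ ℂ) : Continuous (gradientAt f) :=
  continuous_pi fun i => MvPolynomial.continuous_eval (pderiv i f)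

omit [Fintype σ] in
theorem continuous_hessianAt (f : MvPolynomial σ ℂ) : Continuous (hessianAt f) :=
  continuous_pi fun i => continuous_pi fun j =>
    MvPolynomial.continuous_eval (pderiv i (pderiv j f))

theorem hasStrictFDerivAt_gradientAt_deformation (F : MvPolynomial σ ℂ)
    (G : ι → MvPolynomial σ ℂ) (v : σ → ℂ) :
    HasStrictFDerivAt (fun z : (ι → ℂ) × (σ → ℂ) => gradientAt (deformation F G z.1) z.2)
      ((LinearMap.toContinuousLinearMap (hessianAt F v).mulVecLin).comp
          (ContinuousLinearMap.snd ℂ (ι → ℂ) (σ → ℂ)) +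
        ∑ j, ((ContinuousLinearMap.proj (R := ℂ) (φ := fun _ : ι => ℂ) j).comp
          (ContinuousLinearMap.fst ℂ (ι → ℂ) (σ → ℂ))).smulRight (gradientAt (G j) v))
      (0, v) := by
  simp only [gradientAt_deformation]
  have h₂ (f : MvPolynomial σ ℂ) :
      HasStrictFDerivAt (fun z : (ι → ℂ) × (σ → ℂ) => gradientAt f z.2)
        ((LinearMap.toContinuousLinearMap (hessianAt f v).mulVecLin).comp
          (ContinuousLinearMap.snd ℂ (ι → ℂ) (σ → ℂ))) (0, v) :=
    HasStrictFDerivAt.comp (f := Prod.snd) ((0 : ι → ℂ), v) (hasStrictFDerivAt_gradientAt f v)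
      hasStrictFDerivAt_snd
  refine HasStrictFDerivAt.fun_add (h₂ F) (HasStrictFDerivAt.fun_sum fun j _ => ?_)
  have h₁ : HasStrictFDerivAt (fun z : (ι → ℂ) × (σ → ℂ) => z.1 j) _ (0, v) :=
    ((ContinuousLinearMap.proj (R := ℂ) (φ := fun _ : ι => ℂ) j).comp
          (ContinuousLinearMap.fst ℂ (ι → ℂ) (σ → ℂ))).hasStrictFDerivAt
  refine (h₁.fun_smul (h₂ (G j))).congr_fderiv ?_
  ext <;> simp

variable [DecidableEq σ]

/-- The gradient of the deformed polynomial, corrected in direction `k` so that it becomes a local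
coordinate system at a node whose `k`-th coordinate is `1`. -/
noncomputable def slicedGradient (F : MvPolynomial σ ℂ) (G : ι → MvPolynomial σ ℂ) (k : σ)
    (z : (ι → ℂ) × (σ → ℂ)) : σ → ℂ :=
  gradientAt (deformation F G z.1) z.2 + (z.2 k - 1) • Pi.single k 1

theorem hasStrictFDerivAt_slicedGradient (F : MvPolynomial σ ℂ)
    (G : ι → MvPolynomial σ ℂ) (k : σ) (v : σ → ℂ) :
    ∃ D : (ι → ℂ) × (σ → ℂ) →L[ℂ] (σ → ℂ), HasStrictFDerivAt (slicedGradient F G k) D (0, v) ∧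
      ∀ τ ξ, D (τ, ξ) = (hessianAt F v).mulVec ξ + ∑ j, τ j • gradientAt (G j) v +
        ξ k • Pi.single k 1 := by
  have h : HasStrictFDerivAt
      (fun z : (ι → ℂ) × (σ → ℂ) => (z.2 k - 1) • (Pi.single k 1 : σ → ℂ)) _ (0, v) :=
    ((((ContinuousLinearMap.proj (R := ℂ) (φ := fun _ : σ => ℂ) k).comp
      (ContinuousLinearMap.snd ℂ (ι → ℂ) (σ → ℂ))).hasStrictFDerivAt).sub_const 1).smul_const _
  refine ⟨_, (hasStrictFDerivAt_gradientAt_deformation F G v).add h, fun τ ξ => ?_⟩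
  simp

theorem exists_continuousLinearEquiv_of_injective {E E' : Type*} [NormedAddCommGroup E]
    [NormedSpace ℂ E] [FiniteDimensional ℂ E] [NormedAddCommGroup E'] [NormedSpace ℂ E']
    [FiniteDimensional ℂ E'] (D : E →L[ℂ] E') (hD : ∀ x, D x = 0 → x = 0)
    (h : Module.finrank ℂ E = Module.finrank ℂ E') :
    ∃ e : E ≃L[ℂ] E', (e : E →L[ℂ] E') = D := by
  have hinj : Function.Injective (D : E →ₗ[ℂ] E') :=
    (injective_iff_map_eq_zero (D : E →ₗ[ℂ] E')).2 hD
  refine ⟨(LinearMap.linearEquivOfInjective _ hinj h).toContinuousLinearEquiv, ?_⟩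
  ext x
  simp

/-- A nondegeneracy property of the Hessian at a singular point `v` of `F`: its kernel is spanned by
`v`, that is, `v` is a node. -/
theorem eq_zero_of_hessianAt_mulVec_add {F : MvPolynomial σ ℂ} {n : ℕ} (hF : F.IsHomogeneous n)
    {v : σ → ℂ} {k : σ} (hk : v k = 1) (hv : gradientAt F v = 0)
    (hker : ∀ w, (hessianAt F v).mulVec w = 0 → ∃ c : ℂ, w = c • v) {ξ : σ → ℂ}
    (hξ : (hessianAt F v).mulVec ξ + ξ k • Pi.single k 1 = 0) : ξ = 0 := by
  have h₁ : v ⬝ᵥ (hessianAt F v).mulVec ξ = 0 := by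
    rw [Matrix.dotProduct_mulVec, ← Matrix.mulVec_transpose, hessianAt_transpose,
      hessianAt_mulVec_self hF, hv]
    simp
  have h₂ : ξ k = 0 := by
    have := congrArg (fun w => v ⬝ᵥ w) hξ
    simpa [dotProduct_add, h₁, hk] using this
  rw [h₂, zero_smul, add_zero] at hξ
  obtain ⟨c, rfl⟩ := hker ξ hξ
  have : c = 0 := by simpa [hk] using h₂
  simp [this]

theorem exists_injOn_slicedGradient {F : MvPolynomial σ ℂ} {n : ℕ} (hF : F.IsHomogeneous n)
    (G : ι → MvPolynomial σ ℂ) {v : σ → ℂ} {k : σ} (hk : v k = 1) (hv : gradientAt F v = 0)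
    (hker : ∀ w, (hessianAt F v).mulVec w = 0 → ∃ c : ℂ, w = c • v) :
    ∃ N ∈ 𝓝 ((0 : ι → ℂ), v), ∀ t x y, (t, x) ∈ N → (t, y) ∈ N →
      slicedGradient F G k (t, x) = slicedGradient F G k (t, y) → x = y := by
  obtain ⟨D, hD, hDapp⟩ := hasStrictFDerivAt_slicedGradient F G k v
  have hΨ := (hasStrictFDerivAt_fst (𝕜 := ℂ) (p := ((0 : ι → ℂ), v))).prodMk hD
  obtain ⟨e, he⟩ := exists_continuousLinearEquiv_of_injective
    ((ContinuousLinearMap.fst ℂ (ι → ℂ) (σ → ℂ)).prod D) (by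
      rintro ⟨τ, ξ⟩ h
      simp only [ContinuousLinearMap.prod_apply, ContinuousLinearMap.coe_fst', Prod.mk_eq_zero]
        at h
      obtain ⟨rfl, h⟩ := h
      rw [hDapp] at h
      simp only [Prod.mk_eq_zero, true_and]
      exact eq_zero_of_hessianAt_mulVec_add hF hk hv hker (by simpa using h)) rfl
  rw [← he] at hΨ
  refine ⟨_, (hΨ.toOpenPartialHomeomorph _).open_source.mem_nhds
    hΨ.mem_toOpenPartialHomeomorph_source, fun t x y hx hy hxy => ?_⟩
  have := (hΨ.toOpenPartialHomeomorph _).injOn hx hy (by simp [hxy])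
  simpa using this

/-- The positions of the would-be nodes and of their normalizations determine the deformation. -/
theorem map_nhds_slicedGradient {F : MvPolynomial σ ℂ} {n : ℕ} (hn : n ≠ 0)
    (hF : F.IsHomogeneous n) {G : ι → MvPolynomial σ ℂ} (hG : ∀ i, (G i).IsHomogeneous n)
    {v : ι → σ → ℂ} {k : ι → σ} (hk : ∀ i, v i (k i) = 1) (hv : ∀ i, gradientAt F (v i) = 0)
    (hker : ∀ i w, (hessianAt F (v i)).mulVec w = 0 → ∃ c : ℂ, w = c • v i)
    (hGv : ∀ i, eval (v i) (G i) ≠ 0) (hGv' : ∀ i j, j ≠ i → eval (v i) (G j) = 0) :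
    Filter.map (fun z : (ι → ℂ) × (ι → σ → ℂ) =>
      ((fun i => z.2 i (k i)), fun i => slicedGradient F G (k i) (z.1, z.2 i))) (𝓝 (0, v)) =
      𝓝 (1, 0) := by
  choose D hD hDapp using fun i => hasStrictFDerivAt_slicedGradient F G (k i) (v i)
  let P (i : ι) : (ι → ℂ) × (ι → σ → ℂ) →L[ℂ] (σ → ℂ) :=
    (ContinuousLinearMap.proj i).comp (ContinuousLinearMap.snd ℂ (ι → ℂ) (ι → σ → ℂ))
  let Q (i : ι) : (ι → ℂ) × (ι → σ → ℂ) →L[ℂ] (ι → ℂ) × (σ → ℂ) :=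
    (ContinuousLinearMap.fst ℂ (ι → ℂ) (ι → σ → ℂ)).prod (P i)
  have hΦ : HasStrictFDerivAt (fun z : (ι → ℂ) × (ι → σ → ℂ) =>
      ((fun i => z.2 i (k i)), fun i => slicedGradient F G (k i) (z.1, z.2 i)))
      ((ContinuousLinearMap.pi fun i => (ContinuousLinearMap.proj (k i)).comp (P i)).prod
        (ContinuousLinearMap.pi fun i => (D i).comp (Q i))) (0, v) := by
    refine HasStrictFDerivAt.prodMk (hasStrictFDerivAt_pi.2 fun i => ?_)
      (hasStrictFDerivAt_pi.2 fun i => ?_)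
    · exact ((ContinuousLinearMap.proj (R := ℂ) (φ := fun _ : σ => ℂ) (k i)).comp
        (P i)).hasStrictFDerivAt
    · exact (hD i).comp (𝕜 := ℂ) ((0 : ι → ℂ), v) (Q i).hasStrictFDerivAt
  obtain ⟨e, he⟩ := exists_continuousLinearEquiv_of_injective
    ((ContinuousLinearMap.pi fun i => (ContinuousLinearMap.proj (k i)).comp (P i)).prod
        (ContinuousLinearMap.pi fun i => (D i).comp (Q i))) (by
      rintro ⟨τ, ξ⟩ h
      simp only [ContinuousLinearMap.prod_apply, Prod.mk_eq_zero, funext_iff,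
        ContinuousLinearMap.coe_pi', ContinuousLinearMap.comp_apply,
        ContinuousLinearMap.proj_apply, Pi.zero_apply, P, Q, ContinuousLinearMap.coe_fst',
        ContinuousLinearMap.coe_snd', hDapp] at h
      obtain ⟨hξk, h⟩ := h
      replace h : ∀ i, (hessianAt F (v i)).mulVec (ξ i) + ∑ j, τ j • gradientAt (G j) (v i) +
        ξ i (k i) • Pi.single (k i) 1 = 0 := fun i => funext (h i)
      have hτ : τ = 0 := by
        ext i
        have h₁ : v i ⬝ᵥ (hessianAt F (v i)).mulVec (ξ i) = 0 := by
          rw [Matrix.dotProduct_mulVec, ← Matrix.mulVec_transpose, hessianAt_transpose,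
            hessianAt_mulVec_self hF, hv]
          simp
        have h₂ := congrArg (fun w => v i ⬝ᵥ w) (h i)
        simp only [hξk, zero_smul, add_zero, dotProduct_add, h₁, zero_add, dotProduct_sum,
          dotProduct_smul, dotProduct_gradientAt (hG _), dotProduct_zero, smul_eq_mul] at h₂
        rw [Finset.sum_eq_single i (fun j _ hj => by simp [hGv' i j hj]) (by simp)] at h₂
        simpa [hn, hGv i] using h₂
      subst hτ
      simp only [Prod.mk_eq_zero, true_and]
      ext1 i
      exact eq_zero_of_hessianAt_mulVec_add hF (hk i) (hv i) (hker i) (by simpa using h i)) rfl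
  rw [← he] at hΦ
  have := hΦ.map_nhds_eq_of_equiv
  rw [this]
  congr 1
  ext i
  · simp [hk]
  · simp [slicedGradient, hk, gradientAt_deformation, hv]

end Deformation

section Smoothing

open Filter Topology

variable {σ ι : Type*} [Fintype σ] [Fintype ι]

omit [Fintype σ] in
theorem continuous_gradientAt_deformation (F : MvPolynomial σ ℂ) (G : ι → MvPolynomial σ ℂ) :
    Continuous fun z : (ι → ℂ) × (σ → ℂ) => gradientAt (deformation F G z.1) z.2 := by
  simp only [gradientAt_deformation]
  have h (f : MvPolynomial σ ℂ) := continuous_gradientAt f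
  fun_prop

omit [Fintype σ] in
theorem continuous_hessianAt_deformation (F : MvPolynomial σ ℂ) (G : ι → MvPolynomial σ ℂ) :
    Continuous fun z : (ι → ℂ) × (σ → ℂ) => hessianAt (deformation F G z.1) z.2 := by
  simp only [hessianAt_deformation]
  have h (f : MvPolynomial σ ℂ) := continuous_hessianAt f
  fun_prop

/-- Singular points of a small deformation of `F` are close to singular points of `F`. -/
theorem eventually_singular_mem {F : MvPolynomial σ ℂ} {n : ℕ}
    (hF : F.IsHomogeneous n) {G : ι → MvPolynomial σ ℂ} (hG : ∀ i, (G i).IsHomogeneous n)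
    {v : ι → σ → ℂ} {k : ι → σ} (hk : ∀ i, v i (k i) = 1)
    (hsing : ∀ y, y ≠ 0 → gradientAt F y = 0 → ∃ i, ∃ c : ℂ, y = c • v i)
    {N : ι → Set ((ι → ℂ) × (σ → ℂ))} (hN : ∀ i, N i ∈ 𝓝 (0, v i)) :
    ∀ᶠ t in 𝓝 (0 : ι → ℂ), ∀ y, y ≠ 0 → gradientAt (deformation F G t) y = 0 →
      ∃ i, y (k i) ≠ 0 ∧ (t, (y (k i))⁻¹ • y) ∈ N i := by
  have hS := (isCompact_sphere (0 : σ → ℂ) 1).eventually_forall_of_forall_eventually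
    (x₀ := (0 : ι → ℂ)) (P := fun t y => gradientAt (deformation F G t) y = 0 →
      ∃ i, y (k i) ≠ 0 ∧ (t, (y (k i))⁻¹ • y) ∈ N i) (by
    intro y hy
    have hy0 : y ≠ 0 := by
      rintro rfl
      simp at hy
    by_cases hgrad : gradientAt F y = 0
    · obtain ⟨i, c, rfl⟩ := hsing y hy0 hgrad
      have hc : c ≠ 0 := by
        rintro rfl
        simp at hy0
      have hck : (c • v i) (k i) = c := by simp [hk]
      have h₁ : Tendsto (fun z : (ι → ℂ) × (σ → ℂ) => z.2 (k i)) (𝓝 (0, c • v i)) (𝓝 c) := by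
        have : Continuous fun z : (ι → ℂ) × (σ → ℂ) => z.2 (k i) := by fun_prop
        simpa [hk] using this.tendsto (0, c • v i)
      have h₂ : Tendsto (fun z : (ι → ℂ) × (σ → ℂ) => (z.1, (z.2 (k i))⁻¹ • z.2))
          (𝓝 (0, c • v i)) (𝓝 (0, v i)) := by
        have h₃ := (h₁.inv₀ hc).smul (continuous_snd.tendsto ((0 : ι → ℂ), c • v i))
        simp only [smul_smul, inv_mul_cancel₀ hc, one_smul] at h₃
        exact (continuous_fst.tendsto ((0 : ι → ℂ), c • v i)).prodMk_nhds h₃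
      filter_upwards [h₁.eventually_ne hc, h₂ (hN i)] with z hz₁ hz₂ _
      exact ⟨i, hz₁, hz₂⟩
    · have h₀ := (continuous_gradientAt_deformation F G).tendsto (0, y)
      have : gradientAt (deformation F G 0) y ≠ 0 := by simpa [gradientAt_deformation] using hgrad
      filter_upwards [h₀.eventually_ne this] with z hz h
      exact absurd h hz)
  filter_upwards [hS] with t ht y hy hgrad
  have hny : (‖y‖ : ℂ) ≠ 0 := by simpa using hy
  obtain ⟨i, hi, hi'⟩ := ht ((‖y‖ : ℂ)⁻¹ • y) (by simp [norm_smul, hy]) (by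
    rw [gradientAt_smul (isHomogeneous_deformation hF hG t), hgrad, smul_zero])
  refine ⟨i, fun h => hi (by simp [h]), ?_⟩
  convert hi' using 2
  rw [smul_smul]
  congr 1
  simp only [Pi.smul_apply, smul_eq_mul]
  field_simp

variable [DecidableEq σ]

theorem single_mulVec_eq_smul (k : σ) (w : σ → ℂ) :
    (Matrix.single k k (1 : ℂ)).mulVec w = w k • Pi.single k 1 := by
  ext i
  simp [Matrix.single_mulVec, Function.update_apply, Pi.single_apply]

/-- If the nodes `v i` of a nodal hypersurface impose independent conditions on hypersurfaces of the
same degree, then any subset `S` of the nodes can be kept while the others are smoothed. -/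
theorem exists_smoothing {F : MvPolynomial σ ℂ} {n : ℕ} (hn : n ≠ 0)
    (hF : F.IsHomogeneous n) {G : ι → MvPolynomial σ ℂ} (hG : ∀ i, (G i).IsHomogeneous n)
    {v : ι → σ → ℂ} {k : ι → σ} (hk : ∀ i, v i (k i) = 1) (hv : ∀ i, gradientAt F (v i) = 0)
    (hker : ∀ i w, (hessianAt F (v i)).mulVec w = 0 → ∃ c : ℂ, w = c • v i)
    (hsing : ∀ y, y ≠ 0 → gradientAt F y = 0 → ∃ i, ∃ c : ℂ, y = c • v i)
    (hGv : ∀ i, eval (v i) (G i) ≠ 0) (hGv' : ∀ i j, j ≠ i → eval (v i) (G j) = 0)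
    (S : Set ι) :
    ∃ f : MvPolynomial σ ℂ, f.IsHomogeneous n ∧ ∃ x : ι → σ → ℂ,
      (∀ i ∈ S, x i ≠ 0) ∧ (∀ i ∈ S, ∀ j, i ≠ j → ∀ c : ℂ, x j ≠ c • x i) ∧
      (∀ i ∈ S, gradientAt f (x i) = 0) ∧
      (∀ i ∈ S, ∀ w, (hessianAt f (x i)).mulVec w = 0 → ∃ c : ℂ, w = c • x i) ∧
      ∀ y, y ≠ 0 → gradientAt f y = 0 → ∃ i ∈ S, ∃ c : ℂ, y = c • x i := by
  classical
  choose N hN hNinj using fun i => exists_injOn_slicedGradient hF G (hk i) (hv i) (hker i)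
  have hx (i : ι) : Tendsto (fun z : (ι → ℂ) × (ι → σ → ℂ) => (z.1, z.2 i)) (𝓝 (0, v))
      (𝓝 (0, v i)) := by
    have : Continuous fun z : (ι → ℂ) × (ι → σ → ℂ) => (z.1, z.2 i) := by fun_prop
    exact this.tendsto (0, v)
  have hmem : ∀ᶠ z : (ι → ℂ) × (ι → σ → ℂ) in 𝓝 (0, v), ∀ i, (z.1, z.2 i) ∈ N i :=
    eventually_all.2 fun i => hx i (hN i)
  have hsing' := (continuous_fst.tendsto ((0 : ι → ℂ), v)).eventually
    (eventually_singular_mem hF hG hk hsing hN)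
  have hdet : ∀ᶠ z : (ι → ℂ) × (ι → σ → ℂ) in 𝓝 (0, v), ∀ i,
      (hessianAt (deformation F G z.1) (z.2 i) + Matrix.single (k i) (k i) 1).det ≠ 0 := by
    refine eventually_all.2 fun i => ?_
    have hc : Continuous fun z : (ι → ℂ) × (σ → ℂ) =>
        (hessianAt (deformation F G z.1) z.2 + Matrix.single (k i) (k i) 1).det :=
      ((continuous_hessianAt_deformation F G).add continuous_const).matrix_det
    refine ((hc.tendsto (0, v i)).comp (hx i)).eventually_ne ?_
    intro h
    obtain ⟨w, hw, hw'⟩ := Matrix.exists_mulVec_eq_zero_iff.2 h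
    refine hw (eq_zero_of_hessianAt_mulVec_add hF (hk i) (hv i) (hker i) ?_)
    simpa [hessianAt_deformation, Matrix.add_mulVec, single_mulVec_eq_smul] using hw'
  have hdist : ∀ᶠ z : (ι → ℂ) × (ι → σ → ℂ) in 𝓝 (0, v), ∀ i j, i ≠ j →
      z.2 j - z.2 j (k i) • z.2 i ≠ 0 := by
    refine eventually_all.2 fun i => eventually_all.2 fun j => ?_
    by_cases hij : i = j
    · simp [hij]
    have hc : Continuous fun z : (ι → ℂ) × (ι → σ → ℂ) => z.2 j - z.2 j (k i) • z.2 i := by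
      fun_prop
    refine ((hc.tendsto (0, v)).eventually_ne fun h => hGv j ?_).mono fun z hz _ => hz
    have h' : v j = v j (k i) • v i := sub_eq_zero.1 h
    rw [h', eval_smul_of_isHomogeneous (hG j), hGv' i j (Ne.symm hij), mul_zero]
  have himage := Filter.image_mem_map (m := fun z : (ι → ℂ) × (ι → σ → ℂ) =>
      ((fun i => z.2 i (k i)), fun i => slicedGradient F G (k i) (z.1, z.2 i)))
      (hmem.and (hsing'.and (hdet.and hdist)))
  rw [map_nhds_slicedGradient hn hF hG hk hv hker hGv hGv'] at himage
  have hε : Tendsto (fun ε : ℂ => ((fun i => if i ∈ S then 1 else 1 + ε : ι → ℂ),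
      (0 : ι → σ → ℂ))) (𝓝[≠] 0) (𝓝 (1, 0)) := by
    have : Continuous fun ε : ℂ => ((fun i => if i ∈ S then 1 else 1 + ε : ι → ℂ),
      (0 : ι → σ → ℂ)) := by
      refine (continuous_pi fun i => ?_).prodMk continuous_const
      split_ifs <;> fun_prop
    have h := this.tendsto 0
    simp only [add_zero, ite_self] at h
    exact h.mono_left nhdsWithin_le_nhds
  obtain ⟨ε, ⟨⟨t, x⟩, ⟨hmem, hsing', hdet, hdist⟩, heq⟩, hε0⟩ :=
    ((hε.eventually himage).and self_mem_nhdsWithin).exists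
  obtain ⟨hxk, hx0⟩ := Prod.mk.inj heq
  replace hxk (i : ι) : x i (k i) = if i ∈ S then 1 else 1 + ε := congrFun hxk i
  replace hx0 (i : ι) : slicedGradient F G (k i) (t, x i) = 0 := congrFun hx0 i
  have hft := isHomogeneous_deformation hF hG t
  have hxS (i : ι) (hi : i ∈ S) : x i (k i) = 1 := by rw [hxk, if_pos hi]
  have hgrad (i : ι) (hi : i ∈ S) : gradientAt (deformation F G t) (x i) = 0 := by
    simpa [slicedGradient, hxS i hi] using hx0 i
  refine ⟨deformation F G t, hft, x, fun i hi h => ?_, fun i hi j hij c h => ?_, hgrad,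
    fun i hi w hw => ⟨w (k i), ?_⟩, fun y hy hgy => ?_⟩
  · simpa [h] using hxS i hi
  · refine hdist i j hij ?_
    simp [h, hxS i hi]
  · by_contra hne
    refine hdet i (Matrix.exists_mulVec_eq_zero_iff.1 ⟨w - w (k i) • x i, sub_ne_zero.2 hne, ?_⟩)
    simp [Matrix.add_mulVec, single_mulVec_eq_smul, Matrix.mulVec_sub, Matrix.mulVec_smul, hw,
      hessianAt_mulVec_self hft, hgrad i hi, hxS i hi]
  · obtain ⟨i, hi, hiN⟩ := hsing' y hy hgy
    have hyx : (y (k i))⁻¹ • y = x i := by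
      refine hNinj i t _ _ hiN (hmem i) ?_
      rw [hx0]
      simp [slicedGradient, gradientAt_smul hft, hgy, hi]
    have hxi : x i (k i) = 1 := by simp [← hyx, hi]
    refine ⟨i, ?_, y (k i), by simp [← hyx, hi]⟩
    by_contra hiS
    rw [hxk, if_neg hiS] at hxi
    exact hε0 (by simpa using hxi)

end Smoothing

section Irreducibility

/-- Killing the first `j` variables. -/
noncomputable def killVars (j : ℕ) : MvPolynomial (Fin 4) ℂ →ₐ[ℂ] MvPolynomial (Fin 4) ℂ :=
  aeval fun i => if i.val < j then 0 else X i

theorem ker_killVars_lt (j : Fin 4) :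
    RingHom.ker (killVars j) < RingHom.ker (killVars (j + 1)) := by
  have hcomp : (killVars (j + 1)).comp (killVars j) = killVars (j + 1) := by
    ext1 i
    have h : i.val < j → i.val < j.val + 1 := fun h => h.trans (Nat.lt_succ_self j)
    rw [AlgHom.comp_apply]
    simp only [killVars, aeval_X]
    by_cases h' : i.val < j
    · rw [if_pos h', if_pos (h h'), map_zero]
    · rw [if_neg h', aeval_X]
  refine SetLike.lt_iff_le_and_exists.2 ⟨fun p hp => ?_, X j, ?_, ?_⟩
  · rw [RingHom.mem_ker] at hp ⊢
    rw [← hcomp, AlgHom.comp_apply, hp, map_zero]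
  · simp [RingHom.mem_ker, killVars]
  · simp [RingHom.mem_ker, killVars]

theorem three_le_height_ker_eval_zero :
    3 ≤ (RingHom.ker (eval (0 : Fin 4 → ℂ))).height := by
  have (j : ℕ) : (RingHom.ker (killVars j)).IsPrime := RingHom.ker_isPrime _
  have h (j : Fin 4) := Ideal.height_add_one_le_of_lt_of_isPrime (ker_killVars_lt j)
  have hle : RingHom.ker (killVars 4) ≤ RingHom.ker (eval (0 : Fin 4 → ℂ)) := by
    intro p hp
    have hcomp : (aeval (0 : Fin 4 → ℂ)).comp (killVars 4) = aeval (0 : Fin 4 → ℂ) := by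
      ext1 i
      simp [killVars]
    rw [RingHom.mem_ker] at hp ⊢
    have := congrArg (fun φ => φ p) hcomp
    simpa [hp, coe_aeval_eq_eval, eq_comm] using this
  refine le_trans ?_ (Ideal.height_mono hle)
  have h₁ := h 1
  have h₂ := h 2
  have h₃ := h 3
  have h₀ := h 0
  norm_num at h₀ h₁ h₂ h₃
  calc (3 : ℕ∞) ≤ 0 + 1 + 1 + 1 + 1 := by norm_num
    _ ≤ _ := le_trans (by
        gcongr
        refine le_trans ?_ h₂
        gcongr
        refine le_trans ?_ h₁
        gcongr
        refine le_trans ?_ h₀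
        gcongr
        exact bot_le) h₃

/-- Two forms of positive degree in four variables have a common nontrivial zero. -/
theorem exists_ne_zero_eval_eq_zero {g h : MvPolynomial (Fin 4) ℂ}
    (hg : eval 0 g = 0) (hh : eval 0 h = 0) : ∃ y, y ≠ 0 ∧ eval y g = 0 ∧ eval y h = 0 := by
  by_contra! hcon
  let I : Ideal (MvPolynomial (Fin 4) ℂ) := Ideal.span {g, h}
  let M : Ideal (MvPolynomial (Fin 4) ℂ) := RingHom.ker (eval (0 : Fin 4 → ℂ))
  have hM : M ≤ I.radical := by
    rw [← vanishingIdeal_zeroLocus_eq_radical (K := ℂ)]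
    intro p hp
    rw [mem_vanishingIdeal_iff]
    intro y hy
    have hgy : eval y g = 0 := hy g (Ideal.subset_span (by simp))
    have hhy : eval y h = 0 := hy h (Ideal.subset_span (by simp))
    obtain rfl : y = 0 := by
      by_contra hy0
      exact hcon y hy0 hgy hhy
    exact hp
  have hIM : I ≤ M := by
    rw [Ideal.span_le]
    rintro p (rfl | rfl)
    exacts [hg, hh]
  have hMprime : M.IsPrime := RingHom.ker_isPrime _
  have hmin : M ∈ I.minimalPrimes :=
    ⟨⟨hMprime, hIM⟩, fun J hJ _ => hM.trans (hJ.1.radical_le_iff.2 hJ.2)⟩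
  have hle : M.height ≤ 2 := by
    refine (Ideal.height_le_card_of_mem_minimalPrimes_span (Set.toFinite _) hmin).trans ?_
    have h₁ := Set.ncard_insert_le g {h}
    rw [Set.ncard_singleton] at h₁
    exact_mod_cast h₁
  have := three_le_height_ker_eval_zero.trans hle
  norm_num at this

theorem homogeneousComponent_mul_totalDegree (g h : MvPolynomial (Fin 4) ℂ) :
    homogeneousComponent (g.totalDegree + h.totalDegree) (g * h) =
      homogeneousComponent g.totalDegree g * homogeneousComponent h.totalDegree h := by
  ext d
  rw [coeff_homogeneousComponent]
  split_ifs with hd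
  · rw [coeff_mul, coeff_mul]
    refine Finset.sum_congr rfl fun p hp => ?_
    rw [Finset.HasAntidiagonal.mem_antidiagonal] at hp
    rw [← hp, map_add] at hd
    rw [coeff_homogeneousComponent, coeff_homogeneousComponent]
    by_cases h₁ : coeff p.1 g = 0
    · simp [h₁]
    by_cases h₂ : coeff p.2 h = 0
    · simp [h₂]
    have h₁' : p.1.degree ≤ g.totalDegree := le_totalDegree (mem_support_iff.2 h₁)
    have h₂' : p.2.degree ≤ h.totalDegree := le_totalDegree (mem_support_iff.2 h₂)
    rw [if_pos (by omega), if_pos (by omega)]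
  · exact (((homogeneousComponent_isHomogeneous _ g).mul
      (homogeneousComponent_isHomogeneous _ h)).coeff_eq_zero hd).symm

theorem rank_hessianAt_mul_le {g h : MvPolynomial (Fin 4) ℂ} {y : Fin 4 → ℂ} (hg : eval y g = 0)
    (hh : eval y h = 0) : (hessianAt (g * h) y).rank ≤ 2 := by
  have : hessianAt (g * h) y = (Matrix.of fun i => ![gradientAt g y i, gradientAt h y i]) *
      Matrix.of ![gradientAt h y, gradientAt g y] := by
    ext i j
    simp [hessianAt, gradientAt, Matrix.mul_apply, Fin.sum_univ_two, hg, hh]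
    ring
  rw [this]
  exact (Matrix.rank_mul_le_left _ _).trans (Matrix.rank_le_width _)

theorem gradientAt_mul_eq_zero {g h : MvPolynomial (Fin 4) ℂ} {y : Fin 4 → ℂ} (hg : eval y g = 0)
    (hh : eval y h = 0) : gradientAt (g * h) y = 0 := by
  ext i
  simp [gradientAt, hg, hh]

theorem isUnit_of_totalDegree_eq_zero {g : MvPolynomial (Fin 4) ℂ} (hg : g ≠ 0)
    (h : g.totalDegree = 0) : IsUnit g := by
  rw [totalDegree_eq_zero_iff_eq_C] at h
  rw [h] at hg ⊢
  exact (isUnit_iff_ne_zero.2 (by simpa using hg)).map C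

theorem eval_zero_of_isHomogeneous {g : MvPolynomial (Fin 4) ℂ} {n : ℕ} (hg : g.IsHomogeneous n)
    (hn : n ≠ 0) : eval 0 g = 0 := by
  simpa [hn] using eval_smul_of_isHomogeneous hg 0 0

/-- A surface whose only singularities are nodes is irreducible. -/
theorem irreducible_of_rank_hessianAt {f : MvPolynomial (Fin 4) ℂ} {n : ℕ} (hn : n ≠ 0)
    (hf : f.IsHomogeneous n)
    (hrank : ∀ y, y ≠ 0 → gradientAt f y = 0 → (hessianAt f y).rank = 3) : Irreducible f := by
  have hf0 : f ≠ 0 := by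
    rintro rfl
    have h : hessianAt (0 : MvPolynomial (Fin 4) ℂ) 1 = 0 := by
      ext
      simp [hessianAt]
    have := hrank 1 one_ne_zero (by ext; simp [gradientAt])
    simp [h] at this
  refine ⟨fun hu => ?_, fun {g h} hgh => ?_⟩
  · have := hu.map (eval (0 : Fin 4 → ℂ))
    rw [eval_zero_of_isHomogeneous hf hn] at this
    exact not_isUnit_zero this
  · by_contra! hunit
    have hg0 : g ≠ 0 := by rintro rfl; simp [hf0] at hgh
    have hh0 : h ≠ 0 := by rintro rfl; simp [hf0] at hgh
    have hdeg : n = g.totalDegree + h.totalDegree := by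
      rw [← totalDegree_mul_of_isDomain hg0 hh0, ← hgh, hf.totalDegree hf0]
    have htop := homogeneousComponent_mul_totalDegree g h
    rw [← hgh, ← hdeg, homogeneousComponent_eq_self hf] at htop
    obtain ⟨y, hy, hgy, hhy⟩ := exists_ne_zero_eval_eq_zero
      (eval_zero_of_isHomogeneous (homogeneousComponent_isHomogeneous g.totalDegree g)
        fun h => hunit.1 (isUnit_of_totalDegree_eq_zero hg0 h))
      (eval_zero_of_isHomogeneous (homogeneousComponent_isHomogeneous h.totalDegree h)
        fun h => hunit.2 (isUnit_of_totalDegree_eq_zero hh0 h))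
    have h₁ := hrank y hy (by rw [htop, gradientAt_mul_eq_zero hgy hhy])
    have h₂ := rank_hessianAt_mul_le hgy hhy
    rw [← htop] at h₂
    omega

end Irreducibility

section SingularSet

variable {σ ι : Type*} [Fintype σ]

theorem hessianAt_smul {f : MvPolynomial σ ℂ} {n : ℕ} (hf : f.IsHomogeneous n) (c : ℂ)
    (x : σ → ℂ) : hessianAt f (c • x) = c ^ (n - 1 - 1) • hessianAt f x := by
  ext i j
  simp [hessianAt, eval_smul_of_isHomogeneous hf.pderiv.pderiv]

theorem rank_hessianAt_eq_three {f : MvPolynomial (Fin 4) ℂ} {n : ℕ} (hf : f.IsHomogeneous n)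
    {x : Fin 4 → ℂ} (hx : x ≠ 0) (hgrad : gradientAt f x = 0)
    (hker : ∀ w, (hessianAt f x).mulVec w = 0 → ∃ c : ℂ, w = c • x) :
    (hessianAt f x).rank = 3 := by
  have hspan : LinearMap.ker (hessianAt f x).mulVecLin = ℂ ∙ x := by
    ext w
    rw [LinearMap.mem_ker, Matrix.mulVecLin_apply, Submodule.mem_span_singleton]
    constructor
    · intro hw
      obtain ⟨c, rfl⟩ := hker w hw
      exact ⟨c, rfl⟩
    · rintro ⟨c, rfl⟩
      rw [Matrix.mulVec_smul, hessianAt_mulVec_self hf, hgrad, smul_zero, smul_zero]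
  have h := LinearMap.finrank_range_add_finrank_ker (hessianAt f x).mulVecLin
  rw [hspan, finrank_span_singleton hx, Module.finrank_fin_fun] at h
  unfold Matrix.rank
  omega

/-- The number of singular points of a hypersurface described by representatives. -/
theorem card_singular_points {f : MvPolynomial σ ℂ} {n : ℕ} (hf : f.IsHomogeneous n) (S : Set ι)
    [Finite S] (x : ι → σ → ℂ) (hx : ∀ i ∈ S, x i ≠ 0)
    (hinj : ∀ i ∈ S, ∀ j, i ≠ j → ∀ c : ℂ, x j ≠ c • x i)
    (hgrad : ∀ i ∈ S, gradientAt f (x i) = 0)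
    (hsing : ∀ y, y ≠ 0 → gradientAt f y = 0 → ∃ i ∈ S, ∃ c : ℂ, y = c • x i) :
    {p : Projectivization ℂ (σ → ℂ) | ∀ i, eval p.rep (pderiv i f) = 0}.Finite ∧
    Nat.card {p : Projectivization ℂ (σ → ℂ) | ∀ i, eval p.rep (pderiv i f) = 0} = Nat.card S := by
  let P : S → Projectivization ℂ (σ → ℂ) := fun i => Projectivization.mk ℂ (x i) (hx i i.2)
  have hP : Function.Injective P := by
    intro i j hij
    obtain ⟨c, hc⟩ := (Projectivization.mk_eq_mk_iff' _ _ _ _ _).1 hij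
    by_contra hne
    exact hinj j j.2 i (fun h => hne (Subtype.ext h.symm)) c hc.symm
  have hrange : {p : Projectivization ℂ (σ → ℂ) | ∀ i, eval p.rep (pderiv i f) = 0} =
      Set.range P := by
    ext p
    rw [Set.mem_ofPred_eq, Set.mem_range]
    constructor
    · intro hp
      obtain ⟨i, hi, c, hc⟩ := hsing p.rep p.rep_nonzero (funext hp)
      refine ⟨⟨i, hi⟩, ?_⟩
      have hc0 : c ≠ 0 := by
        rintro rfl
        exact p.rep_nonzero (by rw [hc, zero_smul])
      rw [← p.mk_rep]
      exact (Projectivization.mk_eq_mk_iff' _ _ _ _ _).2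
        ⟨c⁻¹, by rw [hc, smul_smul, inv_mul_cancel₀ hc0, one_smul]⟩
    · rintro ⟨i, rfl⟩ k
      have h := (P i).mk_rep
      obtain ⟨c, hc⟩ := (Projectivization.mk_eq_mk_iff' _ _ _ _ _).1 h
      exact congrFun (hc ▸ gradientAt_smul hf c (x i) ▸ by rw [hgrad i i.2, smul_zero] :
        gradientAt f (P i).rep = 0) k
  rw [hrange]
  exact ⟨Set.finite_range P, Nat.card_range_of_injective hP⟩

end SingularSet

/-- Nodes of a surface that impose independent conditions can be smoothed independently. -/
theorem exists_nodal_of_independent {ι : Type*} [Fintype ι] [DecidableEq ι] {n : ℕ} (hn : n ≠ 0)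
    {F : MvPolynomial (Fin 4) ℂ} {G : ι → MvPolynomial (Fin 4) ℂ} {v : ι → Fin 4 → ℂ}
    {k : ι → Fin 4}
    (hF : F.IsHomogeneous n) (hG : ∀ i, (G i).IsHomogeneous n) (hk : ∀ i, v i (k i) = 1)
    (hv : ∀ i, gradientAt F (v i) = 0)
    (hker : ∀ i w, (hessianAt F (v i)).mulVec w = 0 → ∃ c : ℂ, w = c • v i)
    (hsing : ∀ y, y ≠ 0 → gradientAt F y = 0 → ∃ i, ∃ c : ℂ, y = c • v i)
    (hGv : ∀ i, eval (v i) (G i) ≠ 0) (hGv' : ∀ i j, j ≠ i → eval (v i) (G j) = 0) (S : Set ι) :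
    ∃ f : MvPolynomial (Fin 4) ℂ, Irreducible f ∧ f.IsHomogeneous n ∧
      {x : Projectivization ℂ (Fin 4 → ℂ) | ∀ i, eval x.rep (pderiv i f) = 0}.Finite ∧
      Nat.card {x : Projectivization ℂ (Fin 4 → ℂ) | ∀ i, eval x.rep (pderiv i f) = 0} =
        Nat.card S ∧
      ∀ x : Projectivization ℂ (Fin 4 → ℂ), (∀ i, eval x.rep (pderiv i f) = 0) →
        (hessianAt f x.rep).rank = 3 := by
  obtain ⟨f, hf, x, hx, hinj, hgrad, hkerf, hsingf⟩ :=
    exists_smoothing hn hF hG hk hv hker hsing hGv hGv' S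
  have hrank (y : Fin 4 → ℂ) (hy : y ≠ 0) (hy' : gradientAt f y = 0) :
      (hessianAt f y).rank = 3 := by
    obtain ⟨i, hi, c, rfl⟩ := hsingf y hy hy'
    have hc : c ≠ 0 := by
      rintro rfl
      exact hy (zero_smul _ _)
    refine rank_hessianAt_eq_three hf hy hy' fun w hw => ?_
    rw [hessianAt_smul hf, Matrix.smul_mulVec, smul_eq_zero_iff_right (pow_ne_zero _ hc)] at hw
    obtain ⟨d, rfl⟩ := hkerf i hi w hw
    exact ⟨d * c⁻¹, by rw [smul_smul, mul_assoc, inv_mul_cancel₀ hc, mul_one]⟩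
  have hcard := card_singular_points hf S x hx hinj hgrad hsingf
  exact ⟨f, irreducible_of_rank_hessianAt hn hf hrank, hf, hcard.1, hcard.2, fun p hp =>
    hrank p.rep p.rep_nonzero (funext hp)⟩

section BarthSextic

variable {R S : Type*} [CommRing R] [CommRing S]

/-- The Barth sextic, with `s` a square root of `5`. -/
def barthForm (s : R) (x : Fin 4 → R) : R :=
  ((3 + s) * x 0 ^ 2 - 2 * x 1 ^ 2) * ((3 + s) * x 1 ^ 2 - 2 * x 2 ^ 2) *
      ((3 + s) * x 2 ^ 2 - 2 * x 0 ^ 2) -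
    2 * (2 + s) * x 3 ^ 2 * (x 0 ^ 2 + x 1 ^ 2 + x 2 ^ 2 - x 3 ^ 2) ^ 2

/-- The partial derivatives of the Barth sextic with respect to the squares of the coordinates. -/
def barthSquareGrad (s : R) (x : Fin 4 → R) : Fin 4 → R :=
  let a := (3 + s) * x 0 ^ 2 - 2 * x 1 ^ 2
  let b := (3 + s) * x 1 ^ 2 - 2 * x 2 ^ 2
  let c := (3 + s) * x 2 ^ 2 - 2 * x 0 ^ 2
  let k := x 0 ^ 2 + x 1 ^ 2 + x 2 ^ 2 - x 3 ^ 2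
  let e := 2 * (2 + s)
  ![(3 + s) * b * c - 2 * a * b - 2 * e * x 3 ^ 2 * k,
    (3 + s) * a * c - 2 * b * c - 2 * e * x 3 ^ 2 * k,
    (3 + s) * a * b - 2 * a * c - 2 * e * x 3 ^ 2 * k,
    -e * k * (k - 2 * x 3 ^ 2)]

/-- The second partial derivatives of the Barth sextic with respect to the squares of the
coordinates. -/
def barthSquareHess (s : R) (x : Fin 4 → R) : Fin 4 → Fin 4 → R :=
  let a := (3 + s) * x 0 ^ 2 - 2 * x 1 ^ 2
  let b := (3 + s) * x 1 ^ 2 - 2 * x 2 ^ 2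
  let c := (3 + s) * x 2 ^ 2 - 2 * x 0 ^ 2
  let k := x 0 ^ 2 + x 1 ^ 2 + x 2 ^ 2 - x 3 ^ 2
  let e := 2 * (2 + s)
  let t := 3 + s
  let w := x 3 ^ 2
  let l := -2 * e * k + 2 * e * w
  let m₀ := t ^ 2 * a + 4 * c - 2 * t * b - 2 * e * w
  let m₁ := t ^ 2 * b + 4 * a - 2 * t * c - 2 * e * w
  let m₂ := t ^ 2 * c + 4 * b - 2 * t * a - 2 * e * w
  ![![-4 * t * b - 2 * e * w, m₂, m₁, l], ![m₂, -4 * t * c - 2 * e * w, m₀, l],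
    ![m₁, m₀, -4 * t * a - 2 * e * w, l], ![l, l, l, 4 * e * k - 2 * e * w]]

/-- The gradient of the Barth sextic. -/
def barthGrad (s : R) (x : Fin 4 → R) (i : Fin 4) : R :=
  2 * x i * barthSquareGrad s x i

/-- The Hessian matrix of the Barth sextic. -/
def barthHess (s : R) (x : Fin 4 → R) : Matrix (Fin 4) (Fin 4) R :=
  Matrix.of fun i j => 4 * x i * x j * barthSquareHess s x i j +
    if i = j then 2 * barthSquareGrad s x i else 0

theorem map_barthSquareGrad (φ : R →+* S) (s : R) (x : Fin 4 → R) (i : Fin 4) :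
    φ (barthSquareGrad s x i) = barthSquareGrad (φ s) (φ ∘ x) i := by
  fin_cases i <;> simp [barthSquareGrad, map_ofNat φ]

theorem map_barthSquareHess (φ : R →+* S) (s : R) (x : Fin 4 → R) (i j : Fin 4) :
    φ (barthSquareHess s x i j) = barthSquareHess (φ s) (φ ∘ x) i j := by
  fin_cases i <;> fin_cases j <;> simp [barthSquareHess, map_ofNat φ]

theorem map_barthGrad (φ : R →+* S) (s : R) (x : Fin 4 → R) (i : Fin 4) :
    φ (barthGrad s x i) = barthGrad (φ s) (φ ∘ x) i := by
  simp [barthGrad, map_barthSquareGrad, map_ofNat φ]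

theorem map_barthHess (φ : R →+* S) (s : R) (x : Fin 4 → R) :
    (barthHess s x).map φ = barthHess (φ s) (φ ∘ x) := by
  ext i j
  simp [barthHess, map_barthSquareGrad, map_barthSquareHess, apply_ite φ, map_ofNat φ]

theorem pderiv_two (i : Fin 4) : pderiv i (2 : MvPolynomial (Fin 4) R) = 0 :=
  (pderiv i).map_natCast 2

theorem pderiv_three (i : Fin 4) : pderiv i (3 : MvPolynomial (Fin 4) R) = 0 :=
  (pderiv i).map_natCast 3

theorem pderiv_barthForm (s : R) (i : Fin 4) :
    pderiv i (barthForm (C s) X) = barthGrad (C s) X i := by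
  fin_cases i <;>
    simp [pderiv_two, pderiv_three, barthForm, barthGrad, barthSquareGrad, pderiv_X] <;> ring

theorem pderiv_barthGrad (s : R) (i j : Fin 4) :
    pderiv i (barthGrad (C s) X j) = barthHess (C s) X i j := by
  fin_cases i <;> fin_cases j <;>
    simp [pderiv_two, pderiv_three, barthHess, barthGrad, barthSquareGrad, barthSquareHess,
      pderiv_X] <;>
    ring

theorem isHomogeneous_barthForm (s : R) :
    (barthForm (C s) X : MvPolynomial (Fin 4) R).IsHomogeneous 6 := by
  have hX (i : Fin 4) : (X i ^ 2 : MvPolynomial (Fin 4) R).IsHomogeneous 2 :=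
    (isHomogeneous_X R i).pow 2
  have hq (a b : R) (i j : Fin 4) :
      (C a * X i ^ 2 - C b * X j ^ 2 : MvPolynomial (Fin 4) R).IsHomogeneous 2 :=
    ((hX i).C_mul a).sub ((hX j).C_mul b)
  have h := (((hq (3 + s) 2 0 1).mul (hq (3 + s) 2 1 2)).mul (hq (3 + s) 2 2 0)).sub
    (((hX 3).C_mul (2 * (2 + s))).mul (((((hX 0).add (hX 1)).add (hX 2)).sub (hX 3)).pow 2))
  simpa [barthForm, map_ofNat C] using h

theorem gradientAt_barthForm (s : ℂ) (x : Fin 4 → ℂ) :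
    gradientAt (barthForm (C s) X) x = barthGrad s x := by
  ext i
  have h := map_barthGrad (eval x) (C s) X i
  rw [eval_C] at h
  rw [gradientAt, pderiv_barthForm, h]
  congr 1
  ext
  simp

theorem hessianAt_barthForm (s : ℂ) (x : Fin 4 → ℂ) :
    hessianAt (barthForm (C s) X) x = barthHess s x := by
  have h := map_barthHess (eval x) (C s) X
  rw [eval_C] at h
  have hx : eval x ∘ X = x := by
    ext
    simp
  rw [hx] at h
  rw [← h]
  ext i j
  rw [hessianAt, Matrix.of_apply, pderiv_barthForm, pderiv_barthGrad, Matrix.map_apply]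

end BarthSextic

section BarthNodes

/-- Coordinates in `ℤ[√5]` of the nodes of the Barth sextic. -/
def barthNode : Fin 65 → Fin 4 → ℤ√5 :=
  let a : ℤ√5 := ⟨-1, 1⟩
  let b : ℤ√5 := ⟨1, 1⟩
  ![![1, 0, 0, 0], ![0, 1, 0, 0], ![0, 0, 1, 0], ![a, 2, b, 0], ![b, a, 2, 0], ![2, b, a, 0],
      ![a, 2, -b, 0], ![-b, a, 2, 0], ![2, -b, a, 0], ![a, -2, b, 0], ![b, a, -2, 0],
      ![-2, b, a, 0], ![a, -2, -b, 0], ![-b, a, -2, 0], ![-2, -b, a, 0], ![1, 0, 0, 1],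
      ![0, 1, 0, 1], ![0, 0, 1, 1], ![-1, 0, 0, 1], ![0, -1, 0, 1], ![0, 0, -1, 1],
      ![a, 2, b, 4], ![b, a, 2, 4], ![2, b, a, 4], ![a, 2, -b, 4], ![-b, a, 2, 4],
      ![2, -b, a, 4], ![a, -2, b, 4], ![b, a, -2, 4], ![-2, b, a, 4], ![a, -2, -b, 4],
      ![-b, a, -2, 4], ![-2, -b, a, 4], ![-a, 2, b, 4], ![b, -a, 2, 4], ![2, b, -a, 4],
      ![-a, 2, -b, 4], ![-b, -a, 2, 4], ![2, -b, -a, 4], ![-a, -2, b, 4], ![b, -a, -2, 4],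
      ![-2, b, -a, 4], ![-a, -2, -b, 4], ![-b, -a, -2, 4], ![-2, -b, -a, 4], ![1, 1, 1, 1],
      ![1, 1, -1, 1], ![1, -1, 1, 1], ![1, -1, -1, 1], ![-1, 1, 1, 1], ![-1, 1, -1, 1],
      ![-1, -1, 1, 1], ![-1, -1, -1, 1], ![0, a, b, 2], ![b, 0, a, 2], ![a, b, 0, 2],
      ![0, a, -b, 2], ![-b, 0, a, 2], ![a, -b, 0, 2], ![0, -a, b, 2], ![b, 0, -a, 2],
      ![-a, b, 0, 2], ![0, -a, -b, 2], ![-b, 0, -a, 2], ![-a, -b, 0, 2]]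

/-- A coordinate in which the given node does not vanish. -/
def barthPivot (i : Fin 65) : Fin 4 :=
  if barthNode i 0 ≠ 0 then 0 else if barthNode i 1 ≠ 0 then 1 else 2

theorem barthNode_pivot_ne_zero : ∀ i, barthNode i (barthPivot i) ≠ 0 := by
  decide +kernel

theorem barthGrad_barthNode : ∀ i k, barthGrad Zsqrtd.sqrtd (barthNode i) k = 0 := by
  decide +kernel

theorem det_minor_barthHess_ne_zero : ∀ i, ((barthHess Zsqrtd.sqrtd (barthNode i)).submatrix
    (barthPivot i).succAbove (barthPivot i).succAbove).det ≠ 0 := by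
  simp only [Matrix.det_fin_three]
  decide +kernel

/-- Exponents of sextic monomials which are linearly independent on the nodes. -/
def sexticExponents : List (ℕ × ℕ × ℕ × ℕ) :=
  [(0, 0, 0, 6), (0, 0, 1, 5), (0, 0, 2, 4), (0, 0, 3, 3), (0, 0, 4, 2), (0, 0, 5, 1),
   (0, 0, 6, 0), (0, 1, 0, 5), (0, 1, 1, 4), (0, 1, 2, 3), (0, 1, 3, 2), (0, 1, 4, 1),
   (0, 1, 5, 0), (0, 2, 0, 4), (0, 2, 1, 3), (0, 2, 2, 2), (0, 2, 3, 1), (0, 2, 4, 0),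
   (0, 3, 0, 3), (0, 3, 1, 2), (0, 3, 2, 1), (0, 3, 3, 0), (0, 4, 0, 2), (0, 4, 1, 1),
   (0, 4, 2, 0), (0, 5, 0, 1), (0, 5, 1, 0), (0, 6, 0, 0), (1, 0, 0, 5), (1, 0, 1, 4),
   (1, 0, 2, 3), (1, 0, 3, 2), (1, 0, 4, 1), (1, 0, 5, 0), (1, 1, 0, 4), (1, 1, 1, 3),
   (1, 1, 2, 2), (1, 1, 3, 1), (1, 1, 4, 0), (1, 2, 0, 3), (1, 2, 1, 2), (1, 2, 2, 1),
   (1, 2, 3, 0), (1, 3, 0, 2), (1, 3, 1, 1), (1, 3, 2, 0), (1, 4, 0, 1), (1, 4, 1, 0),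
   (1, 5, 0, 0), (2, 0, 0, 4), (2, 0, 1, 3), (2, 0, 2, 2), (2, 0, 4, 0), (2, 1, 0, 3),
   (2, 1, 1, 2), (2, 1, 3, 0), (2, 2, 0, 2), (2, 2, 2, 0), (3, 0, 0, 3), (3, 0, 1, 2),
   (3, 0, 3, 0), (3, 1, 0, 2), (3, 1, 1, 1), (3, 1, 2, 0), (6, 0, 0, 0)]

/-- Coefficients, as digits in base `11`, of sextic forms which are dual to the nodes
modulo `11`. -/
def sexticCoeffs : List ℕ :=
  [4457918096934637627017540297059173617673207677569186433805417157596,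
   519914585148224731288951589300580155692565941579671015975864,
   62390294996719495271630284562548756546881253415844558356295,
   2447894183634593212936812213095990373566910383673307561662950127497,
   3272791867258915943223464298538081249599675734202585937389211565727,
   20291296516607516820491792249024113328924909076757843947378142225,
   2445735124102644463339852023520534550771571611412745492498759809037,
   1225623403876716683498270800397744261639027569712772881397972803717,
   16941999684756424791422288609327323217156076781683841047388489597,
   2052677007603723216128399587979218796944484746627102766407052471727,
   3275393789238506312001367095710605073940909929453147996822688198129,
   16858958034505157861328394925812786630471963549659596190273301226,
   2050517963883993655038335384965521317849720505725969308847136936927,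
   1223021457835053636557700197587762088186772623343739753915684484455,
   20208257272563517706664679129255411676464066727435686105376137878,
   727888424842417807647483196108699197004066236438902268186119,
   748841435993704991628233813308896815190863431712914566683321,
   707091157191610452525130297767823510777581517340113916600908,
   727888424840012376838067020006185576984411739247613011661019,
   748700813491040404608590477513349423220797644873726102601600,
   707091262843378044250915153767669895832057809004855766321559,
   194512463083246508068760216339755430306898007462769263611623908698,
   248101273031894518385051230305183776663265995700225718856734584118,
   177700484618713661676529400049995443564100433326500333371391239498,
   231160981627411479748649472717727526140231605807853101407059084807,
   194341390823937964689815639920247088635942534973055183272153008380,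
   264782234996282281202480451326934628475164366759643546001832117769,
   248101232923764213773228955362155696482588157154578314338641504140,
   211065235150827285174952329069154862811050740568785785674599495469,
   264741971492577618558220594103334132754165950672154570207980035516,
   211065192292698737500076256749715081165781106116357415513570543769,
   231377431798582865667949277993156838039549060432896646922997426831,
   177660224052456832470309508709409343729275912745669129415640015629,
   247930117993868993932566009178839151267706598530402659821034067768,
   194512506160075838511173026872686541950529487079326457570707618149,
   288199641170011462304385644209206465532902238222701362951239414059,
   211281601855699986533760081794900890637662955116784790940645091279,
   247930161070696708513782314792803416489120008454458702451279554609,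
   154227718146815482931624889453451530602117969858621297828735003508,
   194341350715805781227238516990557826150185039436308125583533174008,
   231161021954336726763923605721608854245144578965140605145137683598,
   154242818034904442039550964907606612935160515203313544453434719519,
   231377388940452686148940983469540606878111773546136396417215682319,
   211281642182623370787237608473986935651115020995697425296184069878,
   288214737808158137608522821239600939657337510237066380468409820970,
   335023430085127791179679553746020073900100463712469230010329309307,
   77265882654349986985074582154747467410494119907228501090759419204,
   107271164333136049749745562153833457136947839372910759856417247007,
   365305513254288820120055930747932960159820981900936676100277943898,
   107417113584952205667195423802844672316780289578024386475524636137,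
   365174662046844305215892177462073112965845151394027926470080630524,
   335169380586921748560125145558016138365332341032146605463304368767,
   77135030634419901129963604262947468191019963851825723591390005452,
   2039251477375211761086836200920116880805999796164344573352637,
   147967144694777403474304155341868506254393787461651160621373597,
   10075012754464802636675715326043987576739323053400779331331303445,
   2039079523253913583387217235836779473051055419231033029814777,
   188229179675539364867087523753902725817394851319516222230391608,
   26821502929242894477501895552351482160122041328194867588956991608,
   2038938982924846012154295454707779820546941531970134448588526,
   175647293638424841237150779798151244452562482994418745063708998,
   26798855534566267289584052950135984236867715091924862684529543877,
   2039110772698950158280471310458022832845936208869794113722528,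
   160549030520588391920789329585620294838372040107392883174427247,
   10052365359788175448757872723828489654568479621048030387855020718]

/-- The combination of the entries of a list whose coefficients are the base `11` digits of a
number. -/
def digitDot {R : Type*} [CommSemiring R] : List R → ℕ → R
  | [], _ => 0
  | m :: l, n => (n % 11 : ℕ) * m + digitDot l (n / 11)

/-- The function `digitDot` on natural numbers, in a form suited to kernel computation. -/
def natDigitDot : List ℕ → ℕ → ℕ
  | [], _ => 0
  | m :: l, n => Nat.add (Nat.mul (Nat.mod n 11) m) (natDigitDot l (Nat.div n 11))

theorem natDigitDot_eq (l : List ℕ) (n : ℕ) : natDigitDot l n = digitDot l n := by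
  induction l generalizing n with
  | nil => rfl
  | cons m l ih => exact congrArg _ (ih _)

/-- The values of the monomials with exponents `sexticExponents`. -/
def sexticMonomials {R : Type*} [CommSemiring R] (x : Fin 4 → R) : List R :=
  sexticExponents.map fun e => x 0 ^ e.1 * x 1 ^ e.2.1 * x 2 ^ e.2.2.1 * x 3 ^ e.2.2.2

/-- Sextic forms which are dual to the nodes of the Barth sextic modulo `11`. -/
def sexticForm {R : Type*} [CommSemiring R] (j : Fin 65) (x : Fin 4 → R) : R :=
  digitDot (sexticMonomials x) (sexticCoeffs.getD j 0)

theorem map_digitDot {R S : Type*} [CommSemiring R] [CommSemiring S] (φ : R →+* S) (l : List R)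
    (n : ℕ) : φ (digitDot l n) = digitDot (l.map φ) n := by
  induction l generalizing n with
  | nil => simp [digitDot]
  | cons e l ih => simp [digitDot, ih]

theorem map_sexticForm {R S : Type*} [CommSemiring R] [CommSemiring S] (φ : R →+* S)
    (j : Fin 65) (x : Fin 4 → R) : φ (sexticForm j x) = sexticForm j (φ ∘ x) := by
  rw [sexticForm, map_digitDot, sexticForm, sexticMonomials, List.map_map]
  congr 2
  ext e
  simp

theorem isHomogeneous_digitDot {R : Type*} [CommSemiring R] {m : ℕ}
    {l : List (MvPolynomial (Fin 4) R)} (hl : ∀ p ∈ l, p.IsHomogeneous m) (n : ℕ) :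
    (digitDot l n).IsHomogeneous m := by
  induction l generalizing n with
  | nil => exact isHomogeneous_zero _ _ _
  | cons p l ih =>
    refine IsHomogeneous.add ?_ (ih (fun e he => hl e (List.mem_cons_of_mem _ he)) _)
    rw [← map_natCast C]
    exact (hl p List.mem_cons_self).C_mul _

theorem isHomogeneous_sexticForm {R : Type*} [CommSemiring R] (j : Fin 65) :
    (sexticForm j X : MvPolynomial (Fin 4) R).IsHomogeneous 6 := by
  have hexp : ∀ e ∈ sexticExponents, e.1 + e.2.1 + e.2.2.1 + e.2.2.2 = 6 := by decide +kernel
  refine isHomogeneous_digitDot (fun p hp => ?_) _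
  obtain ⟨e, he, rfl⟩ := List.mem_map.1 hp
  rw [← hexp e he]
  exact (((isHomogeneous_X_pow 0 _).mul (isHomogeneous_X_pow 1 _)).mul
    (isHomogeneous_X_pow 2 _)).mul (isHomogeneous_X_pow 3 _)

/-- Reductions modulo `11` of coordinates of the nodes, sending `√5` to `4`. -/
def barthResidue (i : Fin 65) (k : Fin 4) : ℕ :=
  (((barthNode i k).re + 4 * (barthNode i k).im) % 11).toNat

theorem natDigitDot_barthResidue : ∀ i j : Fin 65,
    natDigitDot (sexticMonomials (barthResidue i)) (sexticCoeffs.getD j 0) % 11 =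
      if i = j then 1 else 0 := by
  decide +kernel

/-- Reduction modulo `11`, sending `√5` to `4`. -/
def reductionModEleven : ℤ√5 →+* ZMod 11 :=
  Zsqrtd.lift ⟨4, by decide⟩

theorem reductionModEleven_barthNode : ∀ i k,
    reductionModEleven (barthNode i k) = (barthResidue i k : ZMod 11) := by
  decide +kernel

theorem reductionModEleven_sexticForm (i j : Fin 65) :
    reductionModEleven (sexticForm j (barthNode i)) = if i = j then 1 else 0 := by
  have hcomp : reductionModEleven ∘ barthNode i = Nat.castRingHom (ZMod 11) ∘ barthResidue i := by
    ext k
    rw [Function.comp_apply, reductionModEleven_barthNode]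
    rfl
  have h := congrArg (Nat.cast : ℕ → ZMod 11) (natDigitDot_barthResidue i j)
  rw [ZMod.natCast_mod, natDigitDot_eq] at h
  rw [map_sexticForm, hcomp, ← map_sexticForm]
  refine h.trans ?_
  split_ifs <;> simp

theorem det_sexticForm_ne_zero :
    (Matrix.of fun i j => sexticForm j (barthNode i)).det ≠ 0 := by
  intro h
  have h' := congrArg reductionModEleven h
  rw [RingHom.map_det, map_zero] at h'
  have : reductionModEleven.mapMatrix (Matrix.of fun i j => sexticForm j (barthNode i)) = 1 := by
    ext i j
    simp [reductionModEleven_sexticForm, Matrix.one_apply]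
  rw [this, Matrix.det_one] at h'
  exact (by decide : (1 : ZMod 11) ≠ 0) h'

end BarthNodes

section BarthNodesComplex

/-- The complex number `√5`. -/
noncomputable def sqrtFive : ℂ := (√5 : ℝ)

theorem sqrtFive_mul_self : sqrtFive * sqrtFive = 5 := by
  rw [sqrtFive, ← Complex.ofReal_mul, Real.mul_self_sqrt (by norm_num)]
  norm_num

/-- The embedding of `ℤ[√5]` in the complex numbers. -/
noncomputable def zsqrtFiveEmbedding : ℤ√5 →+* ℂ :=
  Zsqrtd.lift ⟨sqrtFive, by rw [sqrtFive_mul_self]; norm_num⟩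

theorem zsqrtFiveEmbedding_injective : Function.Injective zsqrtFiveEmbedding := by
  refine Zsqrtd.lift_injective _ fun n hn => ?_
  have h5 : n * n = 5 := hn.symm
  have : n ≤ 3 := by nlinarith
  have : -3 ≤ n := by nlinarith
  interval_cases n <;> omega

theorem zsqrtFiveEmbedding_sqrtd : zsqrtFiveEmbedding Zsqrtd.sqrtd = sqrtFive := by
  simp [zsqrtFiveEmbedding]

/-- The nodes of the Barth sextic. -/
noncomputable def complexNode (i : Fin 65) : Fin 4 → ℂ :=
  zsqrtFiveEmbedding ∘ barthNode i

theorem complexNode_pivot_ne_zero (i : Fin 65) : complexNode i (barthPivot i) ≠ 0 :=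
  (map_ne_zero_iff _ zsqrtFiveEmbedding_injective).2 (barthNode_pivot_ne_zero i)

theorem barthGrad_complexNode (i : Fin 65) : barthGrad sqrtFive (complexNode i) = 0 := by
  ext k
  rw [← zsqrtFiveEmbedding_sqrtd, complexNode, ← map_barthGrad, barthGrad_barthNode, map_zero]
  rfl

theorem det_minor_barthHess_complexNode_ne_zero (i : Fin 65) :
    ((barthHess sqrtFive (complexNode i)).submatrix (barthPivot i).succAbove
      (barthPivot i).succAbove).det ≠ 0 := by
  rw [← zsqrtFiveEmbedding_sqrtd, complexNode, ← map_barthHess, Matrix.submatrix_map]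
  have h := (map_ne_zero_iff _ zsqrtFiveEmbedding_injective).2 (det_minor_barthHess_ne_zero i)
  rwa [RingHom.map_det] at h

/-- If a matrix has a kernel vector with nonvanishing entry at `k`, and a nonvanishing principal
minor complementary to `k`, then its kernel is spanned by this vector. -/
theorem exists_eq_smul_of_det_minor_ne_zero {K : Type*} [Field K] {n : ℕ}
    {M : Matrix (Fin (n + 1)) (Fin (n + 1)) K} {k : Fin (n + 1)}
    (hM : (M.submatrix k.succAbove k.succAbove).det ≠ 0) {v w : Fin (n + 1) → K}
    (hv : M.mulVec v = 0) (hvk : v k ≠ 0) (hw : M.mulVec w = 0) : ∃ c : K, w = c • v := by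
  refine ⟨w k / v k, ?_⟩
  rw [← sub_eq_zero]
  set u := w - (w k / v k) • v with hu
  have huk : u k = 0 := by simp [hu, hvk]
  have hMu : M.mulVec u = 0 := by
    rw [hu, Matrix.mulVec_sub, Matrix.mulVec_smul, hv, hw, smul_zero, sub_zero]
  have h : (M.submatrix k.succAbove k.succAbove).mulVec (u ∘ k.succAbove) = 0 := by
    ext i
    have := congrFun hMu (k.succAbove i)
    rw [Matrix.mulVec, dotProduct, Fin.sum_univ_succAbove _ k, huk, mul_zero, zero_add] at this
    exact this
  have h0 := Matrix.eq_zero_of_mulVec_eq_zero hM h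
  ext i
  obtain rfl | ⟨j, rfl⟩ := Fin.eq_self_or_eq_succAbove k i
  · exact huk
  · exact congrFun h0 j

theorem exists_dual_sextics : ∃ G : Fin 65 → MvPolynomial (Fin 4) ℂ,
    (∀ j, (G j).IsHomogeneous 6) ∧
    ∀ i j, eval (complexNode i) (G j) = if i = j then 1 else 0 := by
  set M : Matrix (Fin 65) (Fin 65) ℂ := Matrix.of fun i j => sexticForm j (complexNode i) with hM
  have hdet : IsUnit M.det := by
    have h : M = zsqrtFiveEmbedding.mapMatrix
        (Matrix.of fun i j => sexticForm j (barthNode i)) := by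
      ext i j
      simp [hM, complexNode, map_sexticForm]
    rw [h, ← RingHom.map_det, isUnit_iff_ne_zero]
    exact (map_ne_zero_iff _ zsqrtFiveEmbedding_injective).2 det_sexticForm_ne_zero
  refine ⟨fun j => ∑ l, C (M⁻¹ l j) * sexticForm l X, fun j =>
    IsHomogeneous.sum _ _ _ fun l _ => (isHomogeneous_sexticForm l).C_mul _, fun i j => ?_⟩
  have heval (l : Fin 65) : eval (complexNode i) (sexticForm l X) = M i l := by
    rw [map_sexticForm, hM, Matrix.of_apply]
    congr 1
    ext
    simp
  simp only [map_sum, map_mul, eval_C, heval]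
  have h := congrFun (congrFun (Matrix.mul_nonsing_inv M hdet) i) j
  rw [Matrix.mul_apply, Matrix.one_apply] at h
  rw [← h]
  exact Finset.sum_congr rfl fun l _ => mul_comm _ _

end BarthNodesComplex

section BarthSingularities

/-- The point with squared coordinates `X, Y, Z, W` is one of the nodes of the Barth sextic. -/
def IsSquaredNode (X Y Z W : ℂ) : Prop :=
  ∃ i : Fin 65, ∃ c : ℂ, X = c * complexNode i 0 ^ 2 ∧ Y = c * complexNode i 1 ^ 2 ∧
    Z = c * complexNode i 2 ^ 2 ∧ W = c * complexNode i 3 ^ 2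

theorem exists_barthNode_eq_rotate : ∀ i, ∃ j,
    barthNode j = ![barthNode i 1, barthNode i 2, barthNode i 0, barthNode i 3] := by
  decide +kernel

theorem exists_barthNode_eq_update_neg : ∀ i k, ∃ j, ∃ u : ℤˣ,
    u • barthNode j = Function.update (barthNode i) k (-barthNode i k) := by
  decide +kernel

theorem IsSquaredNode.rotate {X Y Z W : ℂ} (h : IsSquaredNode X Y Z W) :
    IsSquaredNode Y Z X W := by
  obtain ⟨i, c, rfl, rfl, rfl, rfl⟩ := h
  obtain ⟨j, hj⟩ := exists_barthNode_eq_rotate i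
  exact ⟨j, c, by simp [complexNode, hj]⟩

theorem exists_eq_smul_complexNode_update_neg {v : Fin 4 → ℂ}
    (h : ∃ i, ∃ c : ℂ, v = c • complexNode i) (k : Fin 4) :
    ∃ i, ∃ c : ℂ, Function.update v k (-v k) = c • complexNode i := by
  obtain ⟨i, c, rfl⟩ := h
  obtain ⟨j, u, hj⟩ := exists_barthNode_eq_update_neg i k
  refine ⟨j, c * (u : ℤ), ?_⟩
  ext l
  have hl := congrArg zsqrtFiveEmbedding (congrFun hj l)
  rw [Pi.smul_apply, Units.smul_def, zsmul_eq_mul, map_mul, map_intCast] at hl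
  change _ = c * (u : ℤ) * zsqrtFiveEmbedding (barthNode j l)
  rw [mul_assoc, hl]
  by_cases hlk : l = k
  · subst hlk
    simp [complexNode]
  · simp [complexNode, hlk]

theorem exists_eq_smul_complexNode_of_sq_eq_sq {u v : Fin 4 → ℂ}
    (h : ∃ i, ∃ c : ℂ, u = c • complexNode i) (huv : ∀ k, v k ^ 2 = u k ^ 2) :
    ∃ i, ∃ c : ℂ, v = c • complexNode i := by
  have step {u' : Fin 4 → ℂ} (h : ∃ i, ∃ c : ℂ, u' = c • complexNode i) (k : Fin 4)
      (hk : v k ^ 2 = u' k ^ 2) : ∃ i, ∃ c : ℂ, Function.update u' k (v k) = c • complexNode i := by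
    obtain hk | hk := sq_eq_sq_iff_eq_or_eq_neg.1 hk
    · rwa [hk, Function.update_eq_self]
    · rw [hk]
      exact exists_eq_smul_complexNode_update_neg h k
  have h' := step (step (step (step h 0 (huv 0)) 1 (by simp [huv])) 2 (by simp [huv])) 3
    (by simp [huv])
  have hv : Function.update (Function.update (Function.update (Function.update u 0 (v 0)) 1 (v 1))
      2 (v 2)) 3 (v 3) = v := by
    ext k
    fin_cases k <;> simp
  rwa [hv] at h'

theorem IsSquaredNode.exists_eq_smul {v : Fin 4 → ℂ}
    (h : IsSquaredNode (v 0 ^ 2) (v 1 ^ 2) (v 2 ^ 2) (v 3 ^ 2)) :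
    ∃ i, ∃ c : ℂ, v = c • complexNode i := by
  obtain ⟨i, c, h₀, h₁, h₂, h₃⟩ := h
  obtain ⟨d, rfl⟩ := IsAlgClosed.exists_pow_nat_eq c two_pos
  refine exists_eq_smul_complexNode_of_sq_eq_sq ⟨i, d, rfl⟩ fun k => ?_
  fin_cases k <;> simp [mul_pow, *]

theorem isSquaredNode_of_barthNode {p : Fin 4 → ℤ√5} (hp : ∃ i, barthNode i = p) {X Y Z W : ℂ}
    (c : ℂ) (h₀ : X = c * zsqrtFiveEmbedding (p 0) ^ 2)
    (h₁ : Y = c * zsqrtFiveEmbedding (p 1) ^ 2) (h₂ : Z = c * zsqrtFiveEmbedding (p 2) ^ 2)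
    (h₃ : W = c * zsqrtFiveEmbedding (p 3) ^ 2) : IsSquaredNode X Y Z W := by
  obtain ⟨i, rfl⟩ := hp
  exact ⟨i, c, h₀, h₁, h₂, h₃⟩

variable {φ X Y Z W : ℂ}

theorem isSquaredNode_of_axis (hX : X = 0) (hY : Y = 0) (hW : W = 0 ∨ X + Y + Z = W) :
    IsSquaredNode X Y Z W := by
  subst hX hY
  obtain hW | hW := hW
  · exact isSquaredNode_of_barthNode (p := ![0, 0, 1, 0]) (by decide +kernel) Z
      (by simp) (by simp) (by simp) (by simp [hW])
  · exact isSquaredNode_of_barthNode (p := ![0, 0, 1, 1]) (by decide +kernel) Z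
      (by simp) (by simp) (by simp) (by simp [← hW])

theorem isSquaredNode_of_line (hφ : 2 * φ = 1 + sqrtFive) (hY : Y = φ ^ 2 * X)
    (hZ : Z = φ ^ 2 * Y) (hW : W = 0 ∨ X + Y + Z = W) : IsSquaredNode X Y Z W := by
  have h5 := sqrtFive_mul_self
  obtain hW | hW := hW
  · refine isSquaredNode_of_barthNode (p := ![⟨-1, 1⟩, 2, ⟨1, 1⟩, 0]) (by decide +kernel)
      (φ ^ 2 * X / 4) ?_ ?_ ?_ ?_ <;> simp [zsqrtFiveEmbedding] <;> grind
  · refine isSquaredNode_of_barthNode (p := ![⟨-1, 1⟩, 2, ⟨1, 1⟩, 4]) (by decide +kernel)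
      (φ ^ 2 * X / 4) ?_ ?_ ?_ ?_ <;> simp [zsqrtFiveEmbedding] <;> grind

theorem isSquaredNode_of_mul_eq_zero (hφ : 2 * φ = 1 + sqrtFive)
    (hX : X * (φ ^ 2 * (φ ^ 2 * Y - Z) * (φ ^ 2 * Z - X) -
      (φ ^ 2 * X - Y) * (φ ^ 2 * Y - Z)) = 0)
    (hY : Y * (φ ^ 2 * (φ ^ 2 * Z - X) * (φ ^ 2 * X - Y) -
      (φ ^ 2 * Y - Z) * (φ ^ 2 * Z - X)) = 0)
    (hZ : Z * (φ ^ 2 * (φ ^ 2 * X - Y) * (φ ^ 2 * Y - Z) -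
      (φ ^ 2 * Z - X) * (φ ^ 2 * X - Y)) = 0)
    (hW : W = 0 ∨ X + Y + Z = W) : IsSquaredNode X Y Z W := by
  have key {X Y Z : ℂ} (ha : φ ^ 2 * X - Y = 0)
      (hX : X * (φ ^ 2 * (φ ^ 2 * Y - Z) * (φ ^ 2 * Z - X) -
        (φ ^ 2 * X - Y) * (φ ^ 2 * Y - Z)) = 0) (hW : W = 0 ∨ X + Y + Z = W) :
      IsSquaredNode X Y Z W := by
    have hφ0 : φ ≠ 0 := by
      rintro rfl
      have := sqrtFive_mul_self
      grind
    rw [ha, zero_mul, sub_zero, mul_assoc, mul_eq_zero, mul_eq_zero_iff_left (pow_ne_zero 2 hφ0),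
      mul_eq_zero] at hX
    obtain hX | hb | hc := hX
    · exact isSquaredNode_of_axis hX (by rw [hX] at ha; simpa using ha) hW
    · exact isSquaredNode_of_line hφ (sub_eq_zero.1 ha).symm (sub_eq_zero.1 hb).symm hW
    · exact (isSquaredNode_of_line hφ (sub_eq_zero.1 hc).symm (sub_eq_zero.1 ha).symm
        (by rwa [add_rotate])).rotate
  have hprod : (φ ^ 2 * X - Y) * ((φ ^ 2 * Y - Z) * (φ ^ 2 * Z - X)) = 0 := by
    linear_combination (hX + hY + hZ) / 3
  rw [mul_eq_zero, mul_eq_zero] at hprod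
  obtain ha | hb | hc := hprod
  · exact key ha hX hW
  · exact (key hb hY (by rwa [← add_rotate])).rotate.rotate
  · exact (key hc hZ (by rwa [add_rotate])).rotate

theorem isSquaredNode_of_add_eq (hφ : 2 * φ = 1 + sqrtFive) (hW0 : W ≠ 0)
    (hX : X * (φ ^ 2 * (φ ^ 2 * Y - Z) * (φ ^ 2 * Z - X) -
      (φ ^ 2 * X - Y) * (φ ^ 2 * Y - Z) - φ ^ 3 * W ^ 2) = 0)
    (hY : Y * (φ ^ 2 * (φ ^ 2 * Z - X) * (φ ^ 2 * X - Y) -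
      (φ ^ 2 * Y - Z) * (φ ^ 2 * Z - X) - φ ^ 3 * W ^ 2) = 0)
    (hZ : Z * (φ ^ 2 * (φ ^ 2 * X - Y) * (φ ^ 2 * Y - Z) -
      (φ ^ 2 * Z - X) * (φ ^ 2 * X - Y) - φ ^ 3 * W ^ 2) = 0)
    (hW : X + Y + Z = 3 * W) : IsSquaredNode X Y Z W := by
  have hφ2 : φ ^ 2 = φ + 1 := by
    linear_combination (2 * φ + sqrtFive - 1) * hφ / 4 + sqrtFive_mul_self / 4
  have hφ0 : φ ≠ 0 := by
    rintro rfl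
    simp at hφ2
  have key {X Y Z : ℂ} (hX : X = 0)
      (hY : Y * (φ ^ 2 * (φ ^ 2 * Z - X) * (φ ^ 2 * X - Y) -
        (φ ^ 2 * Y - Z) * (φ ^ 2 * Z - X) - φ ^ 3 * W ^ 2) = 0)
      (hZ : Z * (φ ^ 2 * (φ ^ 2 * X - Y) * (φ ^ 2 * Y - Z) -
        (φ ^ 2 * Z - X) * (φ ^ 2 * X - Y) - φ ^ 3 * W ^ 2) = 0)
      (hW : X + Y + Z = 3 * W) : IsSquaredNode X Y Z W := by
    subst hX
    have hY0 : Y ≠ 0 := by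
      rintro rfl
      have : Z * (φ ^ 3 * W ^ 2) = 0 := by linear_combination -hZ
      simp_all
    have hZ0 : Z ≠ 0 := by
      rintro rfl
      have : Y * (φ ^ 3 * W ^ 2) = 0 := by linear_combination -hY
      simp_all
    have hY' := (mul_eq_zero_iff_left hY0).1 hY
    have hZ' := (mul_eq_zero_iff_left hZ0).1 hZ
    obtain rfl : Z = 3 * W - Y := by linear_combination hW
    have h₁ : (3 * W - Y) * (3 * W - Y - 2 * φ ^ 2 * Y) = φ * W ^ 2 :=
      mul_left_cancel₀ (pow_ne_zero 2 hφ0) (by linear_combination hY')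
    have h₂ : Y * (2 * (3 * W - Y) - φ ^ 2 * Y) = φ * W ^ 2 :=
      mul_left_cancel₀ (pow_ne_zero 2 hφ0) (by linear_combination hZ')
    have hYW : φ ^ 2 * Y = W := by
      refine mul_left_cancel₀ hW0 ?_
      linear_combination -((2 + φ ^ 2) * h₁ + (1 + 2 * φ ^ 2) * h₂) / 24 +
        (W ^ 2 * (6 - 3 * φ) - 6 * (φ ^ 2 + φ - 1) * Y * W) / 24 * hφ2
    refine isSquaredNode_of_barthNode (p := ![0, ⟨-1, 1⟩, ⟨1, 1⟩, 2]) (by decide +kernel)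
      (W / 4) ?_ ?_ ?_ ?_ <;> simp [zsqrtFiveEmbedding] <;> grind
  by_cases hX0 : X = 0
  · exact key hX0 hY hZ hW
  by_cases hY0 : Y = 0
  · exact (key hY0 hZ hX (by rwa [← add_rotate])).rotate.rotate
  by_cases hZ0 : Z = 0
  · exact (key hZ0 hX hY (by rwa [add_rotate])).rotate
  have hX' := (mul_eq_zero_iff_left hX0).1 hX
  have hY' := (mul_eq_zero_iff_left hY0).1 hY
  have hZ' := (mul_eq_zero_iff_left hZ0).1 hZ
  have solve {p q r u : ℂ} (h₁ : φ ^ 2 * p - r = φ * u) (h₂ : φ ^ 2 * q - p = φ * u)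
      (h₃ : φ ^ 2 * r - q = φ * u) : p = u := by
    refine mul_left_cancel₀ (mul_ne_zero (by norm_num : (4 : ℂ) ≠ 0) (pow_ne_zero 3 hφ0)) ?_
    linear_combination φ ^ 4 * h₁ + φ ^ 2 * h₃ + h₂ +
      (φ * (φ ^ 2 + φ - 1) * u - (φ ^ 4 + φ ^ 3 + 2 * φ ^ 2 - φ + 1) * p) * hφ2
  obtain ⟨a, ha⟩ : ∃ a, φ ^ 2 * X - Y = a := ⟨_, rfl⟩
  obtain ⟨b, hb⟩ : ∃ b, φ ^ 2 * Y - Z = b := ⟨_, rfl⟩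
  obtain ⟨c, hc⟩ : ∃ c, φ ^ 2 * Z - X = c := ⟨_, rfl⟩
  rw [ha, hb, hc] at hX' hY' hZ'
  have e₁ : φ ^ 2 * (b * c) - a * b = φ * (φ ^ 2 * W ^ 2) := by linear_combination hX'
  have e₂ : φ ^ 2 * (c * a) - b * c = φ * (φ ^ 2 * W ^ 2) := by linear_combination hY'
  have e₃ : φ ^ 2 * (a * b) - c * a = φ * (φ ^ 2 * W ^ 2) := by linear_combination hZ'
  have hbc := solve e₁ e₂ e₃
  have hca := solve e₂ e₃ e₁
  have hab := solve e₃ e₁ e₂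
  have hne : φ ^ 2 * W ^ 2 ≠ 0 := mul_ne_zero (pow_ne_zero 2 hφ0) (pow_ne_zero 2 hW0)
  have hb0 : b ≠ 0 := by
    rintro rfl
    exact hne (by rw [← hab, mul_zero])
  have hc0 : c ≠ 0 := by
    rintro rfl
    exact hne (by rw [← hbc, mul_zero])
  obtain rfl : a = b := mul_left_cancel₀ hc0 (by linear_combination hca - hbc)
  obtain rfl : a = c := mul_left_cancel₀ hb0 (by linear_combination hab - hbc)
  have haW : a = φ * W := by
    linear_combination -(ha + hb + hc) / 3 + (φ ^ 2 - 1) * hW / 3 + W * hφ2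
  subst haW
  rw [solve ha hc hb, solve hb ha hc, solve hc hb ha]
  exact isSquaredNode_of_barthNode (p := ![1, 1, 1, 1]) (by decide +kernel) W
    (by simp) (by simp) (by simp) (by simp)

theorem exists_eq_smul_complexNode_of_barthGrad_eq_zero {v : Fin 4 → ℂ}
    (hv : barthGrad sqrtFive v = 0) : ∃ i, ∃ c : ℂ, v = c • complexNode i := by
  obtain ⟨φ, hφ⟩ : ∃ φ : ℂ, 2 * φ = 1 + sqrtFive := ⟨(1 + sqrtFive) / 2, by ring⟩
  have h5 := sqrtFive_mul_self
  refine IsSquaredNode.exists_eq_smul ?_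
  have hφ2 : φ ^ 2 = φ + 1 := by
    linear_combination (2 * φ + sqrtFive - 1) * hφ / 4 + sqrtFive_mul_self / 4
  have ht : 3 + sqrtFive = 2 * φ ^ 2 := by linear_combination -hφ - 2 * hφ2
  have he : 2 + sqrtFive = φ ^ 3 := by linear_combination -hφ - (φ + 1) * hφ2
  have he0 : φ ^ 3 ≠ 0 := by
    refine pow_ne_zero 3 ?_
    rintro rfl
    simp at hφ2
  have h (i : Fin 4) : v i ^ 2 * barthSquareGrad sqrtFive v i = 0 := by
    have hi : 2 * v i * barthSquareGrad sqrtFive v i = 0 := congrFun hv i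
    linear_combination v i * hi / 2
  have h₀ := h 0
  have h₁ := h 1
  have h₂ := h 2
  have h₃ := h 3
  simp only [barthSquareGrad, ht, he, Matrix.cons_val] at h₀ h₁ h₂ h₃
  generalize v 0 ^ 2 = X at *
  generalize v 1 ^ 2 = Y at *
  generalize v 2 ^ 2 = Z at *
  generalize v 3 ^ 2 = W at *
  have hWk : W * ((X + Y + Z - W) * (X + Y + Z - W - 2 * W)) = 0 :=
    mul_left_cancel₀ he0 (by linear_combination -h₃ / 2)
  rw [mul_eq_zero, mul_eq_zero] at hWk
  by_cases hW : W = 0 ∨ X + Y + Z = W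
  · have hk : W * (X + Y + Z - W) = 0 := by
      rwa [mul_eq_zero, sub_eq_zero]
    refine isSquaredNode_of_mul_eq_zero hφ ?_ ?_ ?_ hW
    · linear_combination h₀ / 8 + X * φ ^ 3 / 2 * hk
    · linear_combination h₁ / 8 + Y * φ ^ 3 / 2 * hk
    · linear_combination h₂ / 8 + Z * φ ^ 3 / 2 * hk
  · have hk : X + Y + Z = 3 * W := by grind
    refine isSquaredNode_of_add_eq hφ (by tauto) ?_ ?_ ?_ hk
    · linear_combination h₀ / 8 + X * φ ^ 3 * W / 2 * hk
    · linear_combination h₁ / 8 + Y * φ ^ 3 * W / 2 * hk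
    · linear_combination h₂ / 8 + Z * φ ^ 3 * W / 2 * hk

end BarthSingularities

/-- For every set of nodes of the Barth sextic, there is a nodal sextic with as many nodes. -/
theorem exists_nodal_sextic_of_set (S : Set (Fin 65)) :
    ∃ f : MvPolynomial (Fin 4) ℂ, Irreducible f ∧ f.IsHomogeneous 6 ∧
      {x : Projectivization ℂ (Fin 4 → ℂ) | ∀ i, eval x.rep (pderiv i f) = 0}.Finite ∧
      Nat.card {x : Projectivization ℂ (Fin 4 → ℂ) | ∀ i, eval x.rep (pderiv i f) = 0} =
        Nat.card S ∧
      ∀ x : Projectivization ℂ (Fin 4 → ℂ), (∀ i, eval x.rep (pderiv i f) = 0) →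
        (hessianAt f x.rep).rank = 3 := by
  obtain ⟨G, hG, hGv⟩ := exists_dual_sextics
  have hF := isHomogeneous_barthForm sqrtFive
  have hp (i : Fin 65) : (complexNode i (barthPivot i))⁻¹ ≠ 0 :=
    inv_ne_zero (complexNode_pivot_ne_zero i)
  have hgrad (i : Fin 65) : gradientAt (barthForm (C sqrtFive) X) (complexNode i) = 0 := by
    rw [gradientAt_barthForm, barthGrad_complexNode]
  refine exists_nodal_of_independent (v := fun i => (complexNode i (barthPivot i))⁻¹ •
    complexNode i) (k := barthPivot) (by norm_num) hF hG ?_ ?_ ?_ ?_ ?_ ?_ S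
  · exact fun i => inv_mul_cancel₀ (complexNode_pivot_ne_zero i)
  · intro i
    rw [gradientAt_smul hF, hgrad, smul_zero]
  · intro i w hw
    rw [hessianAt_smul hF, Matrix.smul_mulVec, smul_eq_zero_iff_right (pow_ne_zero _ (hp i))] at hw
    have hv : (hessianAt (barthForm (C sqrtFive) X) (complexNode i)).mulVec
        (complexNode i) = 0 := by
      rw [hessianAt_mulVec_self hF, hgrad, smul_zero]
    have hdet := det_minor_barthHess_complexNode_ne_zero i
    rw [← hessianAt_barthForm] at hdet
    obtain ⟨c, rfl⟩ := exists_eq_smul_of_det_minor_ne_zero hdet hv (complexNode_pivot_ne_zero i) hw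
    exact ⟨c * complexNode i (barthPivot i), by
      rw [smul_smul, mul_assoc, mul_inv_cancel₀ (complexNode_pivot_ne_zero i), mul_one]⟩
  · intro y _ hy
    rw [gradientAt_barthForm] at hy
    obtain ⟨i, c, rfl⟩ := exists_eq_smul_complexNode_of_barthGrad_eq_zero hy
    exact ⟨i, c * complexNode i (barthPivot i), by
      rw [smul_smul, mul_assoc, mul_inv_cancel₀ (complexNode_pivot_ne_zero i), mul_one]⟩
  · intro i
    rw [eval_smul_of_isHomogeneous (hG i), hGv, if_pos rfl, mul_one]
    exact pow_ne_zero _ (hp i)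
  · intro i j hij
    rw [eval_smul_of_isHomogeneous (hG j), hGv, if_neg hij.symm, mul_zero]

theorem exists_nodal_sextic (m : ℕ) (hm : m ≤ 65) :
    ∃ f : MvPolynomial (Fin 4) ℂ,
      Irreducible f ∧ f.IsHomogeneous 6 ∧
      {x : Projectivization ℂ (Fin 4 → ℂ) |
          ∀ i : Fin 4, eval x.rep (pderiv i f) = 0}.Finite ∧
      Nat.card {x : Projectivization ℂ (Fin 4 → ℂ) |
          ∀ i : Fin 4, eval x.rep (pderiv i f) = 0} = m ∧
      ∀ x : Projectivization ℂ (Fin 4 → ℂ),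
        (∀ i : Fin 4, eval x.rep (pderiv i f) = 0) →
        (Matrix.of fun i j : Fin 4 =>
          eval x.rep (pderiv i (pderiv j f))).rank = 3 := by
  obtain ⟨f, hirr, hf, hfin, hcard, hrank⟩ :=
    exists_nodal_sextic_of_set (Set.range (Fin.castLE hm))
  refine ⟨f, hirr, hf, hfin, ?_, hrank⟩
  rw [hcard, Nat.card_range_of_injective (Fin.castLE_injective hm), Nat.card_fin]
end

section
/- For every natural number m with 0 ≤ m ≤ 107, there exists an irreducible homogeneous polynomial f ∈ ℂ[x₀,x₁,x₂,x₃] of degree 8 such that the set of points of ℙ³(ℂ) at which all four partial derivatives of f vanish is finite of cardinality exactly m, and at every such point the 4×4 Hessian matrix of second partial derivatives of f has rank 3. -/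
open MvPolynomial

/-- The form `∑ k, pₖ xᵢᵏ xⱼⁿ⁻ᵏ` of degree `n` attached to a univariate polynomial
`p = ∑ pₖ Xᵏ`. -/
noncomputable def binaryForm {σ : Type*} (n : ℕ) (p : Polynomial ℂ) (i j : σ) :
    MvPolynomial σ ℂ :=
  ∑ k ∈ Finset.range (n + 1), C (p.coeff k) * X i ^ k * X j ^ (n - k)

namespace binaryForm

variable {σ : Type*} {n : ℕ} {p : Polynomial ℂ} {i j : σ}

theorem isHomogeneous (n : ℕ) (p : Polynomial ℂ) (i j : σ) :
    (binaryForm n p i j).IsHomogeneous n := by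
  refine IsHomogeneous.sum _ _ _ fun k hk => ?_
  have h := ((isHomogeneous_C σ (p.coeff k)).mul (isHomogeneous_X_pow (R := ℂ) i k)).mul
    (isHomogeneous_X_pow (R := ℂ) j (n - k))
  have hk' : k ≤ n := by simpa [Nat.lt_succ_iff] using hk
  rwa [show 0 + k + (n - k) = n by lia] at h

theorem pderiv_self (hij : i ≠ j) :
    pderiv i (binaryForm (n + 1) p i j) = binaryForm n p.derivative i j := by
  classical
  simp only [binaryForm, map_sum]
  rw [Finset.sum_range_succ']
  simp only [Derivation.leibniz, Derivation.leibniz_pow, pderiv_C, pderiv_X_self,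
    pderiv_X_of_ne hij.symm, Polynomial.coeff_derivative]
  simp only [smul_eq_mul, nsmul_eq_mul, map_mul, map_add, map_one, map_natCast]
  simp only [mul_zero, zero_mul, add_zero, zero_add, Nat.cast_zero, Nat.add_sub_cancel, mul_one,
    Nat.add_sub_add_right, Nat.cast_add, Nat.cast_one]
  exact Finset.sum_congr rfl fun k _ => by ring

theorem pderiv_of_ne {l : σ} (hi : i ≠ l) (hj : j ≠ l) : pderiv l (binaryForm n p i j) = 0 := by
  simp [binaryForm, Derivation.leibniz, Derivation.leibniz_pow, pderiv_X_of_ne hi,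
    pderiv_X_of_ne hj]

theorem eval_of_eq_zero {x : σ → ℂ} (hx : x j = 0) :
    eval x (binaryForm n p i j) = p.coeff n * x i ^ n := by
  simp only [binaryForm, map_sum]
  rw [Finset.sum_range_succ, Finset.sum_eq_zero]
  · simp
  · intro k hk
    have : n - k ≠ 0 := by have := Finset.mem_range.1 hk; lia
    simp [hx, this]

theorem eval_of_ne_zero {x : σ → ℂ} (hx : x j ≠ 0) (hp : p.natDegree ≤ n) :
    eval x (binaryForm n p i j) = x j ^ n * p.eval (x i / x j) := by
  rw [binaryForm, map_sum, Polynomial.eval_eq_sum_range' (Nat.lt_succ_of_le hp), Finset.mul_sum]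
  refine Finset.sum_congr rfl fun k hk => ?_
  have hk' : k ≤ n := by simpa [Nat.lt_succ_iff] using hk
  have : x j ^ n = x j ^ k * x j ^ (n - k) := by rw [← pow_add]; congr 1; lia
  simp only [map_mul, eval_C, map_pow, eval_X, div_pow, this]
  field_simp

end binaryForm

/-- The homogenization, as a form of degree `n` in `x₀, x₁, x₂, x₃`, of
`p₀(x₀) + p₁(x₁) + p₂(x₂)`. -/
noncomputable def separatedForm (n : ℕ) (p : Fin 3 → Polynomial ℂ) : MvPolynomial (Fin 4) ℂ :=
  ∑ i : Fin 3, binaryForm n (p i) i.castSucc (Fin.last 3)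

namespace separatedForm

variable {n : ℕ} {p : Fin 3 → Polynomial ℂ}

theorem isHomogeneous (n : ℕ) (p : Fin 3 → Polynomial ℂ) : (separatedForm n p).IsHomogeneous n :=
  IsHomogeneous.sum _ _ _ fun _ _ => binaryForm.isHomogeneous _ _ _ _

theorem pderiv_castSucc (i : Fin 3) :
    pderiv i.castSucc (separatedForm (n + 1) p) =
      binaryForm n (p i).derivative i.castSucc (Fin.last 3) := by
  rw [separatedForm, map_sum, Finset.sum_eq_single i]
  · exact binaryForm.pderiv_self (Fin.castSucc_lt_last i).ne
  · intro k _ hk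
    exact binaryForm.pderiv_of_ne (by simpa using hk) (Fin.castSucc_lt_last i).ne'
  · simp

theorem finSuccEquiv_eq (n : ℕ) (p : Fin 3 → Polynomial ℂ) :
    finSuccEquiv ℂ 3 (separatedForm n p) =
      ∑ k ∈ Finset.range (n + 1), Polynomial.C (C ((p 0).coeff k) * X 2 ^ (n - k)) *
          Polynomial.X ^ k +
        Polynomial.C (binaryForm n (p 1) 0 2 + binaryForm n (p 2) 1 2) := by
  have hC (c : ℂ) : finSuccEquiv ℂ 3 (C c) = Polynomial.C (C c) := by
    simp [finSuccEquiv_apply]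
  have h0 (q : Polynomial ℂ) : finSuccEquiv ℂ 3 (binaryForm n q 0 (Fin.succ 2)) =
      ∑ k ∈ Finset.range (n + 1), Polynomial.C (C (q.coeff k) * X 2 ^ (n - k)) *
        Polynomial.X ^ k := by
    simp only [binaryForm, map_sum, map_mul, map_pow, finSuccEquiv_X_zero, finSuccEquiv_X_succ, hC]
    exact Finset.sum_congr rfl fun k _ => mul_right_comm _ _ _
  have hsucc (q : Polynomial ℂ) (i j : Fin 3) :
      finSuccEquiv ℂ 3 (binaryForm n q i.succ j.succ) = Polynomial.C (binaryForm n q i j) := by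
    simp only [binaryForm, map_sum, map_mul, map_pow, finSuccEquiv_X_succ, hC]
  rw [separatedForm, Fin.sum_univ_three, map_add, map_add, ← h0, Polynomial.C_add, ← hsucc,
    ← hsucc, add_assoc]
  rfl

theorem coeff_finSuccEquiv (n : ℕ) (p : Fin 3 → Polynomial ℂ) (k : ℕ) :
    (finSuccEquiv ℂ 3 (separatedForm n p)).coeff k =
      (if k ≤ n then C ((p 0).coeff k) * X 2 ^ (n - k) else 0) +
        if k = 0 then binaryForm n (p 1) 0 2 + binaryForm n (p 2) 1 2 else 0 := by
  rw [finSuccEquiv_eq, Polynomial.coeff_add, Polynomial.coeff_C, Polynomial.finsetSum_coeff]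
  congr 1
  simp_rw [Polynomial.coeff_C_mul_X_pow]
  simp

/-- A polynomial in the square of the maximal ideal of a point has vanishing gradient there. -/
theorem eval_pderiv_eq_zero_of_mem_sq {σ : Type*} {x : σ → ℂ} {g : MvPolynomial σ ℂ}
    (hg : g ∈ RingHom.ker (eval x) ^ 2) (i : σ) : eval x (pderiv i g) = 0 := by
  rw [pow_two] at hg
  refine Submodule.mul_induction_on hg (fun a ha b hb => ?_) fun a b ha hb => ?_
  · rw [RingHom.mem_ker] at ha hb
    simp [Derivation.leibniz, ha, hb]
  · simp [ha, hb]

theorem irreducible (hp : ∀ i, (p i).natDegree = n + 1) : Irreducible (separatedForm (n + 1) p) := by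
  have hlead (i) : (p i).coeff (n + 1) ≠ 0 := by
    have : p i ≠ 0 := by rintro h; simpa [h] using hp i
    rw [← hp i]; simpa using this
  obtain ⟨z, hz⟩ := IsAlgClosed.exists_pow_nat_eq
    (-(p 2).coeff (n + 1) / (p 1).coeff (n + 1)) n.succ_pos
  have hz0 : z ≠ 0 := by
    rintro rfl
    rw [zero_pow n.succ_ne_zero, eq_comm, div_eq_zero_iff] at hz
    simp [hlead] at hz
  rw [← MulEquiv.irreducible_iff (finSuccEquiv ℂ 3)]
  set F := finSuccEquiv ℂ 3 (separatedForm (n + 1) p) with hF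
  have hcoeff := coeff_finSuccEquiv (n + 1) p
  rw [← hF] at hcoeff
  have htop : F.coeff (n + 1) = C ((p 0).coeff (n + 1)) := by simp [hcoeff]
  have hdeg : F.natDegree = n + 1 := by
    refine Polynomial.natDegree_eq_of_le_of_coeff_ne_zero ?_ (by simpa [htop] using hlead 0)
    rw [Polynomial.natDegree_le_iff_coeff_eq_zero]
    intro N hN
    rw [hcoeff, if_neg (by lia), if_neg (by lia), add_zero]
  have hF0 : F ≠ 0 := by rintro h; simp [h] at hdeg
  have hunit : IsUnit F.leadingCoeff := by
    rw [Polynomial.leadingCoeff, hdeg, htop]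
    exact (IsUnit.mk0 _ (hlead 0)).map C
  set x : Fin 3 → ℂ := ![z, 1, 0] with hx
  refine Polynomial.irreducible_of_eisenstein_criterion (P := RingHom.ker (eval x))
    (RingHom.ker_isPrime _) ?_ ?_ ?_ ?_ ?_
  · rw [RingHom.mem_ker]
    exact (hunit.map (eval x)).ne_zero
  · intro k hk
    rw [Polynomial.degree_eq_natDegree hF0, hdeg, Nat.cast_lt] at hk
    have hk' : n + 1 - k ≠ 0 := by lia
    rw [RingHom.mem_ker, hcoeff, if_pos hk.le]
    split_ifs with h
    · simp only [map_add, map_mul, map_pow, eval_C, eval_X,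
        binaryForm.eval_of_eq_zero (show x 2 = 0 from rfl)]
      simp only [hx, Matrix.cons_val, zero_pow hk', hz]
      field_simp [hlead 1]
      ring
    · simp [hx, hk']
  · rw [Polynomial.degree_eq_natDegree hF0, hdeg]
    exact_mod_cast n.succ_pos
  · intro h
    have h := eval_pderiv_eq_zero_of_mem_sq h 0
    rw [hcoeff, if_pos (Nat.zero_le _), if_pos rfl, map_add, map_add, map_add, map_add,
      binaryForm.pderiv_self (i := 0) (j := 2) (by decide),
      binaryForm.pderiv_of_ne (i := 1) (j := 2) (l := 0) (by decide) (by decide)] at h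
    rw [binaryForm.eval_of_eq_zero (show x 2 = 0 from rfl), Polynomial.coeff_derivative] at h
    have hn : (n : ℂ) + 1 ≠ 0 := by exact_mod_cast n.succ_ne_zero
    simp [Derivation.leibniz, Derivation.leibniz_pow, hlead, hx, hz0, hn] at h
  · rw [Polynomial.isPrimitive_iff_isUnit_of_C_dvd]
    intro r hr
    exact isUnit_of_dvd_unit ((Polynomial.C_dvd_iff_dvd_coeff _ _).1 hr _) hunit

theorem eval_of_ne_zero {x : Fin 4 → ℂ} (hx : x (Fin.last 3) ≠ 0) (hp : ∀ i, (p i).natDegree ≤ n) :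
    eval x (separatedForm n p) =
      x (Fin.last 3) ^ n * ∑ i, (p i).eval (x i.castSucc / x (Fin.last 3)) := by
  rw [separatedForm, map_sum, Finset.mul_sum]
  exact Finset.sum_congr rfl fun i _ => binaryForm.eval_of_ne_zero hx (hp i)

theorem gradient_eq_zero_iff (hp : ∀ i, (p i).natDegree = n + 2) {x : Fin 4 → ℂ} (hx : x ≠ 0) :
    (∀ i, eval x (pderiv i (separatedForm (n + 2) p)) = 0) ↔
      x (Fin.last 3) ≠ 0 ∧ (∀ i, (p i).derivative.eval (x i.castSucc / x (Fin.last 3)) = 0) ∧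
        ∑ i, (p i).eval (x i.castSucc / x (Fin.last 3)) = 0 := by
  have hlead (i) : (p i).coeff (n + 2) ≠ 0 := by
    have : p i ≠ 0 := by rintro h; simpa [h] using hp i
    rw [← hp i]; simpa using this
  have hder (i) : (p i).derivative.natDegree ≤ n + 1 :=
    (Polynomial.natDegree_derivative_le _).trans (by simp [hp])
  have euler := congrArg (eval x) (isHomogeneous (n + 2) p).sum_X_mul_pderiv
  rw [Fin.sum_univ_castSucc] at euler
  simp only [map_add, map_sum, map_mul, eval_X, map_nsmul] at euler
  constructor
  · intro h
    have hlast : x (Fin.last 3) ≠ 0 := by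
      intro h0
      refine hx (funext fun j => Fin.lastCases h0 (fun i => ?_) j)
      have hi := h i.castSucc
      rw [pderiv_castSucc, binaryForm.eval_of_eq_zero h0, Polynomial.coeff_derivative] at hi
      have hn : (n : ℂ) + 1 + 1 ≠ 0 := by exact_mod_cast (n + 1).succ_ne_zero
      simpa [hlead, hn] using hi
    refine ⟨hlast, fun i => ?_, ?_⟩
    · have hi := h i.castSucc
      rw [pderiv_castSucc, binaryForm.eval_of_ne_zero hlast (hder i)] at hi
      simpa [hlast, -Fin.reduceLast] using hi
    · rw [h, Finset.sum_eq_zero, eq_comm, eval_of_ne_zero hlast fun i => (hp i).le] at euler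
      · simpa [hlast, -Fin.reduceLast, show (n : ℂ) + 2 ≠ 0 by exact_mod_cast (n + 1).succ_ne_zero]
          using euler
      · intro i _
        rw [h, mul_zero]
  · rintro ⟨hlast, hcrit, hsum⟩
    have hi (i : Fin 3) :
        eval x (binaryForm (n + 1) (p i).derivative i.castSucc (Fin.last 3)) = 0 := by
      rw [binaryForm.eval_of_ne_zero hlast (hder i), hcrit, mul_zero]
    refine fun j => Fin.lastCases ?_ (fun i => ?_) j
    · rw [eval_of_ne_zero hlast fun i => (hp i).le, hsum] at euler
      simpa [pderiv_castSucc, hi, hlast, -Fin.reduceLast] using euler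
    · rw [pderiv_castSucc, hi]

theorem rank_hessian (hp : ∀ i, (p i).natDegree = n + 2) (hsep : ∀ i, (p i).derivative.Separable)
    {x : Fin 4 → ℂ} (hx : x ≠ 0)
    (h : ∀ i, eval x (pderiv i (separatedForm (n + 2) p)) = 0) :
    (Matrix.of fun i j : Fin 4 =>
      eval x (pderiv i (pderiv j (separatedForm (n + 2) p)))).rank = 3 := by
  set M := Matrix.of fun i j : Fin 4 => eval x (pderiv i (pderiv j (separatedForm (n + 2) p)))
    with hM
  obtain ⟨hlast, hcrit, -⟩ := (gradient_eq_zero_iff hp hx).1 h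
  apply le_antisymm
  · have hker : x ∈ LinearMap.ker M.transpose.mulVecLin := by
      rw [LinearMap.mem_ker, Matrix.mulVecLin_apply, Matrix.mulVec_transpose]
      funext j
      have euler := congrArg (eval x) ((isHomogeneous (n + 2) p).pderiv (i := j)).sum_X_mul_pderiv
      simpa [h, Matrix.vecMul, dotProduct, hM] using euler
    have : Nontrivial (LinearMap.ker M.transpose.mulVecLin) :=
      nontrivial_of_ne ⟨x, hker⟩ 0 fun h0 => hx (congrArg Subtype.val h0)
    have hpos := Module.finrank_pos (R := ℂ) (M := LinearMap.ker M.transpose.mulVecLin)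
    have hsum := M.transpose.mulVecLin.finrank_range_add_finrank_ker
    rw [Module.finrank_fin_fun] at hsum
    rw [← Matrix.rank_transpose, Matrix.rank]
    lia
  · have hdiag (i j : Fin 3) : M i.castSucc j.castSucc =
        if i = j then x (Fin.last 3) ^ n *
          (p j).derivative.derivative.eval (x j.castSucc / x (Fin.last 3)) else 0 := by
      rw [hM, Matrix.of_apply, pderiv_castSucc]
      split_ifs with hij
      · subst hij
        rw [binaryForm.pderiv_self (Fin.castSucc_lt_last i).ne, binaryForm.eval_of_ne_zero hlast]
        refine (Polynomial.natDegree_derivative_le _).trans ?_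
        have := Polynomial.natDegree_derivative_le (p i)
        rw [hp] at this
        lia
      · rw [binaryForm.pderiv_of_ne (by simpa using Ne.symm hij) (Fin.castSucc_lt_last i).ne',
          map_zero]
    have hsub : M.submatrix Fin.castSucc Fin.castSucc =
        Matrix.diagonal fun i : Fin 3 => x (Fin.last 3) ^ n *
          (p i).derivative.derivative.eval (x i.castSucc / x (Fin.last 3)) := by
      ext i j
      rw [Matrix.submatrix_apply, hdiag, Matrix.diagonal_apply]
      split_ifs with hij
      · rw [hij]
      · rfl
    refine le_trans (le_of_eq ?_) (M.rank_submatrix_le Fin.castSucc Fin.castSucc)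
    rw [hsub, Matrix.rank_diagonal]
    have hne (i) : (p i).derivative.derivative.eval (x i.castSucc / x (Fin.last 3)) ≠ 0 := by
      simpa using (hsep i).eval₂_derivative_ne_zero (RingHom.id ℂ) (hcrit i)
    simp [hlast, hne, -Fin.reduceLast]

/-- The singular points of `separatedForm (n + 2) p` correspond to the triples of critical points
of the `pᵢ` whose critical values sum to zero. -/
theorem singularPoints_eq_image (hp : ∀ i, (p i).natDegree = n + 2) :
    {x : Projectivization ℂ (Fin 4 → ℂ) |
        ∀ i, eval x.rep (pderiv i (separatedForm (n + 2) p)) = 0} =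
      (fun a : Fin 3 → ℂ => Projectivization.mk ℂ (Fin.snoc a 1 : Fin 4 → ℂ)
          fun h => by simpa [-Fin.reduceLast] using congrFun h (Fin.last 3)) ''
        {a | (∀ i, (p i).derivative.eval (a i) = 0) ∧ ∑ i, (p i).eval (a i) = 0} := by
  ext x
  rw [Set.mem_ofPred_eq, gradient_eq_zero_iff hp x.rep_nonzero]
  constructor
  · rintro ⟨hlast, h⟩
    refine ⟨fun i => x.rep i.castSucc / x.rep (Fin.last 3), h, ?_⟩
    conv_rhs => rw [← x.mk_rep]
    rw [Projectivization.mk_eq_mk_iff']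
    refine ⟨(x.rep (Fin.last 3))⁻¹, funext fun j => Fin.lastCases ?_ (fun i => ?_) j⟩
    · simp [hlast, -Fin.reduceLast]
    · simp [div_eq_inv_mul]
  · rintro ⟨a, ha, rfl⟩
    dsimp only
    generalize_proofs h0
    obtain ⟨c, hc⟩ := Projectivization.exists_smul_eq_mk_rep ℂ _ h0
    have hlast : (Projectivization.mk ℂ _ h0).rep (Fin.last 3) = c := by
      simp [← hc, Units.smul_def, -Fin.reduceLast]
    have hi (i : Fin 3) : (Projectivization.mk ℂ _ h0).rep i.castSucc = c * a i := by
      simp [← hc, Units.smul_def, -Fin.reduceLast]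
    simpa [hlast, hi, -Fin.reduceLast] using ha

theorem mk_snoc_injective : Function.Injective fun a : Fin 3 → ℂ =>
    Projectivization.mk ℂ (Fin.snoc a 1 : Fin 4 → ℂ)
      fun h => by simpa [-Fin.reduceLast] using congrFun h (Fin.last 3) := by
  intro a b h
  obtain ⟨c, hc⟩ := (Projectivization.mk_eq_mk_iff' ..).1 h
  have h1 : c = 1 := by simpa [-Fin.reduceLast] using congrFun hc (Fin.last 3)
  funext i
  simpa [h1] using (congrFun hc i.castSucc).symm

end separatedForm

/-- `p` is an octic polynomial with seven distinct critical points, whose critical values are the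
elements of `V`, counted with multiplicity. -/
structure IsOcticWithCriticalValues (p : Polynomial ℂ) (V : Multiset ℤ) : Prop where
  natDegree_eq : p.natDegree = 8
  separable_derivative : p.derivative.Separable
  map_eval_roots : (p.derivative.roots.map fun a => p.eval a) = V.map fun v : ℤ => (v : ℂ)

namespace IsOcticWithCriticalValues

theorem sum_roots {p : Polynomial ℂ} {V : Multiset ℤ} (hp : IsOcticWithCriticalValues p V)
    (F : ℂ → ℕ) :
    ∑ a ∈ p.derivative.roots.toFinset, F (p.eval a) = (V.map fun v : ℤ => F v).sum := by
  classical
  have hnodup := Polynomial.nodup_roots hp.separable_derivative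
  rw [Finset.sum, Multiset.toFinset_val, hnodup.dedup]
  have := congrArg (fun W => (W.map F).sum) hp.map_eval_roots
  simpa [Multiset.map_map] using this

/-- The even octic `h(x²)`, where `h` is a quartic with distinct nonzero critical points. -/
theorem comp_X_sq {h : Polynomial ℂ} (hdeg : h.natDegree = 4) {k c₁ c₂ c₃ : ℂ} (hk : k ≠ 0)
    (hder : h.derivative = Polynomial.C k * ((Polynomial.X - Polynomial.C c₁) *
      (Polynomial.X - Polynomial.C c₂) * (Polynomial.X - Polynomial.C c₃)))
    (h₁ : c₁ ≠ 0) (h₂ : c₂ ≠ 0) (h₃ : c₃ ≠ 0) (h₁₂ : c₁ ≠ c₂) (h₁₃ : c₁ ≠ c₃) (h₂₃ : c₂ ≠ c₃)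
    {v v₁ v₂ v₃ : ℤ} (hv : h.eval 0 = v) (hv₁ : h.eval c₁ = v₁) (hv₂ : h.eval c₂ = v₂)
    (hv₃ : h.eval c₃ = v₃) :
    IsOcticWithCriticalValues (h.comp (Polynomial.X ^ 2)) {v, v₁, v₁, v₂, v₂, v₃, v₃} := by
  obtain ⟨s₁, rfl⟩ := IsAlgClosed.exists_pow_nat_eq c₁ two_pos
  obtain ⟨s₂, rfl⟩ := IsAlgClosed.exists_pow_nat_eq c₂ two_pos
  obtain ⟨s₃, rfl⟩ := IsAlgClosed.exists_pow_nat_eq c₃ two_pos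
  have hs {s : ℂ} (h : s ^ 2 ≠ 0) : s ≠ 0 ∧ s ≠ -s := by
    have : s ≠ 0 := fun h0 => h (by simp [h0])
    exact ⟨this, fun h0 => this (self_eq_neg.1 h0)⟩
  have hss {s t : ℂ} (h : s ^ 2 ≠ t ^ 2) : s ≠ t ∧ s ≠ -t ∧ -s ≠ t := by
    refine ⟨?_, ?_, ?_⟩ <;> rintro rfl <;> simp at h
  set R : Multiset ℂ := {0, s₁, -s₁, s₂, -s₂, s₃, -s₃} with hR
  have hprod : (h.comp (Polynomial.X ^ 2)).derivative =
      Polynomial.C (2 * k) * (R.map fun a => Polynomial.X - Polynomial.C a).prod := by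
    simp [Polynomial.derivative_comp, hder, hR, map_ofNat]
    ring
  have hk2 : 2 * k ≠ 0 := mul_ne_zero two_ne_zero hk
  have hroots : (h.comp (Polynomial.X ^ 2)).derivative.roots = R := by
    rw [hprod, Polynomial.roots_C_mul _ hk2, Polynomial.roots_multiset_prod_X_sub_C]
  have hnodup : R.Nodup := by
    simp [hR, hs h₁, hs h₂, hs h₃, hss h₁₂, hss h₁₃, hss h₂₃, (hs h₁).1.symm, (hs h₂).1.symm,
      (hs h₃).1.symm]
  refine ⟨by simp [Polynomial.natDegree_comp, hdeg], ?_, ?_⟩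
  · rw [← Polynomial.nodup_roots_iff_of_splits _ (IsAlgClosed.splits _), hroots]
    · exact hnodup
    · intro h0
      simp [h0, hR] at hroots
  · rw [hroots]
    simp [hR, hv, hv₁, hv₂, hv₃]

/-- An octic with critical values `u`, `v`, `w` of multiplicities four, two and one. -/
theorem exists_four_two_one {u v w : ℤ} (huv : u ≠ v) (huw : u ≠ w) :
    ∃ p, IsOcticWithCriticalValues p {w, v, v, u, u, u, u} := by
  have hl : ((v : ℂ) - u) ≠ 0 := by rw [sub_ne_zero]; exact_mod_cast huv.symm
  have hw : ((w : ℂ) - u) ≠ 0 := by rw [sub_ne_zero]; exact_mod_cast huw.symm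
  obtain ⟨t, ht, ht1⟩ : ∃ t : ℂ, t ^ 2 = (w - u) / (v - u) ∧ 1 + t ≠ 0 := by
    obtain ⟨t, ht⟩ := IsAlgClosed.exists_pow_nat_eq (((w : ℂ) - u) / (v - u)) two_pos
    by_cases h : 1 + t = 0
    · refine ⟨-t, by rw [neg_sq, ht], fun h' => ?_⟩
      have : (2 : ℂ) = 0 := by linear_combination h + h'
      norm_num at this
    · exact ⟨t, ht, h⟩
  have ht0 : t ≠ 0 := by
    rintro rfl
    rw [zero_pow two_ne_zero, eq_comm, div_eq_zero_iff] at ht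
    exact ht.elim hw hl
  obtain ⟨e, he⟩ := IsAlgClosed.exists_pow_nat_eq (1 + t) two_pos
  have he0 : e ≠ 0 := by rintro rfl; exact ht1 (by simpa using he.symm)
  have he1 : (e - 1) * (e + 1) ≠ 0 := fun h => ht0 (by linear_combination h - he)
  obtain ⟨he1, he2⟩ := mul_ne_zero_iff.1 he1
  rw [eq_div_iff hl] at ht
  set h : Polynomial ℂ := Polynomial.C (v - u : ℂ) *
    ((Polynomial.X + Polynomial.C e) ^ 4 - 2 * (Polynomial.X + Polynomial.C e) ^ 2) +
      Polynomial.C (v : ℂ) with hh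
  refine ⟨h.comp (Polynomial.X ^ 2), comp_X_sq (k := 4 * (v - u)) (c₁ := -e) (c₂ := 1 - e)
    (c₃ := -1 - e) ?_ ?_ ?_ ?_ ?_ ?_ ?_ ?_ ?_ ?_ ?_ ?_ ?_⟩
  · rw [hh]
    compute_degree!
    exact_mod_cast hl
  · exact mul_ne_zero (by norm_num) hl
  · simp [hh, Polynomial.derivative_pow, Polynomial.C_ofNat]
    ring
  · exact neg_ne_zero.2 he0
  · exact fun h => he1 (by linear_combination -h)
  · exact fun h => he2 (by linear_combination -h)
  · exact fun h => one_ne_zero (α := ℂ) (by linear_combination -h)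
  · exact fun h => one_ne_zero (α := ℂ) (by linear_combination h)
  · exact fun h => two_ne_zero (α := ℂ) (by linear_combination h)
  · simp [hh]
    linear_combination ht + (v - u) * (e ^ 2 - 1 + t) * he
  · simp [hh]
  · simp [hh]; ring
  · simp [hh]; ring

theorem exists_three_two_two :
    ∃ p, IsOcticWithCriticalValues p {0, -125, -125, 64, 64, 0, 0} := by
  set h : Polynomial ℂ := Polynomial.C 3 * Polynomial.X ^ 4 - Polynomial.C 44 * Polynomial.X ^ 3 +
    Polynomial.C 204 * Polynomial.X ^ 2 - Polynomial.C 288 * Polynomial.X with hh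
  refine ⟨h.comp (Polynomial.X ^ 2), comp_X_sq (k := 12) (c₁ := 1) (c₂ := 4)
    (c₃ := 6) ?_ ?_ ?_ ?_ ?_ ?_ ?_ ?_ ?_ ?_ ?_ ?_ ?_⟩
  · rw [hh]
    compute_degree!
  · norm_num
  · simp [hh, Polynomial.derivative_pow, Polynomial.C_ofNat]
    ring
  all_goals norm_num [hh]

end IsOcticWithCriticalValues

/-- The number of triples in `U × V × W`, counted with multiplicity, whose sum is zero. -/
def zeroSumCount (U V W : Multiset ℤ) : ℕ :=
  (U.map fun a => (V.map fun b => (W.map fun c => if a + b + c = 0 then 1 else 0).sum).sum).sum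

theorem ncard_zeroSum_criticalPoints {p : Fin 3 → Polynomial ℂ} {V : Fin 3 → Multiset ℤ}
    (hp : ∀ i, IsOcticWithCriticalValues (p i) (V i)) :
    {a : Fin 3 → ℂ | (∀ i, (p i).derivative.eval (a i) = 0) ∧ ∑ i, (p i).eval (a i) = 0}.Finite ∧
    {a : Fin 3 → ℂ | (∀ i, (p i).derivative.eval (a i) = 0) ∧ ∑ i, (p i).eval (a i) = 0}.ncard =
      zeroSumCount (V 0) (V 1) (V 2) := by
  classical
  set S := fun i => (p i).derivative.roots.toFinset with hS
  set T := ((S 0 ×ˢ S 1) ×ˢ S 2).filter fun a =>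
    (p 0).eval a.1.1 + (p 1).eval a.1.2 + (p 2).eval a.2 = 0 with hT
  have hmem (i) (a : ℂ) : a ∈ S i ↔ (p i).derivative.eval a = 0 := by
    have : (p i).derivative ≠ 0 := (hp i).separable_derivative.ne_zero
    simp [hS, this]
  have himage : {a : Fin 3 → ℂ | (∀ i, (p i).derivative.eval (a i) = 0) ∧
      ∑ i, (p i).eval (a i) = 0} =
      (fun a : (ℂ × ℂ) × ℂ => ![a.1.1, a.1.2, a.2]) '' (T : Set ((ℂ × ℂ) × ℂ)) := by
    ext a
    simp only [Set.mem_image, Finset.mem_coe, hT, Finset.mem_filter, Finset.mem_product, hmem,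
      Set.mem_ofPred_eq, Fin.forall_fin_succ, Fin.sum_univ_three]
    constructor
    · rintro ⟨⟨h0, h1, h2, -⟩, hs⟩
      exact ⟨((a 0, a 1), a 2), ⟨⟨⟨h0, h1⟩, h2⟩, hs⟩, by ext i; fin_cases i <;> rfl⟩
    · rintro ⟨b, ⟨⟨⟨h0, h1⟩, h2⟩, hs⟩, rfl⟩
      exact ⟨⟨h0, h1, h2, fun i => i.elim0⟩, hs⟩
  have hinj : Function.Injective fun a : (ℂ × ℂ) × ℂ => ![a.1.1, a.1.2, a.2] := by
    rintro ⟨⟨a, b⟩, c⟩ ⟨⟨a', b'⟩, c'⟩ h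
    simpa [and_assoc] using h
  rw [himage]
  refine ⟨T.finite_toSet.image _, ?_⟩
  rw [Set.ncard_image_of_injective _ hinj, Set.ncard_coe_finset, hT, Finset.card_filter,
    Finset.sum_product, Finset.sum_product]
  have h₂ (z : ℂ) : ∑ c ∈ S 2, (if z + (p 2).eval c = 0 then 1 else 0) =
      ((V 2).map fun w : ℤ => if z + (w : ℂ) = 0 then 1 else 0).sum :=
    (hp 2).sum_roots fun c => if z + c = 0 then 1 else 0
  have h₁ (z : ℂ) : ∑ b ∈ S 1,
        ((V 2).map fun w : ℤ => if z + (p 1).eval b + (w : ℂ) = 0 then 1 else 0).sum =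
      ((V 1).map fun v : ℤ =>
        ((V 2).map fun w : ℤ => if z + (v : ℂ) + (w : ℂ) = 0 then 1 else 0).sum).sum :=
    (hp 1).sum_roots fun b => ((V 2).map fun w : ℤ => if z + b + (w : ℂ) = 0 then 1 else 0).sum
  simp_rw [h₂, h₁]
  rw [(hp 0).sum_roots fun z =>
    ((V 1).map fun v : ℤ =>
        ((V 2).map fun w : ℤ => if z + (v : ℂ) + (w : ℂ) = 0 then 1 else 0).sum).sum]
  norm_cast

/-- Three octic polynomials with prescribed critical values give a nodal octic surface whose nodes
correspond to the zero sums of critical values. -/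
theorem exists_nodal_octic_of_criticalValues {U V W : Multiset ℤ}
    (hU : ∃ p, IsOcticWithCriticalValues p U) (hV : ∃ p, IsOcticWithCriticalValues p V)
    (hW : ∃ p, IsOcticWithCriticalValues p W) :
    ∃ f : MvPolynomial (Fin 4) ℂ,
      Irreducible f ∧ f.IsHomogeneous 8 ∧
      {x : Projectivization ℂ (Fin 4 → ℂ) |
          ∀ i : Fin 4, eval x.rep (pderiv i f) = 0}.Finite ∧
      Nat.card {x : Projectivization ℂ (Fin 4 → ℂ) |
          ∀ i : Fin 4, eval x.rep (pderiv i f) = 0} = zeroSumCount U V W ∧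
      ∀ x : Projectivization ℂ (Fin 4 → ℂ),
        (∀ i : Fin 4, eval x.rep (pderiv i f) = 0) →
        (Matrix.of fun i j : Fin 4 =>
          eval x.rep (pderiv i (pderiv j f))).rank = 3 := by
  obtain ⟨p₀, h₀⟩ := hU
  obtain ⟨p₁, h₁⟩ := hV
  obtain ⟨p₂, h₂⟩ := hW
  have hp : ∀ i, IsOcticWithCriticalValues (![p₀, p₁, p₂] i) (![U, V, W] i) := by
    simpa [Fin.forall_fin_succ] using ⟨h₀, h₁, h₂⟩
  have hdeg (i) := (hp i).natDegree_eq
  obtain ⟨hfin, hcard⟩ := ncard_zeroSum_criticalPoints hp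
  have himage := separatedForm.singularPoints_eq_image (n := 6) hdeg
  refine ⟨separatedForm 8 ![p₀, p₁, p₂], separatedForm.irreducible hdeg,
    separatedForm.isHomogeneous _ _, ?_, ?_, fun x hx => ?_⟩
  · rw [himage]
    exact hfin.image _
  · rw [himage, Nat.card_coe_set_eq,
      Set.ncard_image_of_injective _ separatedForm.mk_snoc_injective, hcard]
    rfl
  · exact separatedForm.rank_hessian hdeg (fun i => (hp i).separable_derivative) x.rep_nonzero hx

/-- The critical values of multiplicities four, two and one of an octic polynomial. -/
structure CriticalTriple where
  /-- the critical value of multiplicity four -/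
  u : ℤ
  /-- the critical value of multiplicity two -/
  v : ℤ
  /-- the critical value of multiplicity one -/
  w : ℤ

namespace CriticalTriple

/-- The seven critical values, with multiplicity. -/
def values (t : CriticalTriple) : Multiset ℤ :=
  {t.w, t.v, t.v, t.u, t.u, t.u, t.u}

/-- For `m ≤ 107` with `m ≠ 7`, the `m`-th entry consists of three triples whose values have
exactly `m` zero sums. -/
def table : List (CriticalTriple × CriticalTriple × CriticalTriple) :=
  [(⟨0, -3, -3⟩, ⟨0, -3, -3⟩, ⟨-7, -6, -6⟩),
   (⟨0, -3, -2⟩, ⟨0, -3, -2⟩, ⟨-7, -6, 4⟩),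
   (⟨0, -3, -2⟩, ⟨0, -3, -2⟩, ⟨-7, 4, -6⟩),
   (⟨0, -3, -3⟩, ⟨0, -3, -2⟩, ⟨-7, -6, 5⟩),
   (⟨0, -3, -3⟩, ⟨0, -3, -2⟩, ⟨-7, -6, 2⟩),
   (⟨0, -3, -2⟩, ⟨0, -3, 1⟩, ⟨-7, 5, 1⟩),
   (⟨0, -3, -3⟩, ⟨0, -3, -2⟩, ⟨-7, -6, 6⟩),
   (⟨0, 1, 1⟩, ⟨0, 1, 1⟩, ⟨0, 1, 1⟩),
   (⟨0, -3, -3⟩, ⟨0, -3, -2⟩, ⟨-7, 2, -6⟩),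
   (⟨0, -3, -3⟩, ⟨0, -3, -3⟩, ⟨-7, -6, 6⟩),
   (⟨0, -3, -3⟩, ⟨0, -3, -2⟩, ⟨-7, 5, 2⟩),
   (⟨0, -3, -3⟩, ⟨0, -3, -2⟩, ⟨-7, 2, 5⟩),
   (⟨0, -3, -3⟩, ⟨0, -3, -2⟩, ⟨-7, 2, 2⟩),
   (⟨0, -3, -2⟩, ⟨0, -3, 1⟩, ⟨-7, 2, 1⟩),
   (⟨0, -3, -3⟩, ⟨0, -3, -2⟩, ⟨-7, 2, 6⟩),
   (⟨0, -3, -3⟩, ⟨0, -3, -2⟩, ⟨-7, 6, 5⟩),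
   (⟨0, -3, -3⟩, ⟨0, -3, -3⟩, ⟨-7, -6, 0⟩),
   (⟨0, -3, -2⟩, ⟨0, -3, -2⟩, ⟨-7, 2, 4⟩),
   (⟨0, -3, -3⟩, ⟨0, -3, -3⟩, ⟨-7, 6, -6⟩),
   (⟨0, -3, -3⟩, ⟨0, -3, -2⟩, ⟨2, -7, 5⟩),
   (⟨0, -3, -3⟩, ⟨0, -3, -2⟩, ⟨-7, -6, 3⟩),
   (⟨0, -3, -2⟩, ⟨0, -3, -1⟩, ⟨-7, 4, 3⟩),
   (⟨0, -3, -3⟩, ⟨0, -3, -2⟩, ⟨-7, 5, 0⟩),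
   (⟨0, -3, -3⟩, ⟨0, -2, 1⟩, ⟨-7, 5, 2⟩),
   (⟨0, -3, -3⟩, ⟨0, -3, -3⟩, ⟨-7, -6, 3⟩),
   (⟨0, -3, -3⟩, ⟨0, -3, -2⟩, ⟨2, 5, 5⟩),
   (⟨0, -3, -3⟩, ⟨0, -3, -2⟩, ⟨-7, 5, 3⟩),
   (⟨0, -3, -3⟩, ⟨0, -3, -3⟩, ⟨-7, 6, 6⟩),
   (⟨0, -3, -3⟩, ⟨0, -3, -2⟩, ⟨-7, 2, 3⟩),
   (⟨0, -3, -2⟩, ⟨0, -3, -1⟩, ⟨4, 5, 3⟩),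
   (⟨0, -3, -3⟩, ⟨0, -3, -2⟩, ⟨5, 6, 6⟩),
   (⟨0, -3, -3⟩, ⟨0, -3, -2⟩, ⟨2, 6, 5⟩),
   (⟨0, -3, -3⟩, ⟨0, -3, -3⟩, ⟨-7, 0, -6⟩),
   (⟨0, -3, -3⟩, ⟨0, -3, -2⟩, ⟨6, 5, 5⟩),
   (⟨0, -3, -3⟩, ⟨0, -3, -3⟩, ⟨-7, 6, 0⟩),
   (⟨0, -3, -3⟩, ⟨0, -3, -2⟩, ⟨-7, 0, 5⟩),
   (⟨0, -3, -3⟩, ⟨0, -3, -3⟩, ⟨6, -7, -7⟩),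
   (⟨0, -3, -2⟩, ⟨0, -3, -1⟩, ⟨1, 4, 3⟩),
   (⟨0, -3, -3⟩, ⟨0, -3, -2⟩, ⟨-7, 0, 6⟩),
   (⟨0, -3, -3⟩, ⟨0, -2, 1⟩, ⟨-1, 5, 2⟩),
   (⟨0, -3, -3⟩, ⟨0, -3, -2⟩, ⟨-7, 3, -6⟩),
   (⟨0, -3, -3⟩, ⟨0, -3, -3⟩, ⟨-7, 0, 6⟩),
   (⟨0, -3, -3⟩, ⟨0, -3, -3⟩, ⟨-7, 6, 3⟩),
   (⟨0, -3, -3⟩, ⟨0, -3, -2⟩, ⟨-7, 3, 5⟩),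
   (⟨0, -3, -3⟩, ⟨0, -3, -2⟩, ⟨-7, 3, 2⟩),
   (⟨0, -3, -2⟩, ⟨0, -3, 3⟩, ⟨5, 0, -1⟩),
   (⟨0, -3, -3⟩, ⟨0, -3, -2⟩, ⟨-7, 3, 6⟩),
   (⟨0, -3, -3⟩, ⟨0, -3, 3⟩, ⟨-3, 6, 0⟩),
   (⟨0, -3, -3⟩, ⟨0, -3, -3⟩, ⟨-7, 0, 0⟩),
   (⟨0, -3, -3⟩, ⟨0, -2, 1⟩, ⟨-1, 2, 2⟩),
   (⟨0, -3, -3⟩, ⟨0, -3, -2⟩, ⟨5, 0, 6⟩),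
   (⟨0, -3, -3⟩, ⟨0, -3, -2⟩, ⟨2, 0, 5⟩),
   (⟨0, -3, -3⟩, ⟨0, -3, -3⟩, ⟨6, -7, 0⟩),
   (⟨0, -3, -2⟩, ⟨0, -3, 3⟩, ⟨-3, 0, -1⟩),
   (⟨0, -3, -3⟩, ⟨0, -3, -2⟩, ⟨2, 0, 6⟩),
   (⟨0, -3, -3⟩, ⟨0, 1, -2⟩, ⟨-1, 2, 5⟩),
   (⟨0, -3, -3⟩, ⟨0, -3, -3⟩, ⟨-7, 0, 3⟩),
   (⟨0, -3, -3⟩, ⟨0, -3, -3⟩, ⟨-7, 3, 6⟩),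
   (⟨0, -3, -3⟩, ⟨0, -3, -2⟩, ⟨5, 3, 6⟩),
   (⟨0, -3, -3⟩, ⟨0, -3, -2⟩, ⟨2, 3, 5⟩),
   (⟨0, -3, -3⟩, ⟨0, -3, -3⟩, ⟨6, -7, 3⟩),
   (⟨0, -3, -2⟩, ⟨0, -2, 1⟩, ⟨2, 4, 1⟩),
   (⟨0, -3, -3⟩, ⟨0, -3, -2⟩, ⟨2, 3, 6⟩),
   (⟨0, -3, -3⟩, ⟨0, -2, -1⟩, ⟨3, 5, 4⟩),
   (⟨0, -3, -3⟩, ⟨0, -3, -3⟩, ⟨-7, 3, 0⟩),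
   (⟨0, -3, -2⟩, ⟨0, -3, -2⟩, ⟨0, -7, 4⟩),
   (⟨0, -3, -3⟩, ⟨0, -3, 3⟩, ⟨6, 0, -3⟩),
   (⟨0, -3, -3⟩, ⟨0, -3, -2⟩, ⟨0, -7, 5⟩),
   (⟨0, -3, -3⟩, ⟨0, -3, -3⟩, ⟨6, 0, -7⟩),
   (⟨0, -3, -2⟩, ⟨0, -3, 1⟩, ⟨0, 5, 1⟩),
   (⟨0, -3, -3⟩, ⟨0, -3, -2⟩, ⟨0, -7, 6⟩),
   (⟨0, -3, -3⟩, ⟨0, -2, 1⟩, ⟨3, 5, 2⟩),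
   (⟨0, -3, -3⟩, ⟨0, -3, -3⟩, ⟨-7, 3, 3⟩),
   (⟨0, -3, -3⟩, ⟨0, -3, -3⟩, ⟨0, -7, 6⟩),
   (⟨0, -3, -3⟩, ⟨0, -3, -2⟩, ⟨0, 5, 2⟩),
   (⟨0, -3, -3⟩, ⟨0, -3, -2⟩, ⟨0, 2, 5⟩),
   (⟨0, -3, -3⟩, ⟨0, -3, -2⟩, ⟨0, 2, 2⟩),
   (⟨0, -3, -2⟩, ⟨0, -3, 1⟩, ⟨0, 2, 1⟩),
   (⟨0, -3, -3⟩, ⟨0, -3, -2⟩, ⟨0, 2, 6⟩),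
   (⟨0, -3, -3⟩, ⟨0, -3, -2⟩, ⟨0, 6, 5⟩),
   (⟨0, -3, -3⟩, ⟨0, -3, -2⟩, ⟨0, 6, 2⟩),
   (⟨0, -3, -3⟩, ⟨0, -3, 3⟩, ⟨6, 0, 0⟩),
   (⟨0, -3, -3⟩, ⟨0, -3, -3⟩, ⟨0, 6, -7⟩),
   (⟨0, -3, -3⟩, ⟨0, -3, -2⟩, ⟨3, -7, 5⟩),
   (⟨0, -3, -3⟩, ⟨0, -3, -3⟩, ⟨6, 0, 0⟩),
   (⟨0, -3, -2⟩, ⟨0, -3, -1⟩, ⟨0, 4, 3⟩),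
   (⟨0, -3, -3⟩, ⟨0, -3, -2⟩, ⟨3, -7, 6⟩),
   (⟨0, -3, -3⟩, ⟨0, -2, 1⟩, ⟨0, 5, 2⟩),
   (⟨0, -3, -3⟩, ⟨0, -3, -3⟩, ⟨0, -7, 3⟩),
   (⟨0, -3, -3⟩, ⟨0, -3, -2⟩, ⟨3, 5, 5⟩),
   (⟨0, -3, -3⟩, ⟨0, -3, -2⟩, ⟨0, 5, 3⟩),
   (⟨0, -3, -3⟩, ⟨0, -3, -3⟩, ⟨0, 6, 6⟩),
   (⟨0, -3, -3⟩, ⟨0, -3, -3⟩, ⟨6, 0, 3⟩),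
   (⟨0, -3, -2⟩, ⟨0, -2, -3⟩, ⟨0, 2, 5⟩),
   (⟨0, -3, -3⟩, ⟨0, -3, -2⟩, ⟨3, 2, 6⟩),
   (⟨0, -3, -3⟩, ⟨0, -3, -2⟩, ⟨3, 6, 5⟩),
   (⟨0, -3, -3⟩, ⟨0, -3, -3⟩, ⟨3, -7, -7⟩),
   (⟨0, -3, -3⟩, ⟨0, -2, -2⟩, ⟨0, 2, 5⟩),
   (⟨0, -3, -3⟩, ⟨0, -3, -2⟩, ⟨3, 6, 6⟩),
   (⟨0, -3, -3⟩, ⟨0, -3, 3⟩, ⟨3, -7, 0⟩),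
   (⟨0, -3, -3⟩, ⟨0, -3, -3⟩, ⟨6, 3, 0⟩),
   (⟨0, -3, -2⟩, ⟨0, -3, 3⟩, ⟨3, 0, -1⟩),
   (⟨0, -3, -3⟩, ⟨0, -3, -2⟩, ⟨3, 5, 0⟩),
   (⟨0, -1, -2⟩, ⟨0, -1, -1⟩, ⟨1, 2, 3⟩),
   (⟨0, -3, -3⟩, ⟨0, -3, -2⟩, ⟨0, 3, -7⟩),
   (⟨0, -3, -3⟩, ⟨0, -3, -3⟩, ⟨3, -7, 6⟩),
   (⟨0, -3, -3⟩, ⟨0, -3, -3⟩, ⟨0, 6, 3⟩),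
   (⟨0, -3, -3⟩, ⟨0, -3, -2⟩, ⟨0, 3, 5⟩)]

/-- The `m`-th entry of `table`. -/
def tableEntry (m : ℕ) : CriticalTriple × CriticalTriple × CriticalTriple :=
  table.getD m (⟨0, 1, 1⟩, ⟨0, 1, 1⟩, ⟨0, 1, 1⟩)

theorem zeroSumCount_tableEntry : ∀ m < 108, m ≠ 7 →
    ((tableEntry m).1.u ≠ (tableEntry m).1.v ∧ (tableEntry m).1.u ≠ (tableEntry m).1.w) ∧
      ((tableEntry m).2.1.u ≠ (tableEntry m).2.1.v ∧
        (tableEntry m).2.1.u ≠ (tableEntry m).2.1.w) ∧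
      ((tableEntry m).2.2.u ≠ (tableEntry m).2.2.v ∧
        (tableEntry m).2.2.u ≠ (tableEntry m).2.2.w) ∧
      zeroSumCount (tableEntry m).1.values (tableEntry m).2.1.values (tableEntry m).2.2.values =
        m := by
  decide +kernel

end CriticalTriple

theorem exists_nodal_octic (m : ℕ) (hm : m ≤ 107) :
    ∃ f : MvPolynomial (Fin 4) ℂ,
      Irreducible f ∧ f.IsHomogeneous 8 ∧
      {x : Projectivization ℂ (Fin 4 → ℂ) |
          ∀ i : Fin 4, eval x.rep (pderiv i f) = 0}.Finite ∧
      Nat.card {x : Projectivization ℂ (Fin 4 → ℂ) |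
          ∀ i : Fin 4, eval x.rep (pderiv i f) = 0} = m ∧
      ∀ x : Projectivization ℂ (Fin 4 → ℂ),
        (∀ i : Fin 4, eval x.rep (pderiv i f) = 0) →
        (Matrix.of fun i j : Fin 4 =>
          eval x.rep (pderiv i (pderiv j f))).rank = 3 := by
  rcases eq_or_ne m 7 with rfl | hm7
  · exact exists_nodal_octic_of_criticalValues
      IsOcticWithCriticalValues.exists_three_two_two
      (IsOcticWithCriticalValues.exists_four_two_one (u := 1000) (v := -64) (w := 0)
        (by decide) (by decide))
      (IsOcticWithCriticalValues.exists_four_two_one (u := 10000) (v := 20000) (w := 0)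
        (by decide) (by decide))
  · obtain ⟨h₀, h₁, h₂, hcount⟩ :=
      CriticalTriple.zeroSumCount_tableEntry m (Nat.lt_succ_of_le hm) hm7
    have h := exists_nodal_octic_of_criticalValues
      (IsOcticWithCriticalValues.exists_four_two_one h₀.1 h₀.2)
      (IsOcticWithCriticalValues.exists_four_two_one h₁.1 h₁.2)
      (IsOcticWithCriticalValues.exists_four_two_one h₂.1 h₂.2)
    rwa [← CriticalTriple.values, ← CriticalTriple.values, ← CriticalTriple.values, hcount] at h
end
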